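/- For all positive integers m, n there exist constants k# and C#, depending only on m and n, with the following property. Let E ⊂ ℝⁿ be an arbitrary (not necessarily finite) set and let f : E → [0,∞). Suppose that for each subset S ⊆ E with #(S) ≤ k# there exists F^S ∈ C^{m-1,1}(ℝⁿ) with ‖F^S‖_{C^{m-1,1}(ℝⁿ)} ≤ 1, F^S = f on S, and F^S ≥ 0 everywhere on ℝⁿ. Then there exists F ∈ C^{m-1,1}(ℝⁿ) with ‖F‖_{C^{m-1,1}(ℝⁿ)} ≤ C#, F = f on E, and F ≥ 0 everywhere on ℝⁿ. -/

import Mathlib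

open scoped BigOperators

noncomputable section

abbrev Euc (n : ℕ) : Type := EuclideanSpace ℝ (Fin n)
abbrev MPoly (n : ℕ) : Type := MvPolynomial (Fin n) ℝ

/-- Partial derivative in the `i`-th coordinate direction. -/
noncomputable def pD {n : ℕ} (i : Fin n) (F : Euc n → ℝ) : Euc n → ℝ :=
  fun x => fderiv ℝ F x (EuclideanSpace.single i (1 : ℝ))

/-- The multi-index partial derivative `∂^α F`. -/
noncomputable def mD {n : ℕ} (α : Fin n → ℕ) (F : Euc n → ℝ) : Euc n → ℝ :=
  (((List.finRange n).flatMap fun i => List.replicate (α i) i)).foldr pD F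

/-- Partial derivative within a set. -/
noncomputable def pDW {n : ℕ} (s : Set (Euc n)) (i : Fin n) (F : Euc n → ℝ) : Euc n → ℝ :=
  fun x => fderivWithin ℝ F s x (EuclideanSpace.single i (1 : ℝ))

/-- Multi-index partial derivative within a set. -/
noncomputable def mDW {n : ℕ} (s : Set (Euc n)) (α : Fin n → ℕ) (F : Euc n → ℝ) : Euc n → ℝ :=
  (((List.finRange n).flatMap fun i => List.replicate (α i) i)).foldr (pDW s) F

/-- The order `|α|` of a multi-index. -/
def deg {n : ℕ} (α : Fin n → ℕ) : ℕ := ∑ i, α i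

/-- Evaluation of an `n`-variable polynomial at a point of `ℝⁿ`. -/
noncomputable def peval {n : ℕ} (P : MPoly n) (x : Euc n) : ℝ :=
  MvPolynomial.eval (fun i => x i) P

/-- `F ∈ C^m(ℝⁿ)` with `‖F‖_{C^m(ℝⁿ)} ≤ M`. -/
def CmNormLe (m n : ℕ) (F : Euc n → ℝ) (M : ℝ) : Prop :=
  ContDiff ℝ (m : ℕ∞) F ∧ ∀ α : Fin n → ℕ, deg α ≤ m → ∀ x : Euc n, |mD α F x| ≤ M

/-- `F ∈ C^{m-1,1}(ℝⁿ)` with `‖F‖_{C^{m-1,1}(ℝⁿ)} ≤ M`. -/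
def CmLipNormLe (m n : ℕ) (F : Euc n → ℝ) (M : ℝ) : Prop :=
  ContDiff ℝ ((m - 1 : ℕ) : ℕ∞) F ∧
  (∀ α : Fin n → ℕ, deg α ≤ m - 1 → ∀ x : Euc n, |mD α F x| ≤ M) ∧
  (∀ α : Fin n → ℕ, deg α = m - 1 → ∀ i : Fin n, ∀ x : Euc n, ∀ t : ℝ,
    |mD α F (x + t • EuclideanSpace.single i (1 : ℝ)) - mD α F x| ≤ M * |t|)

/-- `J_x(F) = P`, i.e. `P` is the `(m-1)`-st order Taylor polynomial of `F` at `x`. -/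
def IsJetAt (m n : ℕ) (F : Euc n → ℝ) (x : Euc n) (P : MPoly n) : Prop :=
  P.totalDegree ≤ m - 1 ∧
  ∀ α : Fin n → ℕ, deg α ≤ m - 1 → mD α (peval P) x = mD α F x

/-- `J_x^+(F) = P`, i.e. `P` is the `m`-th order Taylor polynomial of `F` at `x`. -/
def IsJetPlusAt (m n : ℕ) (F : Euc n → ℝ) (x : Euc n) (P : MPoly n) : Prop :=
  P.totalDegree ≤ m ∧
  ∀ α : Fin n → ℕ, deg α ≤ m → mD α (peval P) x = mD α F x

/-- Truncation of a polynomial: keep the monomials of total degree `≤ d`. -/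
noncomputable def truncLE {n : ℕ} (d : ℕ) (P : MPoly n) : MPoly n :=
  ∑ s ∈ P.support.filter (fun s => (s.sum fun _ e => e) ≤ d),
    MvPolynomial.monomial s (P.coeff s)

/-- Substitution `y ↦ y + v` in a polynomial. -/
noncomputable def polyShift {n : ℕ} (v : Fin n → ℝ) (P : MPoly n) : MPoly n :=
  MvPolynomial.aeval (fun i => (MvPolynomial.X i + MvPolynomial.C (v i) : MPoly n)) P

/-- The `(m-1)`-st order Taylor polynomial of a polynomial `P` at `x`. -/
noncomputable def jetTrunc (m n : ℕ) (x : Euc n) (P : MPoly n) : MPoly n :=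
  polyShift (fun i => -(x i)) (truncLE (m - 1) (polyShift (fun i => x i) P))

/-- Multiplication of `(m-1)`-jets at `x`: `P ⊙_x Q = J_x(PQ)`. -/
noncomputable def jmul (m n : ℕ) (x : Euc n) (P Q : MPoly n) : MPoly n :=
  jetTrunc m n x (P * Q)

/-- `Γ*(x,M)`. -/
def GammaStar (m n : ℕ) (x : Euc n) (M : ℝ) : Set (MPoly n) :=
  {P | ∃ F : Euc n → ℝ, CmNormLe m n F M ∧ (∀ y, 0 ≤ F y) ∧ IsJetAt m n F x P}

/-- `Γ_f(x,M)`. -/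
def GammaF (m n : ℕ) (f : Euc n → ℝ) (x : Euc n) (M : ℝ) : Set (MPoly n) :=
  {P ∈ GammaStar m n x M | peval P x = f x}

/-- `Γ'*(x,M)` (the `C^{m-1,1}` version). -/
def GammaStar' (m n : ℕ) (x : Euc n) (M : ℝ) : Set (MPoly n) :=
  {P | ∃ F : Euc n → ℝ, CmLipNormLe m n F M ∧ (∀ y, 0 ≤ F y) ∧ IsJetAt m n F x P}

/-- `Γ'_f(x,M)`. -/
def GammaF' (m n : ℕ) (f : Euc n → ℝ) (x : Euc n) (M : ℝ) : Set (MPoly n) :=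
  {P ∈ GammaStar' m n x M | peval P x = f x}

/-- `Γ₀⁺`. -/
def Gamma0plus (m n : ℕ) : Set (MPoly n) :=
  {P | P.totalDegree ≤ m ∧
    (∀ β : Fin n → ℕ, deg β ≤ m → |mD β (peval P) 0| ≤ 1) ∧
    (∀ x : Euc n, 0 ≤ peval P x + ‖x‖ ^ m) ∧
    (∀ ε : ℝ, 0 < ε → ∃ δ : ℝ, 0 < δ ∧ ∀ x : Euc n, ‖x‖ ≤ δ → 0 ≤ peval P x + ε * ‖x‖ ^ m)}

/-- `Γ̃₀'`. -/
def GammaTilde0' (m n : ℕ) : Set (MPoly n) :=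
  {P | P.totalDegree ≤ m - 1 ∧
    (∀ β : Fin n → ℕ, deg β ≤ m - 1 → |mD β (peval P) 0| ≤ 1) ∧
    ∀ x : Euc n, 0 ≤ peval P x + ‖x‖ ^ m}

/-- The closed axis-parallel cube with center `c` and sidelength `δ`. -/
def cube {n : ℕ} (c : Euc n) (δ : ℝ) : Set (Euc n) :=
  {y | ∀ i, |y i - c i| ≤ δ / 2}

/-- `F ∈ C^{m-1,1}(Q)` with `‖F‖_{C^{m-1,1}(Q)} ≤ M`, for the cube `Q` of center `c`,
sidelength `δ`. -/
def CmLipOnCubeLe (m n : ℕ) (c : Euc n) (δ : ℝ) (F : Euc n → ℝ) (M : ℝ) : Prop :=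
  ContDiffOn ℝ ((m - 1 : ℕ) : ℕ∞) F (cube c δ) ∧
  (∀ α : Fin n → ℕ, deg α ≤ m - 1 → ∀ x ∈ cube c δ, |mDW (cube c δ) α F x| ≤ M) ∧
  (∀ α : Fin n → ℕ, deg α = m - 1 → ∀ i : Fin n, ∀ x ∈ cube c δ, ∀ t : ℝ,
    x + t • EuclideanSpace.single i (1 : ℝ) ∈ cube c δ →
    |mDW (cube c δ) α F (x + t • EuclideanSpace.single i (1 : ℝ)) - mDW (cube c δ) α F x|
      ≤ M * |t|)

open scoped BigOperators

noncomputable section SecP1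
namespace NNI

open MvPolynomial

variable {n r : ℕ}

abbrev Ix (n r : ℕ) : Type := {β : Fin n →₀ ℕ // β.degree ≤ r}

instance instFintypeIx : Fintype (Ix n r) :=
  Set.Finite.fintype (Finsupp.finite_of_degree_le (σ := Fin n) r)

/-- Jets of order `r`, as vectors of Taylor coefficients. -/
abbrev Jet (n r : ℕ) : Type := Ix n r → ℝ

/-- degree of an index -/
abbrev dg (β : Ix n r) : ℕ := β.1.degree

def z0 : Ix n r := ⟨0, by simp⟩

def toPoly : Jet n r →ₗ[ℝ] MPoly n :=
  ∑ β : Ix n r, (monomial β.1).comp (LinearMap.proj β)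

def ofPoly : MPoly n →ₗ[ℝ] Jet n r := LinearMap.pi fun β => lcoeff ℝ β.1

lemma toPoly_apply (p : Jet n r) : toPoly p = ∑ β : Ix n r, monomial β.1 (p β) := by
  simp [toPoly]

@[simp] lemma ofPoly_apply (q : MPoly n) (β : Ix n r) : ofPoly q β = coeff β.1 q := rfl

lemma coeff_toPoly (p : Jet n r) (γ : Fin n →₀ ℕ) :
    coeff γ (toPoly p) = if h : γ.degree ≤ r then p ⟨γ, h⟩ else 0 := by
  classical
  rw [toPoly_apply, coeff_sum]
  simp only [coeff_monomial]
  split_ifs with h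
  · rw [Finset.sum_eq_single ⟨γ, h⟩]
    · simp
    · intro b _ hb
      rw [if_neg]
      intro hh; exact hb (Subtype.ext hh)
    · simp
  · apply Finset.sum_eq_zero
    intro b _
    rw [if_neg]
    intro hh; exact h (hh ▸ b.2)

@[simp] lemma ofPoly_toPoly (p : Jet n r) : ofPoly (toPoly p) = p := by
  ext β
  simp [coeff_toPoly, β.2]

lemma coeff_eq_zero_of_deg {q : MPoly n} {γ : Fin n →₀ ℕ} (h : q.totalDegree < γ.degree) :
    coeff γ q = 0 := by
  by_contra hc
  have := le_totalDegree (mem_support_iff.2 hc)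
  have h2 : (γ.sum fun _ e => e) = γ.degree := rfl
  omega

lemma toPoly_ofPoly {q : MPoly n} (h : q.totalDegree ≤ r) : toPoly (ofPoly q : Jet n r) = q := by
  ext γ
  rw [coeff_toPoly]
  split_ifs with hγ
  · rfl
  · rw [coeff_eq_zero_of_deg]; omega

lemma totalDegree_toPoly (p : Jet n r) : (toPoly p).totalDegree ≤ r := by
  rw [toPoly_apply]
  refine totalDegree_finsetSum_le ?_
  intro β _
  exact (totalDegree_monomial_le _ _).trans β.2

/-- weighted l1 norm on polynomials -/
def NN (δ : ℝ) (q : MPoly n) : ℝ := ∑ β ∈ q.support, |coeff β q| * δ ^ β.degree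

lemma NN_eq (δ : ℝ) (q : MPoly n) {s : Finset (Fin n →₀ ℕ)} (h : q.support ⊆ s) :
    NN δ q = ∑ β ∈ s, |coeff β q| * δ ^ β.degree := by
  apply Finset.sum_subset h
  intro x _ hx
  simp [notMem_support_iff.1 hx]

lemma NN_nonneg {δ : ℝ} (hδ : 0 ≤ δ) (q : MPoly n) : 0 ≤ NN δ q :=
  Finset.sum_nonneg fun _ _ => by positivity

@[simp] lemma NN_zero (δ : ℝ) : NN δ (0 : MPoly n) = 0 := by simp [NN]

lemma NN_add {δ : ℝ} (hδ : 0 ≤ δ) (p q : MPoly n) : NN δ (p + q) ≤ NN δ p + NN δ q := by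
  classical
  have h1 : (p + q).support ⊆ p.support ∪ q.support := support_add
  rw [NN_eq δ _ h1, NN_eq δ p (Finset.subset_union_left (s₂ := q.support)),
    NN_eq δ q (Finset.subset_union_right (s₁ := p.support)), ← Finset.sum_add_distrib]
  apply Finset.sum_le_sum
  intro β _
  rw [coeff_add, ← add_mul]
  gcongr
  exact abs_add_le _ _

lemma NN_sum {ι : Type*} {δ : ℝ} (hδ : 0 ≤ δ) (s : Finset ι) (p : ι → MPoly n) :
    NN δ (∑ i ∈ s, p i) ≤ ∑ i ∈ s, NN δ (p i) := by
  classical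
  induction s using Finset.induction_on with
  | empty => simp
  | insert a s ha ih =>
    rw [Finset.sum_insert ha, Finset.sum_insert ha]
    exact (NN_add hδ _ _).trans (by gcongr)

lemma NN_monomial (δ : ℝ) (γ : Fin n →₀ ℕ) (c : ℝ) :
    NN δ (monomial γ c) = |c| * δ ^ γ.degree := by
  classical
  rw [NN_eq δ _ (support_monomial_subset)]
  simp

lemma NN_smul (δ : ℝ) (c : ℝ) (p : MPoly n) : NN δ (c • p) = |c| * NN δ p := by
  rw [NN_eq δ _ (support_smul), NN, Finset.mul_sum]
  apply Finset.sum_congr rfl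
  intro β _
  simp [abs_mul, mul_assoc]

lemma NN_mul {δ : ℝ} (hδ : 0 ≤ δ) (p q : MPoly n) : NN δ (p * q) ≤ NN δ p * NN δ q := by
  classical
  have : p * q = ∑ a ∈ p.support, ∑ b ∈ q.support, monomial (a + b) (coeff a p * coeff b q) := by
    conv_lhs => rw [p.as_sum, q.as_sum]
    rw [Finset.sum_mul_sum]
    simp [monomial_mul]
  rw [this]
  refine (NN_sum hδ _ _).trans ?_
  rw [NN, NN, Finset.sum_mul_sum]
  apply Finset.sum_le_sum
  intro a _
  refine (NN_sum hδ _ _).trans ?_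
  apply Finset.sum_le_sum
  intro b _
  rw [NN_monomial, map_add, pow_add, abs_mul]
  apply le_of_eq; ring

lemma NN_one_le {δ : ℝ} : NN δ (1 : MPoly n) = 1 := by
  have := NN_monomial δ (0 : Fin n →₀ ℕ) 1
  simpa using this

lemma NN_pow {δ : ℝ} (hδ : 0 ≤ δ) (p : MPoly n) (k : ℕ) : NN δ (p ^ k) ≤ NN δ p ^ k := by
  induction k with
  | zero => simp [NN_one_le]
  | succ k ih =>
    rw [pow_succ, pow_succ]
    exact (NN_mul hδ _ _).trans (mul_le_mul_of_nonneg_right ih (NN_nonneg hδ _))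

lemma NN_prod {ι : Type*} {δ : ℝ} (hδ : 0 ≤ δ) (s : Finset ι) (p : ι → MPoly n) :
    NN δ (∏ i ∈ s, p i) ≤ ∏ i ∈ s, NN δ (p i) := by
  classical
  induction s using Finset.induction_on with
  | empty => simp [NN_one_le]
  | insert a s ha ih =>
    rw [Finset.prod_insert ha, Finset.prod_insert ha]
    exact (NN_mul hδ _ _).trans (mul_le_mul_of_nonneg_left ih (NN_nonneg hδ _))

lemma NN_mono {δ δ' : ℝ} (hδ : 0 ≤ δ) (h : δ ≤ δ') (p : MPoly n) : NN δ p ≤ NN δ' p := by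
  apply Finset.sum_le_sum
  intro b _
  gcongr

/-- substitution `X ↦ X + h` -/
def shift (h : Euc n) : MPoly n →ₐ[ℝ] MPoly n := aeval (fun i => X i + C (h i))

lemma shift_monomial (h : Euc n) (γ : Fin n →₀ ℕ) (c : ℝ) :
    shift h (monomial γ c) = C c * ∏ i, (X i + C (h i)) ^ γ i := by
  rw [shift, aeval_monomial, Finsupp.prod_fintype _ _ (by simp)]
  rfl

lemma NN_shift {δ : ℝ} (hδ : 0 ≤ δ) (h : Euc n) (q : MPoly n) :
    NN δ (shift h q) ≤ NN (δ + ‖h‖) q := by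
  conv_lhs => rw [q.as_sum]
  rw [map_sum]
  refine (NN_sum hδ _ _).trans ?_
  apply Finset.sum_le_sum
  intro γ _
  rw [shift_monomial]
  refine (NN_mul hδ _ _).trans ?_
  have hC : NN δ (C (coeff γ q) : MPoly n) = |coeff γ q| := by
    have := NN_monomial δ (0 : Fin n →₀ ℕ) (coeff γ q)
    simpa using this
  rw [hC]
  gcongr
  refine (NN_prod hδ _ _).trans ?_
  rw [Finsupp.degree_eq_sum, ← Finset.prod_pow_eq_pow_sum]
  apply Finset.prod_le_prod
  · intro i _; exact NN_nonneg hδ _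
  · intro i _
    refine (NN_pow hδ _ _).trans ?_
    refine pow_le_pow_left₀ (NN_nonneg hδ _) ?_ _
    refine (NN_add hδ _ _).trans ?_
    have h1 : NN δ (X i : MPoly n) = δ := by
      have := NN_monomial δ (Finsupp.single i 1) 1
      simpa [X] using this
    have h2 : NN δ (C (h i) : MPoly n) = |h i| := by
      have := NN_monomial δ (0 : Fin n →₀ ℕ) (h i)
      simpa using this
    rw [h1, h2]
    gcongr
    exact PiLp.norm_apply_le h i

lemma shift_shift (h k : Euc n) (q : MPoly n) : shift h (shift k q) = shift (h + k) q := by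
  have : (shift h).comp (shift k) = shift (h + k) := by
    apply MvPolynomial.algHom_ext
    intro i
    simp [shift]
    ring
  exact DFunLike.congr_fun this q

lemma shift_zero (q : MPoly n) : shift 0 q = q := by
  have : shift (0 : Euc n) = AlgHom.id ℝ (MPoly n) := by
    apply MvPolynomial.algHom_ext
    intro i
    simp [shift]
  rw [this]; rfl

lemma totalDegree_shift (h : Euc n) (q : MPoly n) : (shift h q).totalDegree ≤ q.totalDegree := by
  conv_lhs => rw [q.as_sum, map_sum]
  refine totalDegree_finsetSum_le ?_
  intro γ hγ
  rw [shift_monomial]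
  refine (totalDegree_mul _ _).trans ?_
  rw [totalDegree_C, zero_add]
  refine (totalDegree_finsetProd _ _).trans ?_
  refine le_trans ?_ (le_totalDegree hγ)
  have h2 : (γ.sum fun _ e => e) = γ.degree := rfl
  rw [h2, Finsupp.degree_eq_sum]
  apply Finset.sum_le_sum
  intro i _
  refine (totalDegree_pow _ _).trans ?_
  have : (X i + C (h i) : MPoly n).totalDegree ≤ 1 := by
    refine (totalDegree_add _ _).trans ?_
    simp
  nlinarith

/-! ### jets -/

/-- weighted norm on jets -/
def N (δ : ℝ) (p : Jet n r) : ℝ := ∑ β, |p β| * δ ^ dg β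

lemma NN_toPoly (δ : ℝ) (p : Jet n r) : NN δ (toPoly p) = N δ p := by
  classical
  have hs : (toPoly p).support ⊆ Finset.univ.image (fun β : Ix n r => β.1) := by
    intro γ hγ
    have := mem_support_iff.1 hγ
    rw [coeff_toPoly] at this
    split_ifs at this with h
    · simp only [Finset.mem_image, Finset.mem_univ, true_and]
      exact ⟨⟨γ, h⟩, rfl⟩
    · exact absurd rfl this
  rw [NN_eq δ _ hs, Finset.sum_image (fun a _ b _ h => Subtype.ext h)]
  apply Finset.sum_congr rfl
  intro β _
  simp [coeff_toPoly, β.2]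

lemma N_ofPoly {δ : ℝ} (hδ : 0 ≤ δ) (q : MPoly n) : N δ (ofPoly q : Jet n r) ≤ NN δ q := by
  classical
  rw [NN_eq δ q (Finset.subset_union_left (s₂ := Finset.univ.image (fun β : Ix n r => β.1)))]
  rw [N]
  have := Finset.sum_image (s := (Finset.univ : Finset (Ix n r))) (g := fun β : Ix n r => β.1)
    (f := fun β : Fin n →₀ ℕ => |coeff β q| * δ ^ β.degree) (fun a _ b _ h => Subtype.ext h)
  simp only [ofPoly_apply]
  rw [← this]
  apply Finset.sum_le_sum_of_subset_of_nonneg Finset.subset_union_right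
  intros; positivity

lemma N_nonneg {δ : ℝ} (hδ : 0 ≤ δ) (p : Jet n r) : 0 ≤ N δ p :=
  Finset.sum_nonneg fun _ _ => by positivity

@[simp] lemma N_zero (δ : ℝ) : N δ (0 : Jet n r) = 0 := by simp [N]

lemma N_add {δ : ℝ} (hδ : 0 ≤ δ) (p q : Jet n r) : N δ (p + q) ≤ N δ p + N δ q := by
  rw [N, N, N, ← Finset.sum_add_distrib]
  apply Finset.sum_le_sum
  intro β _
  rw [← add_mul]
  gcongr
  exact abs_add_le _ _

lemma N_smul (δ c : ℝ) (p : Jet n r) : N δ (c • p) = |c| * N δ p := by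
  simp [N, Finset.mul_sum, abs_mul, mul_assoc]

@[simp] lemma N_neg (δ : ℝ) (p : Jet n r) : N δ (-p) = N δ p := by simp [N]

lemma N_sub {δ : ℝ} (hδ : 0 ≤ δ) (p q : Jet n r) : N δ (p - q) ≤ N δ p + N δ q := by
  rw [sub_eq_add_neg, ← N_neg δ q]; exact N_add hδ _ _

lemma N_sub_comm (δ : ℝ) (p q : Jet n r) : N δ (p - q) = N δ (q - p) := by
  rw [← N_neg, neg_sub]

lemma N_sub_le {δ : ℝ} (hδ : 0 ≤ δ) (p q s : Jet n r) :
    N δ (p - s) ≤ N δ (p - q) + N δ (q - s) := by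
  have := N_add hδ (p - q) (q - s)
  simpa using this

lemma N_sum {ι : Type*} {δ : ℝ} (hδ : 0 ≤ δ) (s : Finset ι) (p : ι → Jet n r) :
    N δ (∑ i ∈ s, p i) ≤ ∑ i ∈ s, N δ (p i) := by
  classical
  induction s using Finset.induction_on with
  | empty => simp
  | insert a s ha ih =>
    rw [Finset.sum_insert ha, Finset.sum_insert ha]
    exact (N_add hδ _ _).trans (by gcongr)

lemma N_mono {δ δ' : ℝ} (hδ : 0 ≤ δ) (h : δ ≤ δ') (p : Jet n r) : N δ p ≤ N δ' p := by
  apply Finset.sum_le_sum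
  intro b _
  gcongr

lemma coeff_le_N {δ : ℝ} (hδ : 0 ≤ δ) (p : Jet n r) (β : Ix n r) :
    |p β| * δ ^ dg β ≤ N δ p :=
  Finset.single_le_sum (f := fun β => |p β| * δ ^ dg β) (fun _ _ => by positivity)
    (Finset.mem_univ β)

lemma abs_le_N1 (p : Jet n r) (β : Ix n r) : |p β| ≤ N 1 p := by
  have := coeff_le_N (zero_le_one) p β
  simpa using this

lemma N_eq_zero {δ : ℝ} (hδ : 0 < δ) {p : Jet n r} (h : N δ p = 0) : p = 0 := by
  ext β
  have := coeff_le_N hδ.le p β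
  rw [h] at this
  have h2 : 0 < δ ^ dg β := by positivity
  have h3 : |p β| ≤ 0 := by
    by_contra hc
    push Not at hc
    nlinarith [mul_pos hc h2]
  simpa using h3

/-- growing scale, `t ≥ 1` -/
lemma N_scale_up {δ t : ℝ} (hδ : 0 ≤ δ) (ht : 1 ≤ t) (p : Jet n r) :
    N (t * δ) p ≤ t ^ r * N δ p := by
  rw [N, N, Finset.mul_sum]
  apply Finset.sum_le_sum
  intro β _
  rw [mul_pow]
  have : t ^ dg β ≤ t ^ r := pow_le_pow_right₀ ht β.2
  have h0 : 0 ≤ |p β| * δ ^ dg β := by positivity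
  calc |p β| * (t ^ dg β * δ ^ dg β) = t ^ dg β * (|p β| * δ ^ dg β) := by ring
    _ ≤ _ := by gcongr

lemma NN_high {δ t : ℝ} {k : ℕ} (hδ : 0 ≤ δ) (ht : 0 ≤ t) (ht1 : t ≤ 1) (q : MPoly n)
    (hq : ∀ β, β.degree < k → coeff β q = 0) : NN (t * δ) q ≤ t ^ k * NN δ q := by
  rw [NN, NN, Finset.mul_sum]
  apply Finset.sum_le_sum
  intro β hβ
  have hk : k ≤ β.degree := by
    by_contra hc
    exact (mem_support_iff.1 hβ) (hq β (by omega))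
  rw [mul_pow]
  have : t ^ β.degree ≤ t ^ k := pow_le_pow_of_le_one ht ht1 hk
  have h0 : 0 ≤ |coeff β q| * δ ^ β.degree := by positivity
  calc |coeff β q| * (t ^ β.degree * δ ^ β.degree) = t ^ β.degree * (|coeff β q| * δ ^ β.degree) := by ring
    _ ≤ _ := by gcongr

/-- translation of jets -/
def tr (h : Euc n) : Jet n r →ₗ[ℝ] Jet n r :=
  ofPoly ∘ₗ (shift h).toLinearMap ∘ₗ toPoly

lemma tr_apply (h : Euc n) (p : Jet n r) : tr h p = ofPoly (shift h (toPoly p)) := rfl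

lemma toPoly_tr (h : Euc n) (p : Jet n r) : toPoly (tr h p) = shift h (toPoly p) := by
  rw [tr_apply, toPoly_ofPoly]
  exact (totalDegree_shift _ _).trans (totalDegree_toPoly _)

lemma tr_tr (h k : Euc n) (p : Jet n r) : tr h (tr k p) = tr (h + k) p := by
  rw [tr_apply, toPoly_tr, shift_shift]; rfl

@[simp] lemma tr_zero (p : Jet n r) : tr 0 p = p := by
  rw [tr_apply, shift_zero, ofPoly_toPoly]

lemma N_tr {δ : ℝ} (hδ : 0 ≤ δ) (h : Euc n) (p : Jet n r) : N δ (tr h p) ≤ N (δ + ‖h‖) p := by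
  rw [tr_apply]
  refine (N_ofPoly hδ _).trans ((NN_shift hδ _ _).trans ?_)
  rw [NN_toPoly]

/-- truncated product -/
def jm (p q : Jet n r) : Jet n r := ofPoly (toPoly p * toPoly q)

lemma N_jm {δ : ℝ} (hδ : 0 ≤ δ) (p q : Jet n r) : N δ (jm p q) ≤ N δ p * N δ q := by
  refine (N_ofPoly hδ _).trans ((NN_mul hδ _ _).trans ?_)
  rw [NN_toPoly, NN_toPoly]

lemma jm_add_right (p q s : Jet n r) : jm p (q + s) = jm p q + jm p s := by
  simp [jm, mul_add]
lemma jm_add_left (p q s : Jet n r) : jm (p + q) s = jm p s + jm q s := by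
  simp [jm, add_mul]
lemma jm_sub_right (p q s : Jet n r) : jm p (q - s) = jm p q - jm p s := by
  simp [jm, mul_sub]
lemma jm_sub_left (p q s : Jet n r) : jm (p - q) s = jm p s - jm q s := by
  simp [jm, sub_mul]
lemma jm_smul_right (c : ℝ) (p q : Jet n r) : jm p (c • q) = c • jm p q := by
  simp [jm]
lemma jm_smul_left (c : ℝ) (p q : Jet n r) : jm (c • p) q = c • jm p q := by
  simp [jm]
lemma jm_comm (p q : Jet n r) : jm p q = jm q p := by
  simp [jm, mul_comm]
@[simp] lemma jm_zero_left (q : Jet n r) : jm 0 q = 0 := by simp [jm]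
@[simp] lemma jm_zero_right (q : Jet n r) : jm q 0 = 0 := by simp [jm]

/-- `jm p` as a linear map -/
def jmL (p : Jet n r) : Jet n r →ₗ[ℝ] Jet n r where
  toFun := jm p
  map_add' := jm_add_right p
  map_smul' c q := jm_smul_right c p q

@[simp] lemma jmL_apply (p q : Jet n r) : jmL p q = jm p q := rfl

lemma ofPoly_mul_congr {a a' b b' : MPoly n} (ha : (ofPoly a : Jet n r) = ofPoly a')
    (hb : (ofPoly b : Jet n r) = ofPoly b') : (ofPoly (a * b) : Jet n r) = ofPoly (a' * b') := by
  classical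
  ext β
  simp only [ofPoly_apply, coeff_mul]
  apply Finset.sum_congr rfl
  rintro ⟨x, y⟩ hxy
  have h : x + y = β.1 := by simpa using hxy
  have hd : x.degree + y.degree ≤ r := by
    rw [← map_add, h]; exact β.2
  have h1 := congrFun ha ⟨x, by omega⟩
  have h2 := congrFun hb ⟨y, by omega⟩
  simp only [ofPoly_apply] at h1 h2
  rw [h1, h2]

lemma jm_ofPoly (a b : MPoly n) : jm (ofPoly a : Jet n r) (ofPoly b) = ofPoly (a * b) :=
  ofPoly_mul_congr (by simp) (by simp)

lemma jm_assoc (p q s : Jet n r) : jm (jm p q) s = jm p (jm q s) := by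
  have h1 : jm (jm p q) s = ofPoly (toPoly p * toPoly q * toPoly s) :=
    ofPoly_mul_congr (by simp [jm]) rfl
  have h2 : jm p (jm q s) = ofPoly (toPoly p * (toPoly q * toPoly s)) :=
    ofPoly_mul_congr rfl (by simp [jm])
  rw [h1, h2, mul_assoc]

def one : Jet n r := ofPoly 1

@[simp] lemma jm_one_left (q : Jet n r) : jm one q = q := by
  have : jm one q = ofPoly (1 * toPoly q) := ofPoly_mul_congr (by simp [one]) rfl
  simpa using this

@[simp] lemma tr_one (h : Euc n) : tr h (one : Jet n r) = one := by
  have : toPoly (one : Jet n r) = 1 := toPoly_ofPoly (by simp)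
  rw [tr_apply, this, map_one]; rfl

lemma N_one_eq (δ : ℝ) : N δ (one : Jet n r) = 1 := by
  have : toPoly (one : Jet n r) = 1 := toPoly_ofPoly (by simp)
  rw [← NN_toPoly, this, NN_one_le]

/-- value at the base point -/
def ev : Jet n r →ₗ[ℝ] ℝ := LinearMap.proj z0

lemma ev_apply (p : Jet n r) : ev p = p z0 := rfl

lemma ev_jm (p q : Jet n r) : ev (jm p q) = ev p * ev q := by
  have : ∀ p : Jet n r, p z0 = constantCoeff (toPoly p) := by
    intro p
    rw [constantCoeff_eq, coeff_toPoly]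
    simp [z0]
  have h2 : ev (jm p q) = constantCoeff (toPoly p * toPoly q) := rfl
  rw [h2, map_mul, ev_apply, ev_apply, this p, this q]

@[simp] lemma ev_one : ev (one : Jet n r) = 1 := by
  simp [ev_apply, one, z0]

lemma abs_ev_le {δ : ℝ} (hδ : 0 ≤ δ) (p : Jet n r) : |ev p| ≤ N δ p := by
  have := coeff_le_N hδ p z0
  have h2 : dg (z0 : Ix n r) = 0 := by simp [z0, dg]
  rw [h2, pow_zero, mul_one] at this
  exact this

/-- error of translation versus truncated product -/
lemma tr_jm_error {δ t : ℝ} (hδ : 0 ≤ δ) (ht1 : t ≤ 1) (h : Euc n)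
    (hh : 2 * ‖h‖ = t * δ) (ht : 0 ≤ t) (a b : Jet n r) :
    N ‖h‖ (jm (tr h a) (tr h b) - tr h (jm a b)) ≤ t ^ (r + 1) * (N δ a * N δ b) := by
  classical
  have e1 : jm (tr h a) (tr h b) = ofPoly (shift h (toPoly a * toPoly b)) := by
    rw [jm, toPoly_tr, toPoly_tr, map_mul (shift h)]
  set q := toPoly a * toPoly b with hq
  have e2 : jm (tr h a) (tr h b) - tr h (jm a b)
      = ofPoly (shift h (q - toPoly (ofPoly q : Jet n r))) := by
    rw [e1, map_sub, map_sub]; rfl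
  rw [e2]
  refine (N_ofPoly (norm_nonneg _) _).trans ((NN_shift (norm_nonneg _) _ _).trans ?_)
  have hcoef : ∀ β : Fin n →₀ ℕ, coeff β (q - toPoly (ofPoly q : Jet n r))
      = if β.degree ≤ r then 0 else coeff β q := by
    intro β
    rw [coeff_sub, coeff_toPoly]
    split_ifs <;> simp
  have e3 : ‖h‖ + ‖h‖ = t * δ := by linarith
  rw [e3]
  refine (NN_high (k := r + 1) hδ ht ht1 _ ?_).trans ?_
  · intro β hβ
    rw [hcoef, if_pos (by omega)]
  · gcongr
    have hs : (q - toPoly (ofPoly q : Jet n r)).support ⊆ q.support := by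
      intro β hβ
      have := mem_support_iff.1 hβ
      rw [hcoef] at this
      split_ifs at this with h1
      · exact absurd rfl this
      · exact mem_support_iff.2 this
    have : NN δ (q - toPoly (ofPoly q : Jet n r)) ≤ NN δ q := by
      rw [NN_eq δ _ hs, NN]
      apply Finset.sum_le_sum
      intro β _
      refine mul_le_mul_of_nonneg_right ?_ (by positivity)
      rw [hcoef]
      split_ifs
      · simp
      · exact le_rfl
    refine this.trans ((NN_mul hδ _ _).trans ?_)
    rw [NN_toPoly, NN_toPoly]

end NNI
end SecP1

open scoped BigOperators

noncomputable section SecP2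
namespace NNI

open MvPolynomial

variable {n r : ℕ}

/-- dilation of jets -/
def Dl (s : ℝ) : Jet n r →ₗ[ℝ] Jet n r where
  toFun p := fun β => s ^ dg β * p β
  map_add' p q := by ext β; simp [mul_add]
  map_smul' c p := by ext β; simp; ring

lemma Dl_apply (s : ℝ) (p : Jet n r) (β : Ix n r) : Dl s p β = s ^ dg β * p β := rfl

lemma Dl_one (p : Jet n r) : Dl 1 p = p := by ext β; simp [Dl_apply]

lemma Dl_Dl (s t : ℝ) (p : Jet n r) : Dl s (Dl t p) = Dl (s * t) p := by
  ext β; simp [Dl_apply, mul_pow, mul_assoc]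

lemma N_Dl {s δ : ℝ} (hs : 0 ≤ s) (p : Jet n r) : N δ (Dl s p) = N (s * δ) p := by
  simp only [N, Dl_apply, abs_mul, mul_pow]
  apply Finset.sum_congr rfl
  intro β _
  rw [abs_of_nonneg (pow_nonneg hs _)]; ring

def dil (s : ℝ) : MPoly n →ₐ[ℝ] MPoly n := aeval (fun i => C s * X i)

lemma dil_monomial (s : ℝ) (γ : Fin n →₀ ℕ) (c : ℝ) :
    dil s (monomial γ c) = monomial γ (s ^ γ.degree * c) := by
  rw [dil, aeval_monomial, Finsupp.prod_fintype _ _ (by simp)]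
  have h1 : (∏ i, (C s * X i : MPoly n) ^ γ i) = C (s ^ γ.degree) * ∏ i, X i ^ γ i := by
    rw [Finsupp.degree_eq_sum, ← Finset.prod_pow_eq_pow_sum, map_prod, ← Finset.prod_mul_distrib]
    simp [mul_pow]
  rw [h1, monomial_eq, Finsupp.prod_fintype _ _ (by simp), map_mul]
  simp only [algebraMap_eq]
  ring

lemma coeff_dil (s : ℝ) (q : MPoly n) (γ : Fin n →₀ ℕ) :
    coeff γ (dil s q) = s ^ γ.degree * coeff γ q := by
  classical
  induction q using MvPolynomial.induction_on' with
  | monomial u a =>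
    rw [dil_monomial, coeff_monomial, coeff_monomial]
    split_ifs with h
    · rw [h]
    · simp
  | add p q hp hq => rw [map_add, coeff_add, hp, hq, coeff_add]; ring

lemma toPoly_Dl (s : ℝ) (p : Jet n r) : toPoly (Dl s p) = dil s (toPoly p) := by
  ext γ
  rw [coeff_dil, coeff_toPoly, coeff_toPoly]
  split_ifs <;> simp [Dl_apply]

lemma ofPoly_dil (s : ℝ) (q : MPoly n) : (ofPoly (dil s q) : Jet n r) = Dl s (ofPoly q) := by
  ext γ
  simp [coeff_dil, Dl_apply]

lemma Dl_jm (s : ℝ) (p q : Jet n r) : Dl s (jm p q) = jm (Dl s p) (Dl s q) := by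
  rw [jm, jm, toPoly_Dl, toPoly_Dl, ← map_mul (dil s), ofPoly_dil]

lemma shift_dil (s : ℝ) (h : Euc n) (q : MPoly n) :
    shift h (dil s q) = dil s (shift (s • h) q) := by
  have : (shift h).comp (dil s) = (dil s).comp (shift (s • h)) := by
    apply MvPolynomial.algHom_ext
    intro i
    simp [shift, dil, mul_add]
  exact DFunLike.congr_fun this q

lemma tr_Dl (s : ℝ) (h : Euc n) (p : Jet n r) : tr h (Dl s p) = Dl s (tr (s • h) p) := by
  rw [tr_apply, toPoly_Dl, shift_dil, ofPoly_dil]; rfl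

@[simp] lemma ev_Dl (s : ℝ) (p : Jet n r) : ev (Dl s p) = ev p := by
  have h2 : dg (z0 : Ix n r) = 0 := by simp [z0, dg]
  rw [ev_apply, ev_apply, Dl_apply, h2, pow_zero, one_mul]

@[simp] lemma Dl_one' (s : ℝ) : Dl s (one : Jet n r) = one := by
  rw [one, ← ofPoly_dil, map_one]

/-! ### fields -/

def Wh (Ω : Set (Euc n)) (M : ℝ) (F : Euc n → Jet n r) : Prop :=
  ∀ x ∈ Ω, ∀ y ∈ Ω, N ‖x - y‖ (F x - tr (x - y) (F y)) ≤ M * ‖x - y‖ ^ (r + 1)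

/-- bounded field at scale `δ` -/
def Bd (Ω : Set (Euc n)) (δ A : ℝ) (a : Euc n → Jet n r) : Prop :=
  (∀ x ∈ Ω, N δ (a x) ≤ A) ∧
  ∀ x ∈ Ω, ∀ y ∈ Ω, ‖x - y‖ ≤ δ / 2 →
    N ‖x - y‖ (a x - tr (x - y) (a y)) ≤ A * (‖x - y‖ / δ) ^ (r + 1)

lemma Wh.mono {Ω Ω' : Set (Euc n)} {M M' : ℝ} {F : Euc n → Jet n r} (h : Wh Ω M F)
    (hΩ : Ω' ⊆ Ω) (hM : M ≤ M') : Wh Ω' M' F := fun x hx y hy =>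
  (h x (hΩ hx) y (hΩ hy)).trans (by gcongr)

lemma Wh.congr {Ω : Set (Euc n)} {M : ℝ} {F G : Euc n → Jet n r} (h : Wh Ω M F)
    (hFG : ∀ x ∈ Ω, G x = F x) : Wh Ω M G := fun x hx y hy => by
  rw [hFG x hx, hFG y hy]; exact h x hx y hy

lemma Bd.congr {Ω : Set (Euc n)} {δ A : ℝ} {F G : Euc n → Jet n r} (h : Bd Ω δ A F)
    (hFG : ∀ x ∈ Ω, G x = F x) : Bd Ω δ A G :=
  ⟨fun x hx => by rw [hFG x hx]; exact h.1 x hx,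
    fun x hx y hy hxy => by rw [hFG x hx, hFG y hy]; exact h.2 x hx y hy hxy⟩

lemma Wh.add {Ω : Set (Euc n)} {A B : ℝ} {a b : Euc n → Jet n r}
    (ha : Wh Ω A a) (hb : Wh Ω B b) : Wh Ω (A + B) (fun x => a x + b x) := by
  intro x hx y hy
  have h1 := ha x hx y hy
  have h2 := hb x hx y hy
  have h3 := N_add (norm_nonneg (x - y)) (a x - tr (x - y) (a y)) (b x - tr (x - y) (b y))
  have e : a x + b x - tr (x - y) (a y + b y)
    = (a x - tr (x - y) (a y)) + (b x - tr (x - y) (b y)) := by rw [map_add]; abel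
  simp only [e]
  linarith

lemma Wh.smul {Ω : Set (Euc n)} {A : ℝ} {a : Euc n → Jet n r} (c : ℝ)
    (ha : Wh Ω A a) : Wh Ω (|c| * A) (fun x => c • a x) := by
  intro x hx y hy
  have h1 := ha x hx y hy
  simp only [map_smul, ← smul_sub, N_smul, mul_assoc]
  gcongr

lemma Wh.sub {Ω : Set (Euc n)} {A B : ℝ} {a b : Euc n → Jet n r}
    (ha : Wh Ω A a) (hb : Wh Ω B b) : Wh Ω (A + B) (fun x => a x - b x) := by
  have h := hb.smul (-1)
  have h2 := ha.add h
  simp only [abs_neg, abs_one, one_mul, neg_smul, one_smul, ← sub_eq_add_neg] at h2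
  exact h2

lemma Bd.mono {Ω Ω' : Set (Euc n)} {δ δ' A A' : ℝ} {F : Euc n → Jet n r} (h : Bd Ω δ A F)
    (hΩ : Ω' ⊆ Ω) (hδ' : 0 < δ') (hδ : δ' ≤ δ) (hA : A ≤ A') (hA' : 0 ≤ A') : Bd Ω' δ' A' F := by
  refine ⟨fun x hx => (N_mono hδ'.le hδ _).trans ((h.1 x (hΩ hx)).trans hA), ?_⟩
  intro x hx y hy hxy
  refine (h.2 x (hΩ hx) y (hΩ hy) (by linarith)).trans ?_
  have : ‖x - y‖ / δ ≤ ‖x - y‖ / δ' := by gcongr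
  have h0 : 0 ≤ ‖x - y‖ / δ := div_nonneg (norm_nonneg _) (by linarith)
  gcongr

lemma Bd.nonneg {Ω : Set (Euc n)} {δ A : ℝ} {F : Euc n → Jet n r} (h : Bd Ω δ A F)
    (hδ : 0 ≤ δ) {x : Euc n} (hx : x ∈ Ω) : 0 ≤ A := (N_nonneg hδ _).trans (h.1 x hx)

lemma Bd.add {Ω : Set (Euc n)} {δ A B : ℝ} {a b : Euc n → Jet n r} (hδ : 0 ≤ δ)
    (ha : Bd Ω δ A a) (hb : Bd Ω δ B b) : Bd Ω δ (A + B) (fun x => a x + b x) := by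
  refine ⟨fun x hx => (N_add hδ _ _).trans (add_le_add (ha.1 x hx) (hb.1 x hx)), ?_⟩
  intro x hx y hy hxy
  have h1 := ha.2 x hx y hy hxy
  have h2 := hb.2 x hx y hy hxy
  have h3 := N_add (norm_nonneg (x - y)) (a x - tr (x - y) (a y)) (b x - tr (x - y) (b y))
  have e : a x + b x - tr (x - y) (a y + b y)
    = (a x - tr (x - y) (a y)) + (b x - tr (x - y) (b y)) := by rw [map_add]; abel
  simp only [e]
  linarith

lemma Bd.smul {Ω : Set (Euc n)} {δ A : ℝ} {a : Euc n → Jet n r} (c : ℝ)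
    (ha : Bd Ω δ A a) : Bd Ω δ (|c| * A) (fun x => c • a x) := by
  refine ⟨fun x hx => by rw [N_smul]; exact mul_le_mul_of_nonneg_left (ha.1 x hx) (abs_nonneg _), ?_⟩
  intro x hx y hy hxy
  have h1 := ha.2 x hx y hy hxy
  simp only [map_smul, ← smul_sub, N_smul, mul_assoc]
  gcongr

lemma Bd.sub {Ω : Set (Euc n)} {δ A B : ℝ} {a b : Euc n → Jet n r} (hδ : 0 ≤ δ)
    (ha : Bd Ω δ A a) (hb : Bd Ω δ B b) : Bd Ω δ (A + B) (fun x => a x - b x) := by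
  have h2 := ha.add hδ (hb.smul (-1))
  simp only [abs_neg, abs_one, one_mul, neg_smul, one_smul, ← sub_eq_add_neg] at h2
  exact h2

lemma Bd_of_Wh {Ω : Set (Euc n)} {δ M A : ℝ} {F : Euc n → Jet n r} (hδ : 0 < δ)
    (h : Wh Ω M F) (hM : M * δ ^ (r + 1) ≤ A) (hA : ∀ x ∈ Ω, N δ (F x) ≤ A) : Bd Ω δ A F := by
  refine ⟨hA, fun x hx y hy _ => (h x hx y hy).trans ?_⟩
  rw [div_pow, mul_div_assoc', le_div_iff₀ (by positivity)]
  have : 0 ≤ ‖x - y‖ ^ (r + 1) := by positivity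
  nlinarith

def pc (r : ℕ) : ℝ := 2 + 2 ^ (r + 1)

lemma pc_pos (r : ℕ) : 0 < pc r := by unfold pc; positivity
lemma one_le_pc (r : ℕ) : 1 ≤ pc r := by
  unfold pc
  have : (0:ℝ) ≤ 2 ^ (r + 1) := by positivity
  linarith

lemma Bd.jm {Ω : Set (Euc n)} {δ A B : ℝ} {a b : Euc n → Jet n r} (hδ : 0 < δ)
    (ha : Bd Ω δ A a) (hb : Bd Ω δ B b) : Bd Ω δ (pc r * (A * B)) (fun x => jm (a x) (b x)) := by
  constructor
  · intro x hx
    have hA := ha.nonneg hδ.le hx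
    have hB := hb.nonneg hδ.le hx
    refine (N_jm hδ.le _ _).trans ?_
    have h1 := mul_le_mul (ha.1 x hx) (hb.1 x hx) (N_nonneg hδ.le _) hA
    have : 0 ≤ A * B := by positivity
    nlinarith [one_le_pc r]
  · intro x hx y hy hxy
    have hA := ha.nonneg hδ.le hx
    have hB := hb.nonneg hδ.le hx
    set h := x - y with hh
    have h0 : 0 ≤ ‖h‖ := norm_nonneg _
    have e : NNI.jm (a x) (b x) - tr h (NNI.jm (a y) (b y))
        = (NNI.jm (a x - tr h (a y)) (b x) + NNI.jm (tr h (a y)) (b x - tr h (b y)))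
          + (NNI.jm (tr h (a y)) (tr h (b y)) - tr h (NNI.jm (a y) (b y))) := by
      rw [jm_sub_left, jm_sub_right]; abel
    have b1 : N ‖h‖ (NNI.jm (a x - tr h (a y)) (b x)) ≤ (A * (‖h‖ / δ) ^ (r + 1)) * B := by
      refine (N_jm h0 _ _).trans ?_
      refine mul_le_mul (ha.2 x hx y hy hxy) ?_ (N_nonneg h0 _) (by positivity)
      exact (N_mono h0 (by linarith) _).trans (hb.1 x hx)
    have b2 : N ‖h‖ (NNI.jm (tr h (a y)) (b x - tr h (b y))) ≤ A * (B * (‖h‖ / δ) ^ (r + 1)) := by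
      refine (N_jm h0 _ _).trans ?_
      refine mul_le_mul ?_ (hb.2 x hx y hy hxy) (N_nonneg h0 _) hA
      exact (N_tr h0 _ _).trans ((N_mono (by positivity) (by linarith) _).trans (ha.1 y hy))
    have b3 := tr_jm_error (δ := δ) (t := 2 * ‖h‖ / δ) hδ.le
      (by rw [div_le_one hδ]; linarith) h (by field_simp) (by positivity) (a y) (b y)
    have b4 : N δ (a y) * N δ (b y) ≤ A * B :=
      mul_le_mul (ha.1 y hy) (hb.1 y hy) (N_nonneg hδ.le _) hA
    have b5 : (2 * ‖h‖ / δ) ^ (r + 1) * (N δ (a y) * N δ (b y))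
        ≤ 2 ^ (r + 1) * (‖h‖ / δ) ^ (r + 1) * (A * B) := by
      rw [mul_div_assoc, mul_pow]
      gcongr
    simp only [e]
    refine (N_add h0 _ _).trans ?_
    refine (add_le_add_left (N_add h0 _ _) _).trans ?_
    unfold pc
    nlinarith

lemma LG {Ω : Set (Euc n)} (hΩ : Convex ℝ Ω) {M ε : ℝ} (hε : 0 < ε) (_hM : 0 ≤ M)
    {F : Euc n → Jet n r}
    (h : ∀ x ∈ Ω, ∀ y ∈ Ω, ‖x - y‖ ≤ ε → N ‖x - y‖ (F x - tr (x - y) (F y)) ≤ M * ‖x - y‖ ^ (r + 1)) :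
    Wh Ω (2 ^ r * M) F := by
  intro x hx y hy
  set d := x - y with hd
  have hd0 : 0 ≤ ‖d‖ := norm_nonneg _
  obtain ⟨K, hK⟩ := exists_nat_gt (‖d‖ / ε)
  have hKpos : 0 < (K : ℝ) := lt_of_le_of_lt (by positivity) hK
  have hKne : K ≠ 0 := by rintro rfl; simp at hKpos
  have hK1 : (1 : ℝ) ≤ K := by exact_mod_cast Nat.one_le_iff_ne_zero.2 hKne
  have hs : ‖d‖ / K ≤ ε := by
    rw [div_lt_iff₀ hε] at hK
    rw [div_le_iff₀ hKpos]; linarith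
  let z : ℕ → Euc n := fun i => y + ((i : ℝ) / K) • d
  have hz0 : z 0 = y := by simp [z]
  have hzK : z K = x := by simp [z, div_self hKpos.ne', hd]
  have hzΩ : ∀ i ≤ K, z i ∈ Ω := by
    intro i hi
    have := hΩ.add_smul_sub_mem hy hx (t := (i : ℝ) / K)
      ⟨by positivity, by rw [div_le_one hKpos]; exact_mod_cast hi⟩
    exact this
  have hzs : ∀ i, z (i + 1) - z i = ((1 : ℝ) / K) • d := by
    intro i
    simp only [z]
    push_cast
    rw [add_div, add_smul]; abel
  have hnorm : ∀ i, ‖z (i + 1) - z i‖ = ‖d‖ / K := by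
    intro i
    rw [hzs, norm_smul, Real.norm_of_nonneg (by positivity)]; ring
  have tele : ∀ k, k ≤ K → N ‖d‖ (tr (x - z k) (F (z k)) - tr d (F y))
      ≤ k * (2 ^ r * M * ‖d‖ ^ (r + 1) / K) := by
    intro k
    induction k with
    | zero => intro _; simp [hz0, hd]
    | succ k ih =>
      intro hk
      have ih := ih (by omega)
      have e1 : N ‖d‖ (tr (x - z (k + 1)) (F (z (k + 1))) - tr (x - z k) (F (z k)))
          ≤ 2 ^ r * M * ‖d‖ ^ (r + 1) / K := by
        have e2 : tr (x - z k) (F (z k))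
            = tr (x - z (k + 1)) (tr (z (k + 1) - z k) (F (z k))) := by
          rw [tr_tr]; congr 2; abel
        rw [e2, ← map_sub]
        refine (N_tr hd0 _ _).trans ?_
        have e3 : ‖x - z (k + 1)‖ ≤ ‖d‖ := by
          have : x - z (k + 1) = (1 - ((k + 1 : ℕ) : ℝ) / K) • d := by
            simp only [z, sub_smul, one_smul, hd]; abel
          rw [this, norm_smul]
          have h1 : ((k + 1 : ℕ) : ℝ) / K ≤ 1 := by
            rw [div_le_one hKpos]; exact_mod_cast hk
          have h2 : (0 : ℝ) ≤ ((k + 1 : ℕ) : ℝ) / K := by positivity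
          rw [Real.norm_of_nonneg (by linarith)]
          nlinarith
        have e4 : ‖d‖ + ‖x - z (k + 1)‖ ≤ (2 * K) * (‖d‖ / K) := by
          rw [mul_assoc, mul_div_cancel₀ _ hKpos.ne']; linarith
        refine (N_mono (by positivity) e4 _).trans ?_
        refine (N_scale_up (by positivity) (by linarith) _).trans ?_
        have h5 := h _ (hzΩ (k + 1) hk) _ (hzΩ k (by omega)) (by rw [hnorm]; exact hs)
        rw [hnorm] at h5
        calc (2 * (K : ℝ)) ^ r * N (‖d‖ / K) (F (z (k + 1)) - tr (z (k + 1) - z k) (F (z k)))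
            ≤ (2 * (K : ℝ)) ^ r * (M * (‖d‖ / K) ^ (r + 1)) := by gcongr
          _ = 2 ^ r * M * ‖d‖ ^ (r + 1) / K := by
            rw [mul_pow, div_pow, pow_succ, pow_succ (K : ℝ)]
            field_simp
      have := N_sub_le hd0 (tr (x - z (k + 1)) (F (z (k + 1)))) (tr (x - z k) (F (z k))) (tr d (F y))
      push_cast
      linarith
  have := tele K le_rfl
  rw [hzK] at this
  simp only [sub_self, tr_zero] at this
  refine this.trans (le_of_eq ?_)
  field_simp

lemma Wh_of_Bd {Ω : Set (Euc n)} (hΩ : Convex ℝ Ω) {δ A : ℝ} (hδ : 0 < δ) (hA : 0 ≤ A)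
    {F : Euc n → Jet n r} (h : Bd Ω δ A F) : Wh Ω (2 ^ r * (A / δ ^ (r + 1))) F := by
  refine LG hΩ (ε := δ / 2) (by positivity) (by positivity) ?_
  intro x hx y hy hxy
  refine (h.2 x hx y hy hxy).trans (le_of_eq ?_)
  rw [div_pow]; ring

/-- a fixed polynomial, viewed as a field -/
def cf (x0 : Euc n) (p : Jet n r) : Euc n → Jet n r := fun x => tr (x - x0) p

lemma tr_cf (x0 : Euc n) (p : Jet n r) (x y : Euc n) : tr (x - y) (cf x0 p y) = cf x0 p x := by
  simp only [cf, tr_tr]; congr 2; abel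

lemma cf_self (x0 : Euc n) (p : Jet n r) : cf x0 p x0 = p := by simp [cf]

lemma Wh_cf (Ω : Set (Euc n)) (x0 : Euc n) (p : Jet n r) : Wh Ω 0 (cf x0 p) := by
  intro x _ y _
  rw [tr_cf]; simp

end NNI
end SecP2

open scoped BigOperators

noncomputable section SecP3
namespace NNI

open MvPolynomial

variable {n r : ℕ}

/-- formal derivative of jets -/
def dj (i : Fin n) : Jet n r →ₗ[ℝ] Jet n r :=
  ofPoly ∘ₗ (pderiv i).toLinearMap ∘ₗ toPoly

lemma dj_apply (i : Fin n) (p : Jet n r) (β : Ix n r) :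
    dj i p β = coeff β.1 (pderiv i (toPoly p)) := rfl

lemma dj_lt (i : Fin n) (p : Jet n r) (β : Ix n r) (h : dg β < r) :
    dj i p β = p ⟨β.1 + Finsupp.single i 1, by rw [map_add, Finsupp.degree_single]; exact h⟩
      * (β.1 i + 1) := by
  rw [dj_apply, coeff_pderiv, coeff_toPoly, dif_pos]

lemma dj_eq (i : Fin n) (p : Jet n r) (β : Ix n r) (h : dg β = r) : dj i p β = 0 := by
  rw [dj_apply, coeff_pderiv, coeff_toPoly, dif_neg, zero_mul]
  rw [map_add, Finsupp.degree_single]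
  have : β.1.degree = r := h
  omega

abbrev pr (i : Fin n) : Euc n →L[ℝ] ℝ := EuclideanSpace.proj i

lemma norm_pr_le (i : Fin n) : ‖pr i‖ ≤ 1 := by
  apply ContinuousLinearMap.opNorm_le_bound _ zero_le_one
  intro v
  rw [one_mul]
  exact PiLp.norm_apply_le v i

lemma hasFDerivAt_coeff_shift (q : MPoly n) : ∀ (β : Fin n →₀ ℕ) (h : Euc n),
    HasFDerivAt (fun h => coeff β (shift h q))
      (∑ i, coeff β (pderiv i (shift h q)) • pr i) h := by
  classical
  induction q using MvPolynomial.induction_on with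
  | C a =>
    intro β h
    have : (fun h : Euc n => coeff β (shift h (C a : MPoly n))) = fun _ => coeff β (C a : MPoly n) := by
      ext h; simp [shift]
    rw [this]
    have h2 : ∀ i, pderiv i (shift h (C a : MPoly n)) = 0 := by
      intro i; simp [shift]
    simp only [h2, coeff_zero, zero_smul, Finset.sum_const_zero]
    exact hasFDerivAt_const _ _
  | add p q hp hq =>
    intro β h
    have := (hp β h).add (hq β h)
    simp only [map_add, coeff_add, add_smul, Finset.sum_add_distrib]
    exact this
  | mul_X p j hp =>
    intro β h
    have e : ∀ h : Euc n, shift h (p * X j) = shift h p * X j + C (h j) * shift h p := by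
      intro h
      rw [map_mul, shift, aeval_X]; ring
    have hX : HasFDerivAt (fun h : Euc n => coeff β (shift h p * X j))
        (∑ i, coeff β (pderiv i (shift h p) * X j) • pr i) h := by
      simp only [coeff_mul_X']
      split_ifs
      · exact hp _ h
      · simp only [zero_smul, Finset.sum_const_zero]; exact hasFDerivAt_const _ _
    have hj : HasFDerivAt (fun h : Euc n => h j) (pr j) h := (pr j).hasFDerivAt
    have hY := hj.mul (hp β h)
    have hZ := hX.add hY
    simp only [e, coeff_add, coeff_C_mul]
    refine hZ.congr_fderiv ?_
    have e2 : ∀ i, pderiv i (shift h p * X j + C (h j) * shift h p)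
        = pderiv i (shift h p) * X j + (if i = j then shift h p else 0)
          + C (h j) * pderiv i (shift h p) := by
      intro i
      rw [map_add, Derivation.leibniz, Derivation.leibniz, pderiv_X, pderiv_C]
      simp only [smul_eq_mul, add_zero, mul_zero]
      by_cases hij : i = j
      · subst hij; simp; ring
      · rw [Pi.single_eq_of_ne (Ne.symm hij), if_neg hij]; simp; ring
    simp only [e2, coeff_add, coeff_C_mul, add_smul, Finset.sum_add_distrib, Finset.smul_sum,
      mul_smul]
    have e3 : ∑ x : Fin n, coeff β (if x = j then shift h p else 0) • pr x
        = coeff β (shift h p) • pr j := by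
      rw [Finset.sum_eq_single j]
      · simp
      · intro b _ hb; simp [hb]
      · simp
    rw [e3]
    abel

lemma hasFDerivAt_tr (p : Jet n r) (β : Ix n r) (h : Euc n) :
    HasFDerivAt (fun h => tr h p β) (∑ i, dj i (tr h p) β • pr i) h := by
  have := hasFDerivAt_coeff_shift (toPoly p) β.1 h
  simp only [dj_apply, toPoly_tr]
  exact this

lemma tr_top (p : Jet n r) (β : Ix n r) (hβ : dg β = r) (h : Euc n) : tr h p β = p β := by
  have hd : ∀ h, HasFDerivAt (fun h => tr h p β) (0 : Euc n →L[ℝ] ℝ) h := by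
    intro h
    have := hasFDerivAt_tr p β h
    simpa [dj_eq _ _ β hβ] using this
  have := is_const_of_fderiv_eq_zero (𝕜 := ℝ) (f := fun h => tr h p β)
    (fun h => (hd h).differentiableAt) (fun h => (hd h).fderiv) h 0
  simpa using this

/-- the gradient condition -/
def IsGr (G : Euc n → Jet n r) : Prop := ∀ (β : Ix n r), dg β < r → ∀ x,
  HasFDerivAt (fun x => G x β) (∑ i, dj i (G x) β • pr i) x

lemma norm_grad_le (a : Fin n → ℝ) {K : ℝ} (h : ∀ i, |a i| ≤ K) :
    ‖∑ i, a i • pr i‖ ≤ n * K := by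
  refine (norm_sum_le _ _).trans ?_
  calc ∑ i, ‖a i • pr i‖ ≤ ∑ _i : Fin n, K := by
        apply Finset.sum_le_sum
        intro i _
        rw [norm_smul, Real.norm_eq_abs]
        have := norm_pr_le i
        have h1 := h i
        nlinarith [abs_nonneg (a i), norm_nonneg (pr i)]
    _ = n * K := by simp

def tayK (n r : ℕ) : ℝ := Fintype.card (Ix n r) * ((n : ℝ) * (r + 1) + 1) ^ r

lemma taylor_core (G : Euc n → Jet n r) (hG : IsGr G) {M : ℝ} (hM : 0 ≤ M)
    (hL : ∀ β : Ix n r, dg β = r → ∀ x y, |G x β - G y β| ≤ M * ‖x - y‖) :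
    Wh Set.univ (tayK n r * M) G := by
  intro x _ y _
  set L : ℝ := (n : ℝ) * (r + 1) + 1 with hLdef
  have hL1 : 1 ≤ L := by rw [hLdef]; nlinarith [Nat.cast_nonneg (α := ℝ) n, Nat.cast_nonneg (α := ℝ) r]
  have hL0 : 0 ≤ L := by linarith
  let g : Euc n → Jet n r := fun x => G x - tr (x - y) (G y)
  have hgd : ∀ (β : Ix n r), dg β < r → ∀ x,
      HasFDerivAt (fun x => g x β) (∑ i, dj i (g x) β • pr i) x := by
    intro β hβ x
    have h1 := hG β hβ x
    have h2 : HasFDerivAt (fun x => tr (x - y) (G y) β)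
        (∑ i, dj i (tr (x - y) (G y)) β • pr i) x := by
      have := (hasFDerivAt_tr (G y) β (x - y)).comp x ((hasFDerivAt_id x).sub_const y)
      simpa [Function.comp_def] using this
    refine (h1.sub h2).congr_fderiv ?_
    rw [← Finset.sum_sub_distrib]
    apply Finset.sum_congr rfl
    intro i _
    simp only [g, map_sub, Pi.sub_apply]
    exact (sub_smul _ _ _).symm
  have key : ∀ j, j ≤ r → ∀ β : Ix n r, dg β = r - j → ∀ x,
      |g x β| ≤ L ^ j * M * ‖x - y‖ ^ (j + 1) := by
    intro j
    induction j with
    | zero =>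
      intro _ β hβ x
      have hβ' : dg β = r := by omega
      simp only [g, Pi.sub_apply, tr_top _ β hβ']
      simpa using hL β hβ' x y
    | succ j ih =>
      intro hj β hβ x
      have hβ' : dg β < r := by omega
      set R := ‖x - y‖ with hR
      have hR0 : 0 ≤ R := norm_nonneg _
      have hbound : ∀ z ∈ Metric.closedBall y R,
          ‖∑ i, dj i (g z) β • pr i‖ ≤ n * ((r + 1) * (L ^ j * M * R ^ (j + 1))) := by
        intro z hz
        apply norm_grad_le
        intro i
        rw [dj_lt _ _ β hβ', abs_mul]
        have hz' : ‖z - y‖ ≤ R := by simpa [dist_eq_norm] using hz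
        have h1 := ih (by omega) ⟨β.1 + Finsupp.single i 1, by
          rw [map_add, Finsupp.degree_single]; exact hβ'⟩ (by
            simp only [dg] at hβ ⊢
            rw [map_add, Finsupp.degree_single]; omega) z
        have h2 : ‖z - y‖ ^ (j + 1) ≤ R ^ (j + 1) := by gcongr
        have h3 : |(β.1 i : ℝ) + 1| ≤ r + 1 := by
          rw [abs_of_nonneg (by positivity)]
          have : β.1 i ≤ r := (Finsupp.le_degree i β.1).trans β.2
          have : (β.1 i : ℝ) ≤ r := by exact_mod_cast this
          linarith
        rw [mul_comm]
        refine mul_le_mul h3 (h1.trans ?_) (abs_nonneg _) (by positivity)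
        gcongr
      have hmv := (convex_closedBall y R).norm_image_sub_le_of_norm_hasFDerivWithin_le
        (f := fun x => g x β) (f' := fun z => ∑ i, dj i (g z) β • pr i)
        (fun z _ => (hgd β hβ' z).hasFDerivWithinAt) hbound
        (x := y) (y := x) (Metric.mem_closedBall_self hR0) (by simp [dist_eq_norm, hR])
      have hgy : g y β = 0 := by simp [g]
      simp only [hgy, sub_zero, Real.norm_eq_abs] at hmv
      refine hmv.trans ?_
      have hP : 0 ≤ L ^ j * M * R ^ (j + 1) := by positivity
      calc n * ((r + 1) * (L ^ j * M * R ^ (j + 1))) * R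
          = ((n : ℝ) * (r + 1)) * ((L ^ j * M * R ^ (j + 1)) * R) := by ring
        _ ≤ L * ((L ^ j * M * R ^ (j + 1)) * R) := by
          apply mul_le_mul_of_nonneg_right _ (by positivity)
          rw [hLdef]; linarith
        _ = L ^ (j + 1) * M * R ^ (j + 1 + 1) := by ring
  have hfin : ∀ β : Ix n r, |g x β| * ‖x - y‖ ^ dg β ≤ L ^ r * M * ‖x - y‖ ^ (r + 1) := by
    intro β
    have hb := β.2
    have h1 := key (r - dg β) (by omega) β (by simp only [dg]; omega) x
    have h2 : L ^ (r - dg β) ≤ L ^ r := pow_le_pow_right₀ hL1 (by omega)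
    have e : ‖x - y‖ ^ (r + 1) = ‖x - y‖ ^ (r - dg β + 1) * ‖x - y‖ ^ dg β := by
      rw [← pow_add]; congr 1; simp only [dg]; omega
    rw [e, ← mul_assoc]
    gcongr
    exact h1.trans (by gcongr)
  calc N ‖x - y‖ (g x) ≤ ∑ _β : Ix n r, L ^ r * M * ‖x - y‖ ^ (r + 1) :=
        Finset.sum_le_sum fun β _ => hfin β
    _ = tayK n r * M * ‖x - y‖ ^ (r + 1) := by
      simp [tayK, ← hLdef]; ring

end NNI
end SecP3

open scoped BigOperators

noncomputable section SecP3b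
namespace NNI

open MvPolynomial

variable {n r : ℕ}

/-- the multi-index of a list -/
def ct (l : List (Fin n)) : Fin n →₀ ℕ := (l.map (fun i => Finsupp.single i 1)).sum

@[simp] lemma ct_nil : ct ([] : List (Fin n)) = 0 := rfl
@[simp] lemma ct_cons (i : Fin n) (l : List (Fin n)) : ct (i :: l) = Finsupp.single i 1 + ct l := by
  simp [ct]
lemma ct_apply (l : List (Fin n)) (j : Fin n) : ct l j = l.count j := by
  classical
  induction l with
  | nil => simp
  | cons a l ih =>
    rw [ct_cons, Finsupp.add_apply, ih, List.count_cons, Finsupp.single_apply]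
    by_cases h : a = j <;> simp [h, add_comm]
lemma degree_ct (l : List (Fin n)) : (ct l).degree = l.length := by
  induction l with
  | nil => simp
  | cons a l ih => rw [ct_cons, map_add, ih, Finsupp.degree_single, List.length_cons, add_comm]

def Lst (α : Fin n → ℕ) : List (Fin n) := (List.finRange n).flatMap fun i => List.replicate (α i) i

lemma mD_eq (α : Fin n → ℕ) (F : Euc n → ℝ) : mD α F = (Lst α).foldr pD F := rfl

lemma count_Lst (α : Fin n → ℕ) (j : Fin n) : (Lst α).count j = α j := by
  classical
  rw [Lst, List.count_flatMap, ← List.ofFn_id, List.map_ofFn, List.sum_ofFn]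
  simp only [Function.comp_apply, id]
  rw [Finset.sum_eq_single j]
  · simp
  · intro b _ hb
    rw [List.count_replicate]
    simp [hb]
  · simp

lemma ct_Lst (α : Fin n → ℕ) (j : Fin n) : ct (Lst α) j = α j := by rw [ct_apply, count_Lst]

lemma ct_Lst' (α : Fin n →₀ ℕ) : ct (Lst α) = α := by ext j; exact ct_Lst _ j

lemma length_Lst (α : Fin n →₀ ℕ) : (Lst α).length = α.degree := by
  rw [← degree_ct, ct_Lst']

lemma contDiff_pD (k : ℕ) {F : Euc n → ℝ} (hF : ContDiff ℝ ((k + 1 : ℕ) : ℕ∞) F) (i : Fin n) :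
    ContDiff ℝ (k : ℕ∞) (pD i F) := by
  have : ContDiff ℝ (k : ℕ∞) (fderiv ℝ F) := hF.fderiv_right (by norm_cast)
  exact this.clm_apply contDiff_const

lemma contDiff_foldr (F : Euc n → ℝ) (l : List (Fin n)) : ∀ k : ℕ,
    ContDiff ℝ ((k + l.length : ℕ) : ℕ∞) F → ContDiff ℝ (k : ℕ∞) (l.foldr pD F) := by
  induction l with
  | nil => intro k h; simpa using h
  | cons a l ih =>
    intro k h
    rw [List.foldr_cons]
    apply contDiff_pD
    apply ih
    have e : k + 1 + l.length = k + (a :: l).length := by rw [List.length_cons]; omega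
    rw [e]; exact h

lemma pD_comm {F : Euc n → ℝ} (hF : ContDiff ℝ (2 : ℕ) F) (i j : Fin n) :
    pD i (pD j F) = pD j (pD i F) := by
  have hd : Differentiable ℝ (fderiv ℝ F) :=
    (hF.fderiv_right (m := 1) (by norm_num)).differentiable (by norm_num)
  have e : ∀ (i j : Fin n) x, pD i (pD j F) x
      = fderiv ℝ (fderiv ℝ F) x (EuclideanSpace.single i (1 : ℝ)) (EuclideanSpace.single j (1 : ℝ)) := by
    intro i j x
    have : HasFDerivAt (pD j F) ((ContinuousLinearMap.apply ℝ ℝ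
        (EuclideanSpace.single j (1 : ℝ))).comp (fderiv ℝ (fderiv ℝ F) x)) x :=
      (ContinuousLinearMap.apply ℝ ℝ (EuclideanSpace.single j (1 : ℝ))).hasFDerivAt.comp x
        (hd x).hasFDerivAt
    rw [pD, this.fderiv]; rfl
  ext x
  rw [e, e]
  have hs : IsSymmSndFDerivAt ℝ F x :=
    hF.contDiffAt.isSymmSndFDerivAt (by simp)
  exact hs _ _

lemma foldr_perm {F : Euc n → ℝ} {l l' : List (Fin n)} (h : l.Perm l') :
    ContDiff ℝ ((l.length : ℕ) : ℕ∞) F → l.foldr pD F = l'.foldr pD F := by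
  induction h with
  | nil => intro _; rfl
  | cons a h ih =>
    intro hF
    rw [List.foldr_cons, List.foldr_cons, ih]
    exact hF.of_le (by simp)
  | swap a b l =>
    intro hF
    simp only [List.foldr_cons]
    apply pD_comm
    have := contDiff_foldr F l 2 (by
      have e : 2 + l.length = (b :: a :: l).length := by simp only [List.length_cons]; omega
      rw [e]; exact hF)
    exact_mod_cast this
  | trans h1 h2 ih1 ih2 =>
    intro hF
    rw [ih1 hF, ih2 (by rw [← h1.length_eq]; exact hF)]

lemma pD_mD {F : Euc n → ℝ} (α : Fin n →₀ ℕ) (i : Fin n)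
    (hF : ContDiff ℝ ((α.degree + 1 : ℕ) : ℕ∞) F) :
    pD i (mD α F) = mD (α + Finsupp.single i 1 : Fin n →₀ ℕ) F := by
  classical
  rw [mD_eq, mD_eq]
  change List.foldr pD F (i :: Lst α) = _
  apply foldr_perm
  · rw [List.perm_iff_count]
    intro j
    rw [← ct_apply, ← ct_apply, ct_cons, ct_Lst', ct_Lst', add_comm]
  · rw [List.length_cons, length_Lst]; exact hF

/-- multi-index factorial -/
def mf (α : Fin n →₀ ℕ) : ℝ := ∏ i, ((α i).factorial : ℝ)

lemma mf_pos (α : Fin n →₀ ℕ) : 0 < mf α :=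
  Finset.prod_pos fun i _ => by exact_mod_cast Nat.factorial_pos _

lemma one_le_mf (α : Fin n →₀ ℕ) : 1 ≤ mf α := by
  unfold mf
  have : (1 : ℝ) = ∏ _i : Fin n, (1 : ℝ) := by simp
  rw [this]
  apply Finset.prod_le_prod
  · simp
  · intro i _; exact_mod_cast Nat.factorial_pos _

lemma mf_succ (α : Fin n →₀ ℕ) (i : Fin n) : mf (α + Finsupp.single i 1) = (α i + 1) * mf α := by
  classical
  unfold mf
  rw [← Finset.mul_prod_erase _ _ (Finset.mem_univ i),
    ← Finset.mul_prod_erase _ (fun i => ((α i).factorial : ℝ)) (Finset.mem_univ i)]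
  have : ∀ j ∈ Finset.univ.erase i, (((α + Finsupp.single i 1 : Fin n →₀ ℕ) j).factorial : ℝ)
      = ((α j).factorial : ℝ) := by
    intro j hj
    rw [Finsupp.add_apply, Finsupp.single_eq_of_ne (Finset.ne_of_mem_erase hj), add_zero]
  rw [Finset.prod_congr rfl this]
  simp [Nat.factorial_succ]
  ring

lemma mf_zero : mf (0 : Fin n →₀ ℕ) = 1 := by simp [mf]

lemma mf_le (α : Fin n →₀ ℕ) : mf α ≤ (α.degree.factorial : ℝ) ^ n := by
  unfold mf
  have : ((α.degree).factorial : ℝ) ^ n = ∏ _i : Fin n, ((α.degree).factorial : ℝ) := by simp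
  rw [this]
  apply Finset.prod_le_prod
  · intros; positivity
  · intro i _; exact_mod_cast Nat.factorial_le (Finsupp.le_degree i α)

lemma sum_pr (L : Euc n →L[ℝ] ℝ) : L = ∑ i, L (EuclideanSpace.single i (1 : ℝ)) • pr i := by
  ext v
  have hv : v = ∑ i, v i • EuclideanSpace.single i (1 : ℝ) := by
    ext j
    simp [Finset.sum_apply, Pi.single_apply]
  conv_lhs => rw [hv]
  rw [map_sum]
  simp [mul_comm]

/-- jet field of a function -/
def jf (r : ℕ) (F : Euc n → ℝ) : Euc n → Jet n r := fun x β => mD β.1 F x / mf β.1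

lemma ev_jf (F : Euc n → ℝ) (x : Euc n) : ev (jf r F x) = F x := by
  have h1 : Lst (((z0 : Ix n r).1 : Fin n →₀ ℕ)) = [] := by
    rw [← List.length_eq_zero_iff, length_Lst]; simp [z0]
  rw [ev_apply, jf, mD_eq, h1]
  simp [z0, mf_zero]

lemma isGr_jf {F : Euc n → ℝ} (hF : ContDiff ℝ (r : ℕ∞) F) : IsGr (jf r F) := by
  intro β hβ x
  have hβ' : β.1.degree < r := hβ
  have hc : ContDiff ℝ ((β.1.degree + 1 : ℕ) : ℕ∞) F := hF.of_le (by exact_mod_cast hβ')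
  have hc1 : ContDiff ℝ ((1 : ℕ) : ℕ∞) (mD β.1 F) := by
    rw [mD_eq]; apply contDiff_foldr
    rw [length_Lst, add_comm]; exact hc
  have hd : DifferentiableAt ℝ (mD β.1 F) x := (hc1.differentiable (by simp)) x
  have h1 : HasFDerivAt (fun x => jf r F x β) ((mf β.1)⁻¹ • fderiv ℝ (mD β.1 F) x) x := by
    have := hd.hasFDerivAt.const_smul (mf β.1)⁻¹
    refine this.congr_of_eventuallyEq (Filter.Eventually.of_forall fun y => ?_)
    simp [jf, div_eq_inv_mul]
  refine h1.congr_fderiv ?_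
  conv_lhs => rw [sum_pr (fderiv ℝ (mD β.1 F) x)]
  rw [Finset.smul_sum]
  apply Finset.sum_congr rfl
  intro i _
  rw [smul_smul]
  congr 1
  rw [dj_lt _ _ β hβ]
  have e : fderiv ℝ (mD β.1 F) x (EuclideanSpace.single i (1 : ℝ))
      = mD (β.1 + Finsupp.single i 1 : Fin n →₀ ℕ) F x := by
    rw [← pD_mD β.1 i hc]; rfl
  rw [e, jf]
  simp only
  rw [mf_succ]
  have := mf_pos β.1
  field_simp

lemma lip_coord {g : Euc n → ℝ} {M : ℝ} (hM : 0 ≤ M)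
    (h : ∀ i : Fin n, ∀ x : Euc n, ∀ t : ℝ, |g (x + t • EuclideanSpace.single i (1 : ℝ)) - g x| ≤ M * |t|)
    (x y : Euc n) : |g x - g y| ≤ n * M * ‖x - y‖ := by
  classical
  have key : ∀ (s : Finset (Fin n)) (v x : Euc n),
      |g (x + ∑ i ∈ s, v i • EuclideanSpace.single i (1 : ℝ)) - g x| ≤ ∑ i ∈ s, M * |v i| := by
    intro s v
    induction s using Finset.induction_on with
    | empty => intro x; simp
    | insert a s ha ih =>
      intro x
      rw [Finset.sum_insert ha, Finset.sum_insert ha, ← add_assoc]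
      have h1 := h a x (v a)
      have h2 := ih (x + v a • EuclideanSpace.single a (1 : ℝ))
      have h3 := abs_sub_le (g (x + v a • EuclideanSpace.single a (1 : ℝ) +
        ∑ i ∈ s, v i • EuclideanSpace.single i (1 : ℝ))) (g (x + v a • EuclideanSpace.single a (1 : ℝ))) (g x)
      linarith
  have hv : x = y + ∑ i, (x - y) i • EuclideanSpace.single i (1 : ℝ) := by
    ext j
    simp [Finset.sum_apply, Pi.single_apply]
  have h1 := key Finset.univ (x - y) y
  rw [← hv] at h1
  refine h1.trans ?_
  calc ∑ i, M * |(x - y) i| ≤ ∑ _i : Fin n, M * ‖x - y‖ := by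
        apply Finset.sum_le_sum
        intro i _
        gcongr
        exact PiLp.norm_apply_le (x - y) i
    _ = _ := by simp; ring

lemma deg_eq (α : Fin n →₀ ℕ) : deg (α : Fin n → ℕ) = α.degree := by
  rw [deg, Finsupp.degree_eq_sum]

def fcK (n r : ℕ) : ℝ := tayK n r * n + Fintype.card (Ix n r)

lemma tayK_nonneg (n r : ℕ) : 0 ≤ tayK n r := by unfold tayK; positivity
lemma fcK_nonneg (n r : ℕ) : 0 ≤ fcK n r := by unfold fcK; have := tayK_nonneg n r; positivity

/-- function to field -/
lemma FC {F : Euc n → ℝ} {M : ℝ} (hM : 0 ≤ M) (h : CmLipNormLe (r + 1) n F M) :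
    Wh Set.univ (fcK n r * M) (jf r F) ∧ (∀ x, ev (jf r F x) = F x) ∧
      ∀ x, N 1 (jf r F x) ≤ fcK n r * M := by
  obtain ⟨h1, h2, h3⟩ := h
  simp only [Nat.add_sub_cancel] at h1 h2 h3
  have ht := tayK_nonneg n r
  refine ⟨?_, ev_jf F, ?_⟩
  · refine (taylor_core (jf r F) (isGr_jf h1) (M := n * M) (by positivity) ?_).mono le_rfl ?_
    · intro β hβ x y
      have := lip_coord hM (h3 β.1 (by rw [deg_eq]; exact hβ)) x y
      simp only [jf]
      rw [← sub_div, abs_div, abs_of_pos (mf_pos β.1), div_le_iff₀ (mf_pos β.1)]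
      have h0 : 0 ≤ n * M * ‖x - y‖ := by positivity
      nlinarith [one_le_mf β.1]
    · unfold fcK
      have : (0 : ℝ) ≤ Fintype.card (Ix n r) * M := by positivity
      nlinarith
  · intro x
    calc N 1 (jf r F x) ≤ ∑ _β : Ix n r, M := by
          apply Finset.sum_le_sum
          intro β _
          rw [one_pow, mul_one, jf, abs_div, abs_of_pos (mf_pos β.1), div_le_iff₀ (mf_pos β.1)]
          have := h2 β.1 (by rw [deg_eq]; exact β.2) x
          nlinarith [one_le_mf β.1]
      _ = Fintype.card (Ix n r) * M := by simp
      _ ≤ fcK n r * M := by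
        unfold fcK
        have : 0 ≤ tayK n r * n := by positivity
        nlinarith

/-! ### field to function -/

lemma isGr_of_Wh {G : Euc n → Jet n r} {C : ℝ} (hG : Wh Set.univ C G) : IsGr G := by
  intro β hβ x
  have h1 : HasFDerivAt (fun y => tr (y - x) (G x) β) (∑ i, dj i (G x) β • pr i) x := by
    have := HasFDerivAt.comp (f := fun y => y - x) x (hasFDerivAt_tr (G x) β (x - x))
      ((hasFDerivAt_id x).sub_const x)
    simpa [Function.comp_def] using this
  have h2 : HasFDerivAt (fun y => G y β - tr (y - x) (G x) β) (0 : Euc n →L[ℝ] ℝ) x := by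
    have hO : (fun y => G y β - tr (y - x) (G x) β) =O[nhds x] fun y => ‖y - x‖ ^ 2 := by
      refine Asymptotics.IsBigO.of_bound |C| ?_
      have hnear : ∀ᶠ y in nhds x, ‖y - x‖ < 1 := by
        have := Metric.ball_mem_nhds x zero_lt_one
        filter_upwards [this] with y hy
        simpa [dist_eq_norm] using hy
      filter_upwards [hnear] with y hy
      have hw := hG y trivial x trivial
      have hc := coeff_le_N (norm_nonneg (y - x)) (G y - tr (y - x) (G x)) β
      have hd : ‖y - x‖ ^ (r + 1) = ‖y - x‖ ^ (r + 1 - dg β) * ‖y - x‖ ^ dg β := by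
        rw [← pow_add]; congr 1
        have := β.2
        simp only [dg]; omega
      rw [Real.norm_eq_abs, Real.norm_eq_abs, abs_of_nonneg (by positivity : 0 ≤ ‖y - x‖ ^ 2)]
      rcases eq_or_lt_of_le (norm_nonneg (y - x)) with h0 | h0
      · have : y = x := by
          rw [← sub_eq_zero, ← norm_eq_zero]; exact h0.symm
        subst this; simp
      · have hp : 0 < ‖y - x‖ ^ dg β := by positivity
        have h3 : |(G y - tr (y - x) (G x)) β| ≤ C * ‖y - x‖ ^ (r + 1 - dg β) := by
          have := hc.trans hw
          rw [hd, ← mul_assoc] at this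
          exact le_of_mul_le_mul_right this hp
        refine h3.trans ?_
        have h4 : ‖y - x‖ ^ (r + 1 - dg β) ≤ ‖y - x‖ ^ 2 :=
          pow_le_pow_of_le_one h0.le hy.le (by omega)
        calc C * ‖y - x‖ ^ (r + 1 - dg β) ≤ |C| * ‖y - x‖ ^ (r + 1 - dg β) := by
              gcongr; exact le_abs_self C
          _ ≤ _ := by gcongr
    have := hO.hasFDerivAt (𝕜 := ℝ) (n := 2) (by norm_num)
    exact this
  have := h1.add h2
  simp only [add_zero] at this
  refine this.congr_of_eventuallyEq (Filter.Eventually.of_forall fun y => ?_)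
  simp

lemma lip_top {G : Euc n → Jet n r} {C : ℝ} (hG : Wh Set.univ C G) (β : Ix n r) (hβ : dg β = r)
    (x y : Euc n) : |G x β - G y β| ≤ C * ‖x - y‖ := by
  have hw := hG x trivial y trivial
  have hc := coeff_le_N (norm_nonneg (x - y)) (G x - tr (x - y) (G y)) β
  rw [Pi.sub_apply, tr_top _ β hβ, hβ] at hc
  rcases eq_or_lt_of_le (norm_nonneg (x - y)) with h0 | h0
  · have : x = y := by
      rw [← sub_eq_zero, ← norm_eq_zero]; exact h0.symm
    subst this; simp
  · have := hc.trans hw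
    rw [pow_succ, mul_comm (‖x - y‖ ^ r), ← mul_assoc] at this
    exact le_of_mul_le_mul_right this (by positivity)

lemma contDiff_field {G : Euc n → Jet n r} {C : ℝ} (hG : Wh Set.univ C G) :
    ∀ j : ℕ, ∀ β : Ix n r, dg β + j = r → ContDiff ℝ (j : ℕ∞) (fun x => G x β) := by
  intro j
  induction j with
  | zero =>
    intro β hβ
    have : Continuous (fun x => G x β) := by
      have hl : LipschitzWith (Real.toNNReal C) (fun x => G x β) := by
        apply LipschitzWith.of_dist_le_mul
        intro x y
        rw [Real.dist_eq, dist_eq_norm]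
        refine (lip_top hG β hβ x y).trans ?_
        gcongr
        exact Real.le_coe_toNNReal C
      exact hl.continuous
    exact_mod_cast contDiff_zero.2 this
  | succ j ih =>
    intro β hβ
    have hlt : dg β < r := by omega
    have := (contDiff_succ_iff_hasFDerivAt (𝕜 := ℝ) (n := j) (f := fun x => G x β)).2
      ⟨fun x => ∑ i, dj i (G x) β • pr i, ?_, fun x => isGr_of_Wh hG β hlt x⟩
    · exact_mod_cast this
    · apply ContDiff.sum
      intro i _
      refine ContDiff.fun_smul ?_ contDiff_const
      simp only [dj_lt _ _ β hlt]
      refine ContDiff.mul ?_ contDiff_const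
      have := ih ⟨β.1 + Finsupp.single i 1, by rw [map_add, Finsupp.degree_single]; exact hlt⟩
        (by simp only [dg] at hβ ⊢; rw [map_add, Finsupp.degree_single]; omega)
      exact_mod_cast this

lemma foldr_field {G : Euc n → Jet n r} {C : ℝ} (hG : Wh Set.univ C G) (l : List (Fin n)) :
    ∀ (h : (ct l).degree ≤ r),
    l.foldr pD (fun x => ev (G x)) = fun x => mf (ct l) * G x ⟨ct l, h⟩ := by
  induction l with
  | nil => intro h; ext x; simp [mf_zero, ev_apply, z0]
  | cons i l ih =>
    intro h
    have hl : (ct l).degree < r := by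
      rw [degree_ct] at h ⊢; simp at h; omega
    rw [List.foldr_cons, ih hl.le]
    ext x
    have hd := (isGr_of_Wh hG ⟨ct l, hl.le⟩ hl x).const_mul (mf (ct l))
    rw [pD, hd.fderiv]
    have e : (⟨ct (i :: l), h⟩ : Ix n r) = ⟨ct l + Finsupp.single i 1, by
        rw [map_add, Finsupp.degree_single]; exact hl⟩ := by
      apply Subtype.ext; simp [add_comm]
    rw [e]
    have e2 : mf (ct (i :: l)) = (ct l i + 1) * mf (ct l) := by
      rw [← mf_succ, ct_cons, add_comm]
    rw [e2]
    simp only [smul_apply, sum_apply]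
    rw [Finset.sum_eq_single i]
    · rw [dj_lt _ _ _ hl]
      simp
      ring
    · intro b _ hb
      simp [hb]
    · simp

lemma BC {G : Euc n → Jet n r} {C : ℝ} (_hC : 0 ≤ C) (hG : Wh Set.univ C G)
    (hN : ∀ x, N 1 (G x) ≤ C) :
    CmLipNormLe (r + 1) n (fun x => ev (G x)) ((r.factorial : ℝ) ^ n * C) := by
  have hmD : ∀ α : Fin n → ℕ, ∀ h : deg α ≤ r, mD α (fun x => ev (G x))
      = fun x => mf (Finsupp.equivFunOnFinite.symm α) * G x ⟨Finsupp.equivFunOnFinite.symm α, by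
        rw [← deg_eq]; exact h⟩ := by
    intro α h
    have e : ct (Lst α) = Finsupp.equivFunOnFinite.symm α := by
      ext j; rw [ct_Lst]; rfl
    rw [mD_eq, foldr_field hG (Lst α) (by rw [e, ← deg_eq]; exact h)]
    simp only [e]
  have hmf : ∀ β : Ix n r, mf β.1 ≤ (r.factorial : ℝ) ^ n := by
    intro β
    refine (mf_le β.1).trans ?_
    gcongr
    exact β.2
  refine ⟨?_, ?_, ?_⟩
  · simp only [Nat.add_sub_cancel]
    exact contDiff_field hG r z0 (by simp [z0, dg])
  · intro α hα x
    simp only [Nat.add_sub_cancel] at hα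
    rw [hmD α hα]
    simp only
    rw [abs_mul, abs_of_pos (mf_pos _)]
    have h1 := hmf ⟨Finsupp.equivFunOnFinite.symm α, by rw [← deg_eq]; exact hα⟩
    exact mul_le_mul h1 ((abs_le_N1 _ _).trans (hN x)) (abs_nonneg _) (by positivity)
  · intro α hα i x t
    simp only [Nat.add_sub_cancel] at hα
    rw [hmD α hα.le]
    simp only
    rw [← mul_sub, abs_mul, abs_of_pos (mf_pos _), mul_assoc]
    have h1 := hmf ⟨Finsupp.equivFunOnFinite.symm α, by rw [← deg_eq]; exact hα.le⟩
    refine mul_le_mul h1 ?_ (abs_nonneg _) (by positivity)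
    refine (lip_top hG _ ?_ _ _).trans ?_
    · simp only [dg]; rw [← deg_eq]; exact hα
    · simp [norm_smul]

end NNI
end SecP3b

open scoped BigOperators

noncomputable section SecP3c
namespace NNI

variable {n r : ℕ}

lemma jf_ev {G : Euc n → Jet n r} {C : ℝ} (hG : Wh Set.univ C G) (x : Euc n) :
    jf r (fun x => ev (G x)) x = G x := by
  ext β
  have h := foldr_field hG (Lst β.1) (by rw [ct_Lst']; exact β.2)
  rw [jf, mD_eq, h]
  simp only [ct_Lst']
  have := mf_pos β.1
  field_simp

lemma foldr_germ {F G : Euc n → ℝ} {x : Euc n} (h : F =ᶠ[nhds x] G) (l : List (Fin n)) :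
    l.foldr pD F =ᶠ[nhds x] l.foldr pD G := by
  induction l with
  | nil => exact h
  | cons i l ih =>
    have := ih.fderiv (𝕜 := ℝ)
    filter_upwards [this] with y hy
    simp only [List.foldr_cons, pD]
    rw [hy]

lemma jf_germ {F G : Euc n → ℝ} {x : Euc n} (h : F =ᶠ[nhds x] G) : jf r F x = jf r G x := by
  ext β
  simp only [jf, mD_eq]
  rw [(foldr_germ h _).eq_of_nhds]

lemma Wh_const_one (c : ℝ) : Wh Set.univ 0 (fun _ : Euc n => c • (one : Jet n r)) := by
  intro x _ y _
  simp

lemma jf_const (c : ℝ) (x : Euc n) : jf r (fun _ : Euc n => c) x = c • one := by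
  have := jf_ev (Wh_const_one (n := n) (r := r) c) x
  simpa using this

lemma hasCompactSupport_foldr {F : Euc n → ℝ} (h : HasCompactSupport F) (l : List (Fin n)) :
    HasCompactSupport (l.foldr pD F) := by
  induction l with
  | nil => exact h
  | cons i l ih => exact ih.fderiv_apply (𝕜 := ℝ) _

lemma exists_CmLip {F : Euc n → ℝ} (h1 : ContDiff ℝ ((r + 1 : ℕ) : ℕ∞) F) (h2 : HasCompactSupport F) :
    ∃ M, 0 ≤ M ∧ CmLipNormLe (r + 1) n F M := by
  classical
  have hc : ∀ β : Ix n r, ContDiff ℝ ((1 : ℕ) : ℕ∞) (mD β.1 F) := by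
    intro β
    rw [mD_eq]; apply contDiff_foldr
    apply h1.of_le
    have := β.2
    rw [length_Lst]; norm_cast; omega
  have hs : ∀ β : Ix n r, HasCompactSupport (mD β.1 F) := fun β => hasCompactSupport_foldr h2 _
  have hb : ∀ β : Ix n r, ∃ B, 0 ≤ B ∧ ∀ x, |mD β.1 F x| ≤ B := by
    intro β
    obtain ⟨B, hB⟩ := (hc β).continuous.bounded_above_of_compact_support (hs β)
    exact ⟨B, (norm_nonneg _).trans (hB 0), hB⟩
  have hl : ∀ β : Ix n r, ∃ B : ℝ, 0 ≤ B ∧ ∀ x y, |mD β.1 F x - mD β.1 F y| ≤ B * ‖x - y‖ := by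
    intro β
    obtain ⟨B, hB⟩ := (hc β).lipschitzWith_of_hasCompactSupport (hs β) (by simp)
    exact ⟨B, B.2, fun x y => by simpa [dist_eq_norm] using hB.dist_le_mul x y⟩
  choose B hB0 hB using hb
  choose L hL0 hL using hl
  have hBs : ∀ β, B β ≤ ∑ β, (B β + L β) := fun β => by
    have := Finset.single_le_sum (f := fun β => B β + L β) (fun i _ => add_nonneg (hB0 i) (hL0 i))
      (Finset.mem_univ β)
    have h3 := hL0 β
    linarith
  have hLs : ∀ β, L β ≤ ∑ β, (B β + L β) := fun β => by
    have := Finset.single_le_sum (f := fun β => B β + L β) (fun i _ => add_nonneg (hB0 i) (hL0 i))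
      (Finset.mem_univ β)
    have h3 := hB0 β
    linarith
  refine ⟨∑ β, (B β + L β), Finset.sum_nonneg fun i _ => add_nonneg (hB0 i) (hL0 i), ?_, ?_, ?_⟩
  · exact h1.of_le (by norm_cast; simp)
  · intro α hα x
    have h := hB ⟨Finsupp.equivFunOnFinite.symm α, by rw [← deg_eq]; exact hα⟩ x
    exact h.trans (hBs _)
  · intro α hα i x t
    have h := hL ⟨Finsupp.equivFunOnFinite.symm α, by rw [← deg_eq]; exact hα.le⟩
      (x + t • EuclideanSpace.single i (1 : ℝ)) x
    refine h.trans ?_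
    have : ‖x + t • EuclideanSpace.single i (1 : ℝ) - x‖ = |t| := by simp [norm_smul]
    rw [this]
    exact mul_le_mul_of_nonneg_right (hLs _) (abs_nonneg _)

lemma exists_bump (n r : ℕ) : ∃ (Cb : ℝ) (Ψ : Euc n → Jet n r), 1 ≤ Cb ∧
    (∀ x, 0 ≤ ev (Ψ x)) ∧ (∀ x, ev (Ψ x) ≤ 1) ∧ (∀ x, ‖x‖ ≤ 1 → Ψ x = one) ∧
    (∀ x, 2 ≤ ‖x‖ → Ψ x = 0) ∧ Bd Set.univ 1 Cb Ψ := by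
  let b : ContDiffBump (0 : Euc n) := ⟨3 / 2, 7 / 4, by norm_num, by norm_num⟩
  obtain ⟨M, hM, hcm⟩ := exists_CmLip (r := r) (F := b) b.contDiff b.hasCompactSupport
  obtain ⟨hW, hev, hN⟩ := FC hM hcm
  have hone : ∀ x : Euc n, ‖x‖ ≤ 1 → jf r b x = one := by
    intro x hx
    have h : (b : Euc n → ℝ) =ᶠ[nhds x] fun _ => 1 := by
      have : Metric.ball (0 : Euc n) (3 / 2) ∈ nhds x :=
        Metric.isOpen_ball.mem_nhds (by rw [mem_ball_zero_iff]; linarith)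
      filter_upwards [this] with y hy
      exact b.one_of_mem_closedBall (Metric.ball_subset_closedBall hy)
    rw [jf_germ h, jf_const, one_smul]
  refine ⟨max 1 (fcK n r * M), jf r b, le_max_left _ _, ?_, ?_, hone, ?_, ?_⟩
  · intro x; rw [hev]; exact b.nonneg
  · intro x; rw [hev]; exact b.le_one
  · intro x hx
    have h : (b : Euc n → ℝ) =ᶠ[nhds x] fun _ => 0 := by
      have : (Metric.closedBall (0 : Euc n) (7 / 4))ᶜ ∈ nhds x :=
        Metric.isClosed_closedBall.isOpen_compl.mem_nhds (by simp; linarith)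
      filter_upwards [this] with y hy
      apply b.zero_of_le_dist
      simp at hy
      simp [b]; linarith
    rw [jf_germ h, jf_const, zero_smul]
  · exact Bd_of_Wh zero_lt_one hW (by simp) (fun x _ => (hN x).trans (le_max_right _ _))

def Cb (n r : ℕ) : ℝ := (exists_bump n r).choose
def Psi (n r : ℕ) : Euc n → Jet n r := (exists_bump n r).choose_spec.choose

/-- rescaled bump, `= 1` on `B(c,ρ)`, `= 0` off `B(c,2ρ)` -/
def bmp (r : ℕ) (c : Euc n) (ρ : ℝ) : Euc n → Jet n r := fun x => Dl ρ⁻¹ (Psi n r (ρ⁻¹ • (x - c)))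

lemma one_le_Cb (n r : ℕ) : 1 ≤ Cb n r := (exists_bump n r).choose_spec.choose_spec.1

lemma bmp_nonneg (c : Euc n) (ρ : ℝ) (x : Euc n) : 0 ≤ ev (bmp r c ρ x) := by
  rw [bmp, ev_Dl]; exact (exists_bump n r).choose_spec.choose_spec.2.1 _

lemma bmp_le_one (c : Euc n) (ρ : ℝ) (x : Euc n) : ev (bmp r c ρ x) ≤ 1 := by
  rw [bmp, ev_Dl]; exact (exists_bump n r).choose_spec.choose_spec.2.2.1 _

lemma bmp_one (c : Euc n) {ρ : ℝ} (hρ : 0 < ρ) {x : Euc n} (h : ‖x - c‖ ≤ ρ) :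
    bmp r c ρ x = one := by
  have := (exists_bump n r).choose_spec.choose_spec.2.2.2.1 (ρ⁻¹ • (x - c)) (by
    rw [norm_smul, Real.norm_of_nonneg (by positivity), inv_mul_le_iff₀ hρ]; linarith)
  rw [bmp, Psi, this, Dl_one']

lemma bmp_zero (c : Euc n) {ρ : ℝ} (hρ : 0 < ρ) {x : Euc n} (h : 2 * ρ ≤ ‖x - c‖) :
    bmp r c ρ x = 0 := by
  have := (exists_bump n r).choose_spec.choose_spec.2.2.2.2.1 (ρ⁻¹ • (x - c)) (by
    rw [norm_smul, Real.norm_of_nonneg (by positivity), le_inv_mul_iff₀ hρ]; linarith)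
  rw [bmp, Psi, this, map_zero]

lemma Bd_bmp (c : Euc n) {ρ : ℝ} (hρ : 0 < ρ) : Bd Set.univ ρ (Cb n r) (bmp r c ρ) := by
  have h := (exists_bump n r).choose_spec.choose_spec.2.2.2.2.2
  change Bd Set.univ 1 (Cb n r) (Psi n r) at h
  have hρi : 0 ≤ ρ⁻¹ := by positivity
  constructor
  · intro x _
    rw [bmp, N_Dl hρi, inv_mul_cancel₀ hρ.ne']
    exact h.1 _ trivial
  · intro x _ y _ hxy
    have e : tr (x - y) (bmp r c ρ y)
        = Dl ρ⁻¹ (tr (ρ⁻¹ • (x - c) - ρ⁻¹ • (y - c)) (Psi n r (ρ⁻¹ • (y - c)))) := by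
      rw [bmp, tr_Dl, ← smul_sub, sub_sub_sub_cancel_right]
    have e2 : ‖ρ⁻¹ • (x - c) - ρ⁻¹ • (y - c)‖ = ρ⁻¹ * ‖x - y‖ := by
      rw [← smul_sub, sub_sub_sub_cancel_right, norm_smul, Real.norm_of_nonneg hρi]
    have := h.2 (ρ⁻¹ • (x - c)) trivial (ρ⁻¹ • (y - c)) trivial (by
      rw [e2, inv_mul_le_iff₀ hρ]; linarith)
    rw [e, bmp, ← map_sub, N_Dl hρi]
    rw [e2] at this
    refine this.trans (le_of_eq ?_)
    rw [div_one, inv_mul_eq_div]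

end NNI
end SecP3c


open scoped BigOperators

noncomputable section SecP4

namespace NNI

variable {n r : ℕ}

lemma Wh_scale {Ω : Set (Euc n)} {M t : ℝ} {F : Euc n → Jet n r} (h : Wh Ω M F) (hM : 0 ≤ M)
    {x y : Euc n} (hx : x ∈ Ω) (hy : y ∈ Ω) (ht : 0 < t) (hxy : ‖x - y‖ ≤ t) :
    N t (F x - tr (x - y) (F y)) ≤ M * t ^ (r + 1) := by
  by_cases h0 : x = y
  · subst h0; simp; positivity
  have hp : 0 < ‖x - y‖ := norm_pos_iff.2 (sub_ne_zero.2 h0)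
  have h1 := N_scale_up (δ := ‖x - y‖) (t := t / ‖x - y‖) hp.le ((one_le_div hp).2 hxy)
    (F x - tr (x - y) (F y))
  rw [div_mul_cancel₀ _ hp.ne'] at h1
  refine h1.trans ((mul_le_mul_of_nonneg_left (h x hx y hy) (by positivity)).trans ?_)
  have : (t / ‖x - y‖) ^ r * (M * ‖x - y‖ ^ (r + 1)) = M * t ^ r * ‖x - y‖ := by
    rw [div_pow, pow_succ]; field_simp
  rw [this, pow_succ, ← mul_assoc]
  exact mul_le_mul_of_nonneg_left hxy (by positivity)

/-- scale monotonicity of `N δ p / δ^m` -/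
lemma N_up {δ δ' A : ℝ} (hδ : 0 < δ) (h : δ ≤ δ') (p : Jet n r) (hA : N δ p ≤ A * δ ^ (r + 1)) :
    N δ' p ≤ A * δ * δ' ^ r := by
  have hδ' : 0 < δ' := hδ.trans_le h
  have h1 := N_scale_up (δ := δ) (t := δ' / δ) hδ.le ((one_le_div hδ).2 h) p
  rw [div_mul_cancel₀ _ hδ.ne'] at h1
  refine h1.trans ((mul_le_mul_of_nonneg_left hA (by positivity)).trans (le_of_eq ?_))
  rw [div_pow, pow_succ]
  field_simp

lemma N_up' {δ δ' A : ℝ} (hδ : 0 < δ) (h : δ ≤ δ') (p : Jet n r) (hA : N δ p ≤ A * δ ^ (r + 1)) :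
    N δ' p ≤ A * δ' ^ (r + 1) := by
  have hA0 : 0 ≤ A := by
    have := (N_nonneg hδ.le p).trans hA
    exact nonneg_of_mul_nonneg_left this (by positivity)
  refine (N_up hδ h p hA).trans ?_
  have hδ' := hδ.trans_le h
  rw [pow_succ, mul_comm (δ' ^ r), ← mul_assoc]
  gcongr

/-- `N t p ≤ A s^m` when `t ≤ K s`-/
lemma N_le_of_scale {s t K : ℝ} (hs : 0 < s) (ht : 0 ≤ t) (hK : 1 ≤ K) (h : t ≤ K * s)
    (p : Jet n r) : N t p ≤ K ^ r * N s p :=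
  (N_mono ht h p).trans (N_scale_up hs.le hK p)

lemma Bd_ball {c : Euc n} {δ M A : ℝ} {F : Euc n → Jet n r} (hδ : 0 < δ) (hM : 0 ≤ M)
    (hF : Wh (Metric.closedBall c (4 * δ)) M F) (hA : N δ (F c) ≤ A) :
    Bd (Metric.closedBall c (4 * δ)) δ (5 ^ (r + 1) * (A + M * δ ^ (r + 1))) F := by
  have hA0 : 0 ≤ A := (N_nonneg hδ.le _).trans hA
  refine Bd_of_Wh hδ hF ?_ ?_
  · have : (1:ℝ) ≤ 5 ^ (r + 1) := one_le_pow₀ (by norm_num)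
    have h2 : 0 ≤ M * δ ^ (r + 1) := by positivity
    nlinarith
  · intro z hz
    have hz' : ‖z - c‖ ≤ 4 * δ := by rwa [mem_closedBall_iff_norm] at hz
    have hc : c ∈ Metric.closedBall c (4 * δ) := Metric.mem_closedBall_self (by positivity)
    have h1 := Wh_scale hF hM hz hc (by positivity : 0 < 4 * δ) hz'
    have h2 : N δ (tr (z - c) (F c)) ≤ 5 ^ r * A := by
      refine (N_tr hδ.le _ _).trans ((N_le_of_scale (K := 5) hδ (by positivity) (by norm_num) (by linarith) _).trans ?_)
      gcongr
    have h3 := N_add hδ.le (F z - tr (z - c) (F c)) (tr (z - c) (F c))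
    rw [sub_add_cancel] at h3
    have h4 := (N_mono hδ.le (by linarith : δ ≤ 4 * δ) (F z - tr (z - c) (F c))).trans h1
    have h5 : (4:ℝ) ^ (r + 1) ≤ 5 ^ (r + 1) := by gcongr; norm_num
    have h6 : (5:ℝ) ^ r ≤ 5 ^ (r + 1) := pow_le_pow_right₀ (by norm_num) (by omega)
    rw [mul_pow] at h4
    have h7 : 0 ≤ M * δ ^ (r + 1) := by positivity
    nlinarith

lemma Wh_supp {c : Euc n} {δ A : ℝ} {a : Euc n → Jet n r} (hδ : 0 < δ) (hA : 0 ≤ A)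
    (h : Bd (Metric.closedBall c (4 * δ)) δ A a) (h0 : ∀ x, 2 * δ ≤ ‖x - c‖ → a x = 0) :
    Wh Set.univ (2 ^ r * (A / δ ^ (r + 1))) a := by
  refine LG convex_univ (ε := δ / 2) (by positivity) (by positivity) ?_
  intro x _ y _ hxy
  by_cases hx : ‖x - c‖ ≤ 3 * δ
  · have hy : ‖y - c‖ ≤ 4 * δ := by
      have : y - c = (x - c) - (x - y) := by abel
      rw [this]; refine (norm_sub_le _ _).trans ?_; linarith
    have := h.2 x (by rw [mem_closedBall_iff_norm]; linarith) y (by rwa [mem_closedBall_iff_norm]) hxy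
    rw [div_pow] at this
    calc _ ≤ _ := this
      _ = _ := by ring
  · have hy : 2 * δ ≤ ‖y - c‖ := by
      have : x - c = (x - y) + (y - c) := by abel
      have h2 := norm_add_le (x - y) (y - c)
      rw [← this] at h2; linarith
    rw [h0 x (by linarith), h0 y hy]; simp; positivity

/-! ### Fields and the convex sets `Γ` -/

def FF (f : Euc n → ℝ) (S : Finset (Euc n)) (M : ℝ) (F : Euc n → Jet n r) : Prop :=
  Wh Set.univ M F ∧ (∀ x, 0 ≤ ev (F x)) ∧ ∀ x ∈ S, ev (F x) = f x

def Gam (f : Euc n → ℝ) (S : Finset (Euc n)) (x : Euc n) (M : ℝ) : Set (Jet n r) :=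
  {p | ∃ F, FF f S M F ∧ F x = p}

def GamK (E : Finset (Euc n)) (f : Euc n → ℝ) (k : ℕ) (x : Euc n) (M : ℝ) : Set (Jet n r) :=
  {p | ∀ S, S ⊆ E → S.card ≤ k → p ∈ Gam f S x M}

lemma FF.mono {f : Euc n → ℝ} {S S' : Finset (Euc n)} {M M' : ℝ} {F : Euc n → Jet n r}
    (h : FF f S M F) (hS : S' ⊆ S) (hM : M ≤ M') : FF f S' M' F :=
  ⟨h.1.mono subset_rfl hM, h.2.1, fun x hx => h.2.2 x (hS hx)⟩

lemma FF.comb {f : Euc n → ℝ} {S : Finset (Euc n)} {M M' a b : ℝ} {F G : Euc n → Jet n r}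
    (hF : FF f S M F) (hG : FF f S M' G) (ha : 0 ≤ a) (hb : 0 ≤ b) (hab : a + b = 1) :
    FF f S (a * M + b * M') (fun x => a • F x + b • G x) := by
  refine ⟨?_, ?_, ?_⟩
  · have := (hF.1.smul a).add (hG.1.smul b)
    rwa [abs_of_nonneg ha, abs_of_nonneg hb] at this
  · intro x
    have := hF.2.1 x; have := hG.2.1 x
    simp only [map_add, map_smul, smul_eq_mul]; positivity
  · intro x hx
    simp only [map_add, map_smul, smul_eq_mul, hF.2.2 x hx, hG.2.2 x hx]
    rw [← add_mul, hab, one_mul]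

lemma GamK.mono {E : Finset (Euc n)} {f : Euc n → ℝ} {k k' : ℕ} {x : Euc n} {M M' : ℝ}
    {p : Jet n r} (h : p ∈ GamK E f k x M) (hk : k' ≤ k) (hM : M ≤ M') : p ∈ GamK E f k' x M' := by
  intro S hS hc
  obtain ⟨F, hF, h2⟩ := h S hS (hc.trans hk)
  exact ⟨F, hF.mono subset_rfl hM, h2⟩

lemma GamK.comb {E : Finset (Euc n)} {f : Euc n → ℝ} {k : ℕ} {x : Euc n} {M M' a b : ℝ}
    {p q : Jet n r} (hp : p ∈ GamK E f k x M) (hq : q ∈ GamK E f k x M')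
    (ha : 0 ≤ a) (hb : 0 ≤ b) (hab : a + b = 1) :
    a • p + b • q ∈ GamK E f k x (a * M + b * M') := by
  intro S hS hc
  obtain ⟨F, hF, h2⟩ := hp S hS hc
  obtain ⟨G, hG, h3⟩ := hq S hS hc
  exact ⟨_, hF.comb hG ha hb hab, by simp only [h2, h3]⟩

lemma convex_GamK (E : Finset (Euc n)) (f : Euc n → ℝ) (k : ℕ) (x : Euc n) (M : ℝ) :
    Convex ℝ (GamK E f k x M : Set (Jet n r)) := by
  intro p hp q hq a b ha hb hab
  have := GamK.comb hp hq ha hb hab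
  rwa [← add_mul, hab, one_mul] at this

lemma convex_Gam (f : Euc n → ℝ) (S : Finset (Euc n)) (x : Euc n) (M : ℝ) :
    Convex ℝ (Gam f S x M : Set (Jet n r)) := by
  rintro p ⟨F, hF, rfl⟩ q ⟨G, hG, rfl⟩ a b ha hb hab
  refine ⟨fun x => a • F x + b • G x, ?_, rfl⟩
  have := hF.comb hG ha hb hab
  rwa [← add_mul, hab, one_mul] at this

lemma convex_N {δ : ℝ} (hδ : 0 ≤ δ) (q : Jet n r) (A : ℝ) :
    Convex ℝ {p : Jet n r | N δ (p - q) ≤ A} := by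
  intro p hp p' hp' a b ha hb hab
  simp only [Set.mem_ofPred_eq] at *
  have : a • p + b • p' - q = a • (p - q) + b • (p' - q) := by
    have hq : q = a • q + b • q := by rw [← add_smul, hab, one_smul]
    nth_rewrite 1 [hq]
    simp only [smul_sub]; abel
  rw [this]
  refine (N_add hδ _ _).trans ?_
  rw [N_smul, N_smul, abs_of_nonneg ha, abs_of_nonneg hb]
  calc _ ≤ a * A + b * A := by gcongr
    _ = A := by rw [← add_mul, hab, one_mul]

/-- dimension of jet space -/
def DD (n r : ℕ) : ℕ := Module.finrank ℝ (Jet n r)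

/-- Helly for families of convex sets indexed by small subsets of `E`. -/
lemma helly_E (E : Finset (Euc n)) (k : ℕ) (K : Finset (Euc n) → Set (Jet n r))
    (hK : ∀ S, Convex ℝ (K S)) (hanti : ∀ S S', S ⊆ S' → K S' ⊆ K S)
    (hne : ∀ S, S ⊆ E → S.card ≤ (DD n r + 1) * k → (K S).Nonempty) :
    ∃ p, ∀ S, S ⊆ E → S.card ≤ k → p ∈ K S := by
  classical
  have h := Convex.helly_theorem' (𝕜 := ℝ) (F := K)
    (s := E.powerset.filter fun S => S.card ≤ k) (fun S _ => hK S) (by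
      intro I hI hIc
      obtain ⟨p, hp⟩ := hne (I.biUnion id) (by
        intro x hx
        obtain ⟨S, hS, hx⟩ := Finset.mem_biUnion.1 hx
        exact Finset.mem_powerset.1 (Finset.mem_filter.1 (hI hS)).1 hx) (by
        refine (Finset.card_biUnion_le_card_mul _ _ k ?_).trans (Nat.mul_le_mul_right _ hIc)
        intro S hS
        exact (Finset.mem_filter.1 (hI hS)).2)
      refine ⟨p, Set.mem_iInter₂.2 fun S hS => hanti _ _ ?_ hp⟩
      exact Finset.subset_biUnion_of_mem id hS)
  obtain ⟨p, hp⟩ := h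
  refine ⟨p, fun S hS hc => ?_⟩
  exact Set.mem_iInter₂.1 hp S (Finset.mem_filter.2 ⟨Finset.mem_powerset.2 hS, hc⟩)

/-- transport -/
lemma transport {E : Finset (Euc n)} {f : Euc n → ℝ} {k : ℕ} {x : Euc n} {M : ℝ} {p : Jet n r}
    (hp : p ∈ GamK E f ((DD n r + 1) * k) x M) (y : Euc n) :
    ∃ p' ∈ GamK E f k y M, N ‖y - x‖ (p' - tr (y - x) p) ≤ M * ‖y - x‖ ^ (r + 1) := by
  have := helly_E (r := r) E k
    (fun S => Gam f S y M ∩ {p' | N ‖y - x‖ (p' - tr (y - x) p) ≤ M * ‖y - x‖ ^ (r + 1)})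
    (fun S => (convex_Gam f S y M).inter (convex_N (norm_nonneg _) _ _))
    (fun S S' hSS => by
      rintro q ⟨⟨F, hF, h2⟩, hq⟩
      exact ⟨⟨F, hF.mono hSS le_rfl, h2⟩, hq⟩) (by
      intro S hS hc
      obtain ⟨F, hF, h2⟩ := hp S hS hc
      refine ⟨F y, ⟨F, hF, rfl⟩, ?_⟩
      rw [← h2]
      exact hF.1 y (Set.mem_univ _) x (Set.mem_univ _))
  obtain ⟨p', hp'⟩ := this
  exact ⟨p', fun S hS hc => (hp' S hS hc).1, (hp' ∅ (by simp) (by simp)).2⟩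

lemma transport' {E : Finset (Euc n)} {f : Euc n → ℝ} {k : ℕ} {x : Euc n} {M : ℝ} {p : Jet n r}
    (hp : p ∈ GamK E f ((DD n r + 1) * k) x M) (hM : 0 ≤ M) {t : ℝ} (ht : 0 < t) (y : Euc n)
    (hy : ‖y - x‖ ≤ t) :
    ∃ p' ∈ GamK E f k y M, N t (p' - tr (y - x) p) ≤ M * t ^ (r + 1) := by
  by_cases h0 : y = x
  · subst h0
    refine ⟨p, GamK.mono hp (Nat.le_mul_of_pos_left _ (by omega)) le_rfl, ?_⟩
    simp; positivity
  · obtain ⟨p', h1, h2⟩ := transport hp y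
    exact ⟨p', h1, N_up' (norm_pos_iff.2 (sub_ne_zero.2 h0)) hy _ h2⟩

end NNI
end SecP4


open scoped BigOperators

noncomputable section SecP4b

namespace NNI

variable {n r : ℕ}

def Cw (n r : ℕ) : ℝ := 2 ^ r * (pc r * ((pc r * (5 ^ (r + 1) * Cb n r)) * (5 ^ (r + 1) * 2)))

lemma Cw_ge (n r : ℕ) : 5 ^ (r + 1) ≤ Cw n r := by
  unfold Cw
  have h1 := one_le_pc r
  have h2 := one_le_Cb n r
  have h3 : (1:ℝ) ≤ 5 ^ (r + 1) := one_le_pow₀ (by norm_num)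
  have h4 : (1:ℝ) ≤ 2 ^ r := one_le_pow₀ (by norm_num)
  have h5 : 1 ≤ 5 ^ (r + 1) * Cb n r := one_le_mul_of_one_le_of_one_le h3 h2
  have h6 : 1 ≤ pc r * (5 ^ (r + 1) * Cb n r) := one_le_mul_of_one_le_of_one_le h1 h5
  have h7 : (5:ℝ) ^ (r + 1) ≤ pc r * (5 ^ (r + 1) * Cb n r) * (5 ^ (r + 1) * 2) := by nlinarith
  have h8 : (5:ℝ) ^ (r + 1) ≤ pc r * (pc r * (5 ^ (r + 1) * Cb n r) * (5 ^ (r + 1) * 2)) :=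
    h7.trans (le_mul_of_one_le_left (by linarith) h1)
  exact h8.trans (le_mul_of_one_le_left (by linarith) h4)

lemma one_le_Cw (n r : ℕ) : 1 ≤ Cw n r :=
  (one_le_pow₀ (by norm_num : (1:ℝ) ≤ 5)).trans (Cw_ge n r)

lemma WC {E : Finset (Euc n)} {f : Euc n → ℝ} {k : ℕ} {x : Euc n} {M L δ : ℝ} {p0 Q q : Jet n r}
    (hM : 0 ≤ M) (hL : 1 ≤ L) (hδ : 0 < δ)
    (h1 : p0 + Q ∈ GamK E f k x M) (h2 : p0 - Q ∈ GamK E f k x M)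
    (hQ : N δ Q ≤ L * M * δ ^ (r + 1)) (hq : N δ q ≤ 1) :
    p0 + (Cw n r * L)⁻¹ • jm q Q ∈ GamK E f k x (2 * M) := by
  intro S hS hc
  obtain ⟨F1, hF1, e1⟩ := h1 S hS hc
  obtain ⟨F2, hF2, e2⟩ := h2 S hS hc
  have hCw := one_le_Cw n r
  set c := (Cw n r * L)⁻¹ with hcdef
  have hc0 : 0 < c := by positivity
  have hH := hF1.comb hF2 (a := 1/2) (b := 1/2) (by norm_num) (by norm_num) (by norm_num)
  set H : Euc n → Jet n r := fun z => (1/2 : ℝ) • F1 z + (1/2 : ℝ) • F2 z with hHdef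
  set G : Euc n → Jet n r := fun z => (1/2 : ℝ) • F1 z + (-1/2 : ℝ) • F2 z with hGdef
  have hG : Wh Set.univ M G := by
    have := (hF1.1.smul (1/2)).add (hF2.1.smul (-1/2))
    refine this.mono subset_rfl (le_of_eq ?_)
    norm_num [abs_of_neg, abs_of_pos]; ring
  have hHx : H x = p0 := by
    rw [hHdef]; simp only [e1, e2]; ext β; simp; ring
  have hGx : G x = Q := by
    rw [hGdef]; simp only [e1, e2]; ext β; simp; ring
  set θ : Euc n → Jet n r := fun z => jm (cf x q z) (bmp r x δ z) with hθ
  have b1 : Bd (Metric.closedBall x (4 * δ)) δ (5 ^ (r + 1)) (cf x q) := by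
    have := Bd_ball (F := cf x q) hδ le_rfl (Wh_cf _ x q) (A := 1) (by rw [cf_self]; exact hq)
    simpa using this
  have b2 : Bd (Metric.closedBall x (4 * δ)) δ (Cb n r) (bmp r x δ) :=
    (Bd_bmp x hδ).mono (Set.subset_univ _) hδ le_rfl le_rfl (by linarith [one_le_Cb n r])
  have b3 := b1.jm hδ b2
  have b4 : Bd (Metric.closedBall x (4 * δ)) δ (5 ^ (r + 1) * 2 * (L * M * δ ^ (r + 1))) G := by
    refine (Bd_ball hδ hM (hG.mono (Set.subset_univ _) le_rfl) (hGx ▸ hQ)).mono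
      subset_rfl hδ le_rfl ?_ (by positivity)
    have : M * δ ^ (r + 1) ≤ L * M * δ ^ (r + 1) := by
      have : M ≤ L * M := le_mul_of_one_le_left hM hL
      gcongr
    have h5 : (0:ℝ) ≤ 5 ^ (r + 1) := by positivity
    nlinarith
  have hCb := one_le_Cb n r
  have hpc := pc_pos r
  have b5 := Wh_supp (c := x) hδ (by positivity) (b3.jm hδ b4) (by
    intro z hz; rw [bmp_zero x hδ hz]; simp)
  have b6 : Wh Set.univ M (fun z => c • jm (θ z) (G z)) := by
    refine (b5.smul c).mono subset_rfl (le_of_eq ?_)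
    rw [abs_of_pos hc0, hcdef, Cw]
    field_simp
  refine ⟨fun z => H z + c • jm (θ z) (G z), ⟨?_, ?_, ?_⟩, ?_⟩
  · exact (hH.1.add b6).mono subset_rfl (by linarith)
  · intro z
    have hb0 := bmp_nonneg (r := r) x δ z
    have hb1 := bmp_le_one (r := r) x δ z
    have u1 := hF1.2.1 z
    have u2 := hF2.2.1 z
    have hle : c * |ev (θ z)| ≤ 1 := by
      rw [hθ]; simp only [ev_jm, abs_mul, abs_of_nonneg hb0]
      by_cases hz : 2 * δ ≤ ‖z - x‖
      · rw [bmp_zero x hδ hz]; simp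
      · have h3 := (abs_ev_le hδ.le (cf x q z)).trans
          (b1.1 z (by rw [mem_closedBall_iff_norm]; linarith))
        have h4 := h3.trans (Cw_ge n r)
        have h6 : |ev (cf x q z)| * ev (bmp r x δ z) ≤ Cw n r * 1 := by gcongr
        rw [hcdef, inv_mul_le_iff₀ (by positivity)]
        nlinarith
    have habs : |c * ev (θ z)| ≤ 1 := by rwa [abs_mul, abs_of_pos hc0]
    have hle2 := abs_le.1 habs
    simp only [map_add, map_smul, smul_eq_mul, ev_jm, hHdef, hGdef]
    nlinarith
  · intro z hz
    have e3 := hF1.2.2 z hz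
    have e4 := hF2.2.2 z hz
    simp only [map_add, map_smul, smul_eq_mul, ev_jm, hHdef, hGdef, e3, e4]
    ring
  · simp only [hHx, hGx, hθ, cf_self, bmp_one x hδ (x := x) (by simpa using hδ.le)]
    rw [jm_comm q one, jm_one_left]

def Ct (n r : ℕ) : ℝ := 2 ^ r * (pc r * (Cb n r * 5 ^ (r + 1))) + 1

lemma one_le_Ct (n r : ℕ) : 1 ≤ Ct n r := by
  have := one_le_Cb n r
  have := pc_pos r
  unfold Ct
  have : 0 ≤ 2 ^ r * (pc r * (Cb n r * 5 ^ (r + 1))) := by positivity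
  linarith

/-- gluing a local field with a global one -/
lemma TF {E S : Finset (Euc n)} {f : Euc n → ℝ} {c : Euc n} {ρ M1 M2 M3 : ℝ}
    {F H : Euc n → Jet n r} (hρ : 0 < ρ) (hM1 : 0 ≤ M1) (hM2 : 0 ≤ M2) (hM3 : 0 ≤ M3)
    (hF : Wh (Metric.closedBall c (4 * ρ)) M1 F)
    (hF0 : ∀ z, ‖z - c‖ ≤ 4 * ρ → 0 ≤ ev (F z))
    (hFE : ∀ z ∈ E, ‖z - c‖ ≤ 4 * ρ → ev (F z) = f z)
    (hSE : S ⊆ E) (hH : FF f S M2 H) (hd : N ρ (F c - H c) ≤ M3 * ρ ^ (r + 1)) :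
    ∃ G, FF f S (Ct n r * (M1 + M2 + M3)) G ∧ ∀ z, ‖z - c‖ ≤ ρ → G z = F z := by
  have hCb := one_le_Cb n r
  have hpc := pc_pos r
  have b2 : Bd (Metric.closedBall c (4 * ρ)) ρ (Cb n r) (bmp r c ρ) :=
    (Bd_bmp c hρ).mono (Set.subset_univ _) hρ le_rfl le_rfl (by linarith)
  have b1 := Bd_ball hρ (by positivity) (hF.sub (hH.1.mono (Set.subset_univ _) le_rfl)) hd
  have b3 := Wh_supp (c := c) hρ (by positivity) (b2.jm hρ b1) (by
    intro z hz; rw [bmp_zero c hρ hz]; simp)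
  refine ⟨fun z => H z + jm (bmp r c ρ z) (F z - H z), ⟨?_, ?_, ?_⟩, ?_⟩
  · refine (hH.1.add b3).mono subset_rfl ?_
    have : (2:ℝ) ^ r * (pc r * (Cb n r * (5 ^ (r + 1) * (M3 * ρ ^ (r + 1) + (M1 + M2) * ρ ^ (r + 1)))) / ρ ^ (r + 1))
      = 2 ^ r * (pc r * (Cb n r * 5 ^ (r + 1))) * (M1 + M2 + M3) := by field_simp; ring
    rw [this, Ct]; linarith
  · intro z
    have hb0 := bmp_nonneg (r := r) c ρ z
    have hb1 := bmp_le_one (r := r) c ρ z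
    have hHz := hH.2.1 z
    simp only [map_add, map_sub, ev_jm]
    by_cases hz : ‖z - c‖ ≤ 4 * ρ
    · have := hF0 z hz
      nlinarith
    · rw [bmp_zero c hρ (by linarith)]; simpa using hHz
  · intro z hz
    simp only [map_add, map_sub, ev_jm, hH.2.2 z hz]
    by_cases hz' : ‖z - c‖ ≤ 4 * ρ
    · rw [hFE z (hSE hz) hz']; ring
    · rw [bmp_zero c hρ (by linarith)]; simp
  · intro z hz
    simp [bmp_one c hρ hz]

end NNI
end SecP4b


open scoped BigOperators

noncomputable section SecP5

namespace NNI

variable {n r : ℕ}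

/-! ### Basis jets, scaling, inversion -/

open Classical in
def bs (β : Ix n r) : Jet n r := Pi.single β 1

lemma sum_bs (p : Jet n r) : p = ∑ β, p β • bs β := by
  classical
  ext γ
  simp [bs, Pi.single_apply, Finset.sum_apply]

lemma N_bs (β : Ix n r) (δ : ℝ) : N δ (bs β) = δ ^ dg β := by
  classical
  unfold N bs
  rw [Finset.sum_eq_single β]
  · simp
  · intro γ _ h; simp [h]
  · simp

lemma bs_apply_ne {β γ : Ix n r} (h : γ ≠ β) : (bs β : Jet n r) γ = 0 := by
  classical
  simp [bs, h]

@[simp] lemma bs_self (β : Ix n r) : (bs β : Jet n r) β = 1 := by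
  classical
  simp [bs]

lemma N1_eq (p : Jet n r) : N 1 p = ∑ β, |p β| := by simp [N]

lemma lin_bound {T : Jet n r →ₗ[ℝ] Jet n r} {C δ : ℝ} (hδ : 0 ≤ δ) (h : ∀ β, N δ (T (bs β)) ≤ C)
    (p : Jet n r) : N δ (T p) ≤ C * N 1 p := by
  conv_lhs => rw [sum_bs p]
  rw [map_sum]
  refine (N_sum hδ _ _).trans ?_
  rw [N1_eq, Finset.mul_sum]
  refine Finset.sum_le_sum fun β _ => ?_
  rw [map_smul, N_smul, mul_comm]
  exact mul_le_mul_of_nonneg_right (h β) (abs_nonneg _)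

lemma lin_invert {R : Jet n r →ₗ[ℝ] Jet n r} (h : ∀ p, N 1 (R p) ≤ 1 / 2 * N 1 p) :
    ∃ U : Jet n r →ₗ[ℝ] Jet n r, ∀ p, U p + R (U p) = p ∧ N 1 (U p) ≤ 2 * N 1 p := by
  have hb : ∀ q : Jet n r, N 1 q ≤ 2 * N 1 (q + R q) := by
    intro q
    have h1 := N_sub (zero_le_one) (q + R q) (R q)
    rw [add_sub_cancel_right] at h1
    linarith [h q]
  have hinj : Function.Injective (LinearMap.id + R : Jet n r →ₗ[ℝ] Jet n r) := by
    rw [← LinearMap.ker_eq_bot, LinearMap.ker_eq_bot']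
    intro q hq
    have h1 := hb q
    simp only [LinearMap.add_apply, LinearMap.id_apply] at hq
    rw [hq, N_zero, mul_zero] at h1
    exact N_eq_zero one_pos (le_antisymm h1 (N_nonneg zero_le_one q))
  let L := LinearEquiv.ofInjectiveEndo _ hinj
  refine ⟨L.symm.toLinearMap, fun p => ?_⟩
  have h1 : L.symm p + R (L.symm p) = p := by
    have := L.apply_symm_apply p
    exact this
  refine ⟨h1, ?_⟩
  have h2 := hb (L.symm p)
  rw [h1] at h2
  exact h2

def Sc (s : ℝ) : Jet n r →ₗ[ℝ] Jet n r where
  toFun p := fun β => s ^ (r + 1 - dg β) * p β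
  map_add' p q := by ext β; simp [mul_add]
  map_smul' c p := by ext β; simp; ring

lemma Sc_apply (s : ℝ) (p : Jet n r) (β : Ix n r) : Sc s p β = s ^ (r + 1 - dg β) * p β := rfl

lemma Sc_Sc (s t : ℝ) (p : Jet n r) : Sc s (Sc t p) = Sc (s * t) p := by
  ext β; simp only [Sc_apply, mul_pow]; ring

@[simp] lemma Sc_one (p : Jet n r) : Sc 1 p = p := by ext β; simp [Sc_apply]

lemma Sc_inv {s : ℝ} (hs : s ≠ 0) (p : Jet n r) : Sc s (Sc s⁻¹ p) = p := by
  rw [Sc_Sc, mul_inv_cancel₀ hs, Sc_one]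

lemma Sc_inv' {s : ℝ} (hs : s ≠ 0) (p : Jet n r) : Sc s⁻¹ (Sc s p) = p := by
  rw [Sc_Sc, inv_mul_cancel₀ hs, Sc_one]

lemma Sc_eq {s : ℝ} (hs : s ≠ 0) (p : Jet n r) : Sc s p = s ^ (r + 1) • Dl s⁻¹ p := by
  ext β
  have hβ : dg β ≤ r := β.2
  rw [Sc_apply, Pi.smul_apply, Dl_apply, smul_eq_mul, ← mul_assoc, pow_sub₀ _ hs (by omega), inv_pow]

lemma N_Sc {s : ℝ} (hs : 0 < s) (δ : ℝ) (p : Jet n r) :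
    N δ (Sc s p) = s ^ (r + 1) * N (δ / s) p := by
  rw [Sc_eq hs.ne', N_smul, N_Dl (by positivity), abs_of_pos (by positivity), div_eq_inv_mul]

lemma N_Sc_self {s : ℝ} (hs : 0 < s) (p : Jet n r) : N s (Sc s p) = s ^ (r + 1) * N 1 p := by
  rw [N_Sc hs, div_self hs.ne']

lemma Sc_jm {s : ℝ} (hs : s ≠ 0) (q w : Jet n r) : Sc s (jm q w) = jm (Dl s⁻¹ q) (Sc s w) := by
  rw [Sc_eq hs, Sc_eq hs, Dl_jm, jm_smul_right]

/-! ### Fischer form and invariant subspaces -/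

def fi : LinearMap.BilinForm ℝ (Jet n r) :=
  LinearMap.mk₂ ℝ (fun p q => ∑ β : Ix n r, mf β.1 * (p β * q β))
    (fun p p' q => by simp [add_mul, mul_add, Finset.sum_add_distrib])
    (fun c p q => by simp only [Pi.smul_apply, smul_eq_mul, Finset.mul_sum]; exact Finset.sum_congr rfl fun _ _ => by ring)
    (fun p p' q => by simp [mul_add, Finset.sum_add_distrib])
    (fun c p q => by simp only [Pi.smul_apply, smul_eq_mul, Finset.mul_sum]; exact Finset.sum_congr rfl fun _ _ => by ring)

lemma fi_apply (p q : Jet n r) : fi p q = ∑ β : Ix n r, mf β.1 * (p β * q β) := rfl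

lemma fi_comm (p q : Jet n r) : fi p q = fi q p := by
  simp only [fi_apply]; exact Finset.sum_congr rfl fun _ _ => by ring

lemma fi_pos {p : Jet n r} (h : fi p p = 0) : p = 0 := by
  rw [fi_apply, Finset.sum_eq_zero_iff_of_nonneg] at h
  · ext β
    have h1 := h β (Finset.mem_univ _)
    have h2 := mf_pos β.1
    simpa [h2.ne'] using h1
  · intro β _
    have h2 := mf_pos β.1
    have := mul_self_nonneg (p β)
    positivity

lemma fi_bs (β : Ix n r) (q : Jet n r) : fi (bs β) q = mf β.1 * q β := by
  rw [fi_apply, Finset.sum_eq_single β]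
  · simp
  · intro γ _ h; simp [bs_apply_ne h]
  · simp

lemma fi_Dl (s : ℝ) (p q : Jet n r) : fi (Dl s p) q = fi p (Dl s q) := by
  simp only [fi_apply, Dl_apply]; exact Finset.sum_congr rfl fun _ _ => by ring

open MvPolynomial in
lemma fi_X (i : Fin n) (p q : Jet n r) : fi (jm (ofPoly (X i)) p) q = fi p (dj i q) := by
  suffices h : ∀ β : Ix n r, fi (jm (ofPoly (X i)) (bs β)) q = fi (bs β) (dj i q) by
    rw [sum_bs p, ← jmL_apply]
    simp only [map_sum, map_smul, LinearMap.sum_apply, LinearMap.smul_apply, jmL_apply, h]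
  intro β
  rw [fi_bs]
  have hb : (bs β : Jet n r) = ofPoly (monomial β.1 1) := by
    classical
    ext γ
    simp only [ofPoly_apply, coeff_monomial]
    by_cases h : γ = β
    · subst h; simp
    · rw [bs_apply_ne h, if_neg]
      intro h2; exact h (Subtype.ext h2.symm)
  rw [hb, jm_ofPoly]
  have hm : (X i * monomial β.1 1 : MPoly n) = monomial (β.1 + Finsupp.single i 1) 1 := by
    rw [mul_comm, X, monomial_mul, one_mul]
  rw [hm]
  have hd : (β.1 + Finsupp.single i 1).degree = dg β + 1 := by
    rw [map_add, Finsupp.degree_single]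
  by_cases h : dg β < r
  · rw [dj_lt i q β h, fi_apply,
      Finset.sum_eq_single (⟨β.1 + Finsupp.single i 1, by rw [hd]; exact h⟩ : Ix n r)]
    · simp only [ofPoly_apply, coeff_monomial, if_true, mf_succ]; ring
    · intro γ _ hγ
      rw [ofPoly_apply, coeff_monomial, if_neg]
      · simp
      · intro h2; exact hγ (Subtype.ext h2.symm)
    · simp
  · have hβ : dg β = r := le_antisymm β.2 (not_lt.1 h)
    rw [dj_eq i q β hβ, fi_apply, mul_zero]
    refine Finset.sum_eq_zero fun γ _ => ?_
    rw [ofPoly_apply, coeff_monomial, if_neg]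
    · simp
    · intro h2
      have := γ.2
      rw [← h2, hd, hβ] at this
      omega

/-- derivation- and dilation-invariant subspaces -/
def DTI (V : Submodule ℝ (Jet n r)) : Prop :=
  (∀ i, ∀ p ∈ V, dj i p ∈ V) ∧ ∀ s : ℝ, ∀ p ∈ V, Dl s p ∈ V

lemma DTI.sc {V : Submodule ℝ (Jet n r)} (h : DTI V) {s : ℝ} (hs : s ≠ 0) {p : Jet n r}
    (hp : p ∈ V) : Sc s p ∈ V := by
  rw [Sc_eq hs]; exact V.smul_mem _ (h.2 _ _ hp)

lemma DTI_top : DTI (⊤ : Submodule ℝ (Jet n r)) := ⟨fun _ _ _ => trivial, fun _ _ _ => trivial⟩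

lemma hasDerivAt_trl (h : Euc n) (p : Jet n r) (t : ℝ) :
    HasDerivAt (fun t : ℝ => tr (t • h) p) (tr (t • h) (∑ i, h i • dj i p)) t := by
  have h0 : HasDerivAt (fun s : ℝ => tr (s • h) p) (∑ i, h i • dj i p) 0 := by
    rw [hasDerivAt_pi]
    intro β
    have h1 := hasFDerivAt_tr p β ((0:ℝ) • h)
    have h2 : HasDerivAt (fun s : ℝ => s • h) h 0 := by
      simpa using (hasDerivAt_id (0:ℝ)).smul_const h
    have h3 := h1.comp_hasDerivAt (0:ℝ) h2
    refine h3.congr_deriv ?_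
    simp [Finset.sum_apply, mul_comm]
  have h4 : HasDerivAt (fun s : ℝ => tr ((s - t) • h) p) (∑ i, h i • dj i p) t := by
    have h5 : HasDerivAt (fun s : ℝ => s - t) 1 t := by simpa using (hasDerivAt_id t).sub_const t
    have h6 : HasDerivAt (fun s : ℝ => tr (s • h) p) (∑ i, h i • dj i p) (t - t) := by
      rw [sub_self]; exact h0
    have := HasDerivAt.scomp (h := fun s : ℝ => s - t) t h6 h5
    rw [one_smul] at this
    exact this
  let L : Jet n r →L[ℝ] Jet n r := LinearMap.toContinuousLinearMap (tr (t • h))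
  have h7 := L.hasFDerivAt.comp_hasDerivAt t h4
  have e : (fun s : ℝ => tr (s • h) p) = fun s => L (tr ((s - t) • h) p) := by
    ext1 s
    change _ = tr (t • h) (tr ((s - t) • h) p)
    rw [tr_tr, ← add_smul, add_sub_cancel]
  rw [e]
  exact h7

lemma DTI.tr {V : Submodule ℝ (Jet n r)} (hV : DTI V) (h : Euc n) {p : Jet n r} (hp : p ∈ V) :
    tr h p ∈ V := by
  suffices H : ∀ k : ℕ, ∀ p ∈ V, (∀ β : Ix n r, k ≤ dg β → p β = 0) → ∀ h : Euc n, NNI.tr h p ∈ V from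
    H (r + 1) p hp (fun β hβ => absurd β.2 (by have : r + 1 ≤ β.1.degree := hβ; omega)) h
  intro k
  induction k with
  | zero =>
    intro p _ h0 h
    have : p = 0 := by ext β; exact h0 β (Nat.zero_le _)
    rw [this, map_zero]; exact V.zero_mem
  | succ k ih =>
    intro p hp h0 h
    by_contra hc
    obtain ⟨l, hl1, hl2⟩ := Submodule.exists_le_ker_of_notMem hc
    have hd : ∀ t : ℝ, HasDerivAt (fun t : ℝ => l (NNI.tr (t • h) p)) 0 t := by
      intro t
      have h1 := (LinearMap.toContinuousLinearMap l).hasFDerivAt.comp_hasDerivAt t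
        (hasDerivAt_trl h p t)
      have h2 : l (NNI.tr (t • h) (∑ i, h i • dj i p)) = 0 := by
        apply hl2
        apply ih _ (V.sum_mem fun i _ => V.smul_mem _ (hV.1 i p hp))
        intro β hβ
        simp only [Finset.sum_apply, Pi.smul_apply, smul_eq_mul]
        refine Finset.sum_eq_zero fun i _ => ?_
        by_cases h3 : dg β < r
        · rw [dj_lt i p β h3, h0]
          · simp
          · change _ ≤ (β.1 + Finsupp.single i 1).degree
            rw [map_add, Finsupp.degree_single]
            have : k ≤ β.1.degree := hβ
            omega
        · rw [dj_eq i p β (le_antisymm β.2 (not_lt.1 h3)), mul_zero]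
      exact h1.congr_deriv h2
    have := is_const_of_deriv_eq_zero (fun t => (hd t).differentiableAt) (fun t => (hd t).deriv) 1 0
    simp only [one_smul, zero_smul, tr_zero] at this
    exact hl1 (this.trans (hl2 hp))

end NNI
end SecP5


open scoped BigOperators

noncomputable section SecP5b

namespace NNI

variable {n r : ℕ}

def trl (j : ℕ) : Jet n r →ₗ[ℝ] Jet n r where
  toFun p := fun β => if dg β ≤ j then p β else 0
  map_add' p q := by ext β; by_cases h : dg β ≤ j <;> simp [h]
  map_smul' c p := by ext β; by_cases h : dg β ≤ j <;> simp [h]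

lemma trl_apply (j : ℕ) (p : Jet n r) (β : Ix n r) :
    trl j p β = if dg β ≤ j then p β else 0 := rfl

def hmg (j : ℕ) : Jet n r →ₗ[ℝ] Jet n r where
  toFun p := fun β => if dg β = j then p β else 0
  map_add' p q := by ext β; by_cases h : dg β = j <;> simp [h]
  map_smul' c p := by ext β; by_cases h : dg β = j <;> simp [h]

lemma hmg_apply (j : ℕ) (p : Jet n r) (β : Ix n r) :
    hmg j p β = if dg β = j then p β else 0 := rfl

def om (V : Submodule ℝ (Jet n r)) : ℕ :=
  ∑ j ∈ Finset.range (r + 1), Module.finrank ℝ (V.map (trl j))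

def inI (W : Submodule ℝ (Jet n r)) : Submodule ℝ (Jet n r) :=
  Submodule.span ℝ {u | ∃ (q w : Jet n r) (j : ℕ), w ∈ W ∧ (∀ β, dg β < j → w β = 0) ∧
    u = jm q (hmg j w)}

lemma inI_jm {W : Submodule ℝ (Jet n r)} (a : Jet n r) {u : Jet n r} (hu : u ∈ inI W) :
    jm a u ∈ inI W := by
  have : inI W ≤ (inI W).comap (jmL a) := by
    refine Submodule.span_le.2 ?_
    rintro _ ⟨q, w, j, hw, h0, rfl⟩
    refine Submodule.subset_span ⟨jm a q, w, j, hw, h0, ?_⟩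
    rw [jmL_apply, jm_assoc]
  exact this hu

lemma inI_Dl {W : Submodule ℝ (Jet n r)} (s : ℝ) {u : Jet n r} (hu : u ∈ inI W) :
    Dl s u ∈ inI W := by
  have : inI W ≤ (inI W).comap (Dl s) := by
    refine Submodule.span_le.2 ?_
    rintro _ ⟨q, w, j, hw, h0, rfl⟩
    refine Submodule.subset_span ⟨Dl s q, s ^ j • w, j, W.smul_mem _ hw, ?_, ?_⟩
    · intro β hβ; simp [h0 β hβ]
    · rw [Dl_jm]
      congr 1
      ext β
      simp only [Dl_apply, hmg_apply, Pi.smul_apply, smul_eq_mul]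
      split_ifs with h
      · rw [h]
      · simp
  exact this hu

def orthI (W : Submodule ℝ (Jet n r)) : Submodule ℝ (Jet n r) :=
  LinearMap.BilinForm.orthogonal fi (inI W)

lemma mem_orthI {W : Submodule ℝ (Jet n r)} {v : Jet n r} :
    v ∈ orthI W ↔ ∀ u ∈ inI W, fi u v = 0 := Iff.rfl

lemma DTI_orthI (W : Submodule ℝ (Jet n r)) : DTI (orthI W) := by
  refine ⟨fun i p hp => ?_, fun s p hp => ?_⟩
  · rw [mem_orthI] at *
    intro u hu
    rw [← fi_X]
    exact hp _ (inI_jm _ hu)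
  · rw [mem_orthI] at *
    intro u hu
    rw [← fi_Dl]
    exact hp _ (inI_Dl _ hu)

lemma orthI_decomp (W : Submodule ℝ (Jet n r)) (p : Jet n r) :
    ∃ u ∈ inI W, p - u ∈ orthI W := by
  have hr : LinearMap.BilinForm.IsRefl (fi : LinearMap.BilinForm ℝ (Jet n r)) := fun p q h => by
    rw [fi_comm]; exact h
  have hd : Disjoint (inI W) (LinearMap.BilinForm.orthogonal fi (inI W)) := by
    rw [Submodule.disjoint_def]
    intro x hx hx2
    exact fi_pos (mem_orthI.1 hx2 x hx)
  have hc := LinearMap.BilinForm.isCompl_orthogonal_of_restrict_nondegenerate hr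
    (LinearMap.BilinForm.nondegenerate_restrict_of_disjoint_orthogonal fi hr hd)
  have hp : p ∈ inI W ⊔ LinearMap.BilinForm.orthogonal fi (inI W) := by
    rw [hc.sup_eq_top]; trivial
  obtain ⟨u, hu, v, hv, h⟩ := Submodule.mem_sup.1 hp
  refine ⟨u, hu, ?_⟩
  rw [← h, add_sub_cancel_left]; exact hv

lemma orthI_inter (W : Submodule ℝ (Jet n r)) (j : ℕ) :
    (orthI W).map (trl j) ⊓ W.map (trl j) = ⊥ := by
  rw [eq_bot_iff]
  rintro x ⟨⟨v, hv, hvx⟩, ⟨w, hw, rfl⟩⟩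
  rw [Submodule.mem_bot]
  by_contra hne
  have hex : ∃ i, ∃ β : Ix n r, dg β = i ∧ trl j w β ≠ 0 := by
    by_contra hc
    push Not at hc
    exact hne (by ext β; exact hc _ β rfl)
  classical
  set i := Nat.find hex with hi
  obtain ⟨β, hβ, hne2⟩ := Nat.find_spec hex
  have hij : i ≤ j := by
    rw [trl_apply] at hne2
    by_contra h
    rw [if_neg (by rw [hβ]; exact h)] at hne2
    exact hne2 rfl
  have h0 : ∀ γ : Ix n r, dg γ < i → w γ = 0 := by
    intro γ hγ
    have := Nat.find_min hex hγ
    push Not at this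
    have := this γ rfl
    rwa [trl_apply, if_pos (by omega)] at this
  have hu : hmg i w ∈ inI W := Submodule.subset_span ⟨one, w, i, hw, h0, by rw [jm_one_left]⟩
  have h1 := mem_orthI.1 hv _ hu
  have h2 : fi (hmg i w) v = fi (hmg i w) (hmg i w) := by
    simp only [fi_apply]
    refine Finset.sum_congr rfl fun γ _ => ?_
    simp only [hmg_apply]
    split_ifs with h
    · have := congrFun hvx γ
      rw [trl_apply, trl_apply, if_pos (by omega), if_pos (by omega)] at this
      rw [this]
    · simp
  rw [h2] at h1
  have h3 := congrFun (fi_pos h1) β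
  rw [hmg_apply, if_pos hβ] at h3
  rw [trl_apply, if_pos (by rw [hβ]; exact hij)] at hne2
  exact hne2 h3

lemma om_orthI (W : Submodule ℝ (Jet n r)) :
    om (orthI W) + om W ≤ om (⊤ : Submodule ℝ (Jet n r)) := by
  unfold om
  rw [← Finset.sum_add_distrib]
  refine Finset.sum_le_sum fun j _ => ?_
  have h := Submodule.finrank_sup_add_finrank_inf_eq ((orthI W).map (trl j)) (W.map (trl j))
  rw [orthI_inter, finrank_bot, add_zero] at h
  rw [← h]
  exact Submodule.finrank_mono (sup_le (Submodule.map_mono le_top) (Submodule.map_mono le_top))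

def low (T : Jet n r →ₗ[ℝ] Jet n r) : ℝ :=
  ∑ β : Ix n r, ∑ α : Ix n r, if dg α < dg β then |T (bs β) α| else 0

lemma low_ne {T : Jet n r →ₗ[ℝ] Jet n r} (h : low T ≠ 0) :
    ∃ α β : Ix n r, dg α < dg β ∧ T (bs β) α ≠ 0 := by
  by_contra hc
  push Not at hc
  apply h
  refine Finset.sum_eq_zero fun β _ => Finset.sum_eq_zero fun α _ => ?_
  split_ifs with h2
  · rw [hc α β h2, abs_zero]
  · rfl

def WW (T : Jet n r →ₗ[ℝ] Jet n r) (Q : Jet n r) : Submodule ℝ (Jet n r) :=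
  LinearMap.range T ⊔ Submodule.span ℝ {Q}

def ZZ (T : Jet n r →ₗ[ℝ] Jet n r) (Q : Jet n r) : Submodule ℝ (Jet n r) :=
  LinearMap.range (LinearMap.id - T) ⊔ Submodule.span ℝ {Q}

lemma om_count {T : Jet n r →ₗ[ℝ] Jet n r} {Q : Jet n r} (h : Q ≠ 0 ∨ low T ≠ 0) :
    om (⊤ : Submodule ℝ (Jet n r)) + 1 ≤ om (ZZ T Q) + om (WW T Q) := by
  have hsup : ∀ j, (ZZ T Q).map (trl j) ⊔ (WW T Q).map (trl j) = (⊤ : Submodule ℝ (Jet n r)).map (trl j) := by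
    intro j
    rw [← Submodule.map_sup]
    congr 1
    rw [eq_top_iff]
    intro p _
    have : p = (LinearMap.id - T : Jet n r →ₗ[ℝ] Jet n r) p + T p := by simp
    rw [this]
    exact Submodule.add_mem_sup (Submodule.mem_sup_left ⟨p, rfl⟩) (Submodule.mem_sup_left ⟨p, rfl⟩)
  have hinf : ∃ j ∈ Finset.range (r + 1), 1 ≤ Module.finrank ℝ
      ((ZZ T Q).map (trl j) ⊓ (WW T Q).map (trl j) : Submodule ℝ (Jet n r)) := by
    have key : ∃ j ∈ Finset.range (r + 1), ∃ x : Jet n r, x ≠ 0 ∧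
        x ∈ (ZZ T Q).map (trl j) ∧ x ∈ (WW T Q).map (trl j) := by
      rcases h with h | h
      · obtain ⟨β, hβ⟩ := Function.ne_iff.1 h
        have hβr : dg β ≤ r := β.2
        refine ⟨dg β, by simp; omega, trl (dg β) Q, ?_, ?_, ?_⟩
        · rw [Function.ne_iff]; refine ⟨β, ?_⟩; rw [trl_apply, if_pos le_rfl]; exact hβ
        · exact ⟨Q, Submodule.mem_sup_right (Submodule.mem_span_singleton_self Q), rfl⟩
        · exact ⟨Q, Submodule.mem_sup_right (Submodule.mem_span_singleton_self Q), rfl⟩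
      · obtain ⟨α, β, hαβ, hne⟩ := low_ne h
        have hβr : dg β ≤ r := β.2
        refine ⟨dg α, by simp; omega, trl (dg α) (T (bs β)), ?_, ?_, ?_⟩
        · rw [Function.ne_iff]; refine ⟨α, ?_⟩; rw [trl_apply, if_pos le_rfl]; exact hne
        · refine ⟨-((LinearMap.id - T : Jet n r →ₗ[ℝ] Jet n r) (bs β)), Submodule.neg_mem _ (Submodule.mem_sup_left ⟨_, rfl⟩), ?_⟩
          have : trl (dg α) (bs β : Jet n r) = 0 := by
            ext γ
            rw [trl_apply]
            split_ifs with h2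
            · rw [bs_apply_ne]; rfl
              rintro rfl; omega
            · rfl
          simp [this]
        · exact ⟨T (bs β), Submodule.mem_sup_left ⟨_, rfl⟩, rfl⟩
    obtain ⟨j, hj, x, hx, h1, h2⟩ := key
    refine ⟨j, hj, ?_⟩
    rw [Nat.one_le_iff_ne_zero, Submodule.finrank_eq_zero.ne]
    intro hb
    have hx2 := Submodule.mem_inf.2 ⟨h1, h2⟩
    rw [hb] at hx2
    exact hx ((Submodule.mem_bot ℝ).1 hx2)
  unfold om
  rw [← Finset.sum_add_distrib, Nat.add_one_le_iff]
  obtain ⟨j, hj, hj1⟩ := hinf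
  refine Finset.sum_lt_sum (fun i _ => ?_) ⟨j, hj, ?_⟩
  · have h := Submodule.finrank_sup_add_finrank_inf_eq ((ZZ T Q).map (trl i)) ((WW T Q).map (trl i))
    rw [hsup] at h
    omega
  · have h := Submodule.finrank_sup_add_finrank_inf_eq ((ZZ T Q).map (trl j)) ((WW T Q).map (trl j))
    rw [hsup] at h
    omega

/-! ### Approximation -/

def Comb (s : ℝ) (T : Jet n r →ₗ[ℝ] Jet n r) (Q : Jet n r) (c : Ix n r → Jet n r) (t : Ix n r → ℝ) :
    Jet n r := ∑ η, jm (bs η) (Sc s⁻¹ (T (c η) + t η • Q))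

lemma Comb_add (s : ℝ) (T : Jet n r →ₗ[ℝ] Jet n r) (Q : Jet n r) (c c' : Ix n r → Jet n r)
    (t t' : Ix n r → ℝ) : Comb s T Q (c + c') (t + t') = Comb s T Q c t + Comb s T Q c' t' := by
  unfold Comb
  rw [← Finset.sum_add_distrib]
  refine Finset.sum_congr rfl fun η _ => ?_
  rw [← jm_add_right, ← map_add]
  simp only [Pi.add_apply, map_add, add_smul]
  congr 1; abel

lemma Comb_smul (s : ℝ) (T : Jet n r →ₗ[ℝ] Jet n r) (Q : Jet n r) (c : Ix n r → Jet n r)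
    (t : Ix n r → ℝ) (a : ℝ) : Comb s T Q (a • c) (a • t) = a • Comb s T Q c t := by
  unfold Comb
  rw [Finset.smul_sum]
  refine Finset.sum_congr rfl fun η _ => ?_
  rw [← jm_smul_right, ← map_smul]
  simp only [Pi.smul_apply, map_smul, smul_add, smul_smul, smul_eq_mul]

lemma jm_sum_bs (q u : Jet n r) : jm q u = ∑ η, jm (bs η) (q η • u) := by
  conv_lhs => rw [sum_bs q, jm_comm, ← jmL_apply, map_sum]
  refine Finset.sum_congr rfl fun η _ => ?_
  rw [jmL_apply, jm_smul_right, jm_smul_right, jm_comm]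

lemma continuous_N (δ : ℝ) : Continuous (fun p : Jet n r => N δ p) := by
  unfold N; fun_prop

open Filter Topology in
lemma approx {T : Jet n r →ₗ[ℝ] Jet n r} {Q u : Jet n r} (hu : u ∈ inI (WW T Q)) :
    ∀ ε > 0, ∀ᶠ s in 𝓝[>] (0:ℝ), ∃ c t, N 1 (Comb s T Q c t - u) < ε := by
  unfold inI at hu
  induction hu using Submodule.span_induction with
  | mem u hu =>
    obtain ⟨q, w, j, hw, h0, rfl⟩ := hu
    intro ε hε
    obtain ⟨_, ⟨c, rfl⟩, _, hQ, rfl⟩ := Submodule.mem_sup.1 hw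
    obtain ⟨t, rfl⟩ := Submodule.mem_span_singleton.1 hQ
    set w := T c + t • Q with hwd
    by_cases hjr : j ≤ r
    swap
    · refine Eventually.of_forall fun s => ⟨0, 0, ?_⟩
      have : hmg j w = 0 := by
        ext β
        have hβ : dg β ≤ r := β.2
        rw [hmg_apply, if_neg (by omega)]; rfl
      rw [this]
      simpa [Comb] using hε
    have hlim : Tendsto (fun s : ℝ => (s ^ (r + 1 - j) • Sc s⁻¹ w : Jet n r)) (𝓝[>] 0)
        (𝓝 (hmg j w)) := by
      rw [tendsto_pi_nhds]
      intro β
      have hβ : dg β ≤ r := β.2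
      rcases lt_trichotomy (dg β) j with h | h | h
      · simp [Sc_apply, hmg_apply, h0 β h]
      · rw [hmg_apply, if_pos h]
        refine tendsto_const_nhds.congr' ?_
        filter_upwards [self_mem_nhdsWithin] with s hs
        have hs0 : (s:ℝ) ≠ 0 := ne_of_gt hs
        rw [Pi.smul_apply, Sc_apply, smul_eq_mul, h, ← mul_assoc, inv_pow,
          mul_inv_cancel₀ (pow_ne_zero _ hs0), one_mul]
      · rw [hmg_apply, if_neg (by omega)]
        have hl : Tendsto (fun s : ℝ => s ^ (dg β - j) * w β) (𝓝[>] 0) (𝓝 0) := by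
          have : Tendsto (fun s : ℝ => s ^ (dg β - j) * w β) (𝓝 0) (𝓝 ((0:ℝ) ^ (dg β - j) * w β)) := by
            apply Continuous.tendsto; fun_prop
          rw [zero_pow (by omega), zero_mul] at this
          exact this.mono_left nhdsWithin_le_nhds
        refine hl.congr' ?_
        filter_upwards [self_mem_nhdsWithin] with s hs
        have hs0 : (s:ℝ) ≠ 0 := ne_of_gt hs
        rw [Pi.smul_apply, Sc_apply, smul_eq_mul, ← mul_assoc, inv_pow]
        congr 1
        have : r + 1 - j = (dg β - j) + (r + 1 - dg β) := by omega
        rw [this, pow_add, mul_assoc, mul_inv_cancel₀ (pow_ne_zero _ hs0), mul_one]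
    have hcont : Continuous (fun p : Jet n r => N 1 (jm q p - jm q (hmg j w))) := by
      have h1 : Continuous (jmL q) := LinearMap.continuous_of_finiteDimensional _
      exact (continuous_N 1).comp (h1.sub continuous_const)
    have hlim2 := (hcont.tendsto (hmg j w)).comp hlim
    rw [sub_self, N_zero] at hlim2
    filter_upwards [hlim2.eventually (gt_mem_nhds hε)] with s hs
    refine ⟨fun η => (q η * s ^ (r + 1 - j)) • c, fun η => q η * s ^ (r + 1 - j) * t, ?_⟩
    have : Comb s T Q (fun η => (q η * s ^ (r + 1 - j)) • c) (fun η => q η * s ^ (r + 1 - j) * t)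
        = jm q (s ^ (r + 1 - j) • Sc s⁻¹ w) := by
      rw [jm_sum_bs, Comb]
      refine Finset.sum_congr rfl fun η _ => ?_
      congr 1
      rw [smul_smul, ← map_smul]
      congr 1
      rw [hwd, smul_add, map_smul, smul_smul]
    rw [this]
    exact hs
  | zero => intro ε hε; exact Eventually.of_forall fun s => ⟨0, 0, by simpa [Comb] using hε⟩
  | add u v _ _ hu hv =>
    intro ε hε
    filter_upwards [hu (ε / 2) (by positivity), hv (ε / 2) (by positivity)] with s hs hs'
    obtain ⟨c, t, h⟩ := hs
    obtain ⟨c', t', h'⟩ := hs'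
    refine ⟨c + c', t + t', ?_⟩
    rw [Comb_add, add_sub_add_comm]
    have := N_add zero_le_one (Comb s T Q c t - u) (Comb s T Q c' t' - v)
    linarith
  | smul a u _ hu =>
    intro ε hε
    filter_upwards [hu (ε / (|a| + 1)) (by positivity)] with s hs
    obtain ⟨c, t, h⟩ := hs
    refine ⟨a • c, a • t, ?_⟩
    rw [Comb_smul, ← smul_sub, N_smul]
    rw [lt_div_iff₀ (by positivity)] at h
    have := N_nonneg zero_le_one (Comb s T Q c t - u)
    nlinarith

end NNI
end SecP5b


open scoped BigOperators

noncomputable section SecP5c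

namespace NNI

variable {n r : ℕ}

def CombL (s : ℝ) (T : Jet n r →ₗ[ℝ] Jet n r) (Q : Jet n r) :
    ((Ix n r → Jet n r) × (Ix n r → ℝ)) →ₗ[ℝ] Jet n r where
  toFun z := Comb s T Q z.1 z.2
  map_add' z z' := Comb_add s T Q _ _ _ _
  map_smul' a z := Comb_smul s T Q _ _ a

lemma CombL_apply (s : ℝ) (T : Jet n r →ₗ[ℝ] Jet n r) (Q : Jet n r) (z) :
    CombL s T Q z = Comb s T Q z.1 z.2 := rfl

/-- linear extension from columns -/
def colL {X : Type*} [AddCommGroup X] [Module ℝ X] (u : Ix n r → X) : Jet n r →ₗ[ℝ] X where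
  toFun p := ∑ β, p β • u β
  map_add' p q := by simp [add_smul, Finset.sum_add_distrib]
  map_smul' c p := by simp [Finset.smul_sum, smul_smul]

lemma colL_apply {X : Type*} [AddCommGroup X] [Module ℝ X] (u : Ix n r → X) (p : Jet n r) :
    colL u p = ∑ β, p β • u β := rfl

lemma colL_bs {X : Type*} [AddCommGroup X] [Module ℝ X] (u : Ix n r → X) (β : Ix n r) :
    colL u (bs β) = u β := by
  rw [colL_apply, Finset.sum_eq_single β]
  · simp
  · intro γ _ h; simp [bs_apply_ne h]
  · simp

def Concl (T : Jet n r →ₗ[ℝ] Jet n r) (Q : Jet n r) (d : ℕ) (s0 C' : ℝ) : Prop :=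
  ∃ s, s0 ≤ s ∧ s ≤ 1 ∧ ∃ V' : Submodule ℝ (Jet n r), DTI V' ∧ om V' < d ∧
    ∃ T' : Jet n r →ₗ[ℝ] Jet n r, (∀ p, p - T' p ∈ V') ∧
      ∀ p, ∃ c t, T' p = Comb s T Q c t ∧ ∀ η, N 1 (c η) ≤ C' * N 1 p ∧ |t η| ≤ C' * N 1 p

lemma Concl.mono {T : Jet n r →ₗ[ℝ] Jet n r} {Q : Jet n r} {d : ℕ} {s0 s1 C' C'' : ℝ}
    (h : Concl T Q d s0 C') (hs : s1 ≤ s0) (hC : C' ≤ C'') : Concl T Q d s1 C'' := by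
  obtain ⟨s, h1, h2, V', h3, h4, T', h5, h6⟩ := h
  refine ⟨s, hs.trans h1, h2, V', h3, h4, T', h5, fun p => ?_⟩
  obtain ⟨c, t, h7, h8⟩ := h6 p
  have hp := N_nonneg zero_le_one p
  exact ⟨c, t, h7, fun η => ⟨(h8 η).1.trans (by gcongr), (h8 η).2.trans (by gcongr)⟩⟩

open Filter Topology in
lemma RLpt {T0 : Jet n r →ₗ[ℝ] Jet n r} {Q0 : Jet n r} {d : ℕ} (h : Q0 ≠ 0 ∨ low T0 ≠ 0)
    (hd : om (ZZ T0 Q0) ≤ d) :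
    ∃ (s : ℝ) (V' : Submodule ℝ (Jet n r)) (π : Jet n r →ₗ[ℝ] Jet n r)
      (c : Ix n r → Ix n r → Jet n r) (t : Ix n r → Ix n r → ℝ), 0 < s ∧ s ≤ 1 ∧ DTI V' ∧ om V' < d ∧
      (∀ p, p - π p ∈ V') ∧ ∀ β, N 1 (Comb s T0 Q0 (c β) (t β) - π (bs β)) < 1 / 2 := by
  have h1 := om_orthI (WW T0 Q0)
  have h2 := om_count h
  choose u hu1 hu2 using fun β : Ix n r => orthI_decomp (WW T0 Q0) (bs β)
  have h3 : ∀ᶠ s in 𝓝[>] (0:ℝ), ∀ β, ∃ c t, N 1 (Comb s T0 Q0 c t - u β) < 1 / 2 := by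
    rw [eventually_all]
    intro β
    exact approx (hu1 β) (1 / 2) (by norm_num)
  have h4 : ∀ᶠ s in 𝓝[>] (0:ℝ), s ∈ Set.Ioo (0:ℝ) 1 :=
    Ioo_mem_nhdsGT (by norm_num)
  obtain ⟨s, hs, hs1⟩ := (h3.and h4).exists
  choose c t hct using hs
  refine ⟨s, orthI (WW T0 Q0), colL u, c, t, hs1.1, hs1.2.le, DTI_orthI _, by omega, ?_, ?_⟩
  · intro p
    have : p - colL u p = ∑ β, p β • (bs β - u β) := by
      simp only [smul_sub, Finset.sum_sub_distrib, ← sum_bs p, colL_apply]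
    rw [this]
    exact Submodule.sum_mem _ fun β _ => Submodule.smul_mem _ _ (hu2 β)
  · intro β; rw [colL_bs]; exact hct β

lemma Concl_of {T : Jet n r →ₗ[ℝ] Jet n r} {Q : Jet n r} {d : ℕ} {s C1 : ℝ}
    {V' : Submodule ℝ (Jet n r)} {π : Jet n r →ₗ[ℝ] Jet n r} {c : Ix n r → Ix n r → Jet n r}
    {t : Ix n r → Ix n r → ℝ} (hs1 : s ≤ 1) (hV : DTI V') (hom : om V' < d)
    (hπ : ∀ p, p - π p ∈ V') (hb : ∀ β, N 1 (Comb s T Q (c β) (t β) - π (bs β)) ≤ 1 / 2)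
    (hC : 0 ≤ C1) (hc : ∀ β η, N 1 (c β η) ≤ C1) (ht : ∀ β η, |t β η| ≤ C1) :
    Concl T Q d s (C1 * 2) := by
  let z : Ix n r → (Ix n r → Jet n r) × (Ix n r → ℝ) := fun β => (c β, t β)
  let S : Jet n r →ₗ[ℝ] Jet n r := CombL s T Q ∘ₗ colL z
  obtain ⟨U, hU⟩ := lin_invert (R := S - π) (fun p => by
    refine lin_bound zero_le_one (fun β => ?_) p
    rw [LinearMap.sub_apply, LinearMap.comp_apply, colL_bs]
    exact hb β)
  refine ⟨s, le_rfl, hs1, V', hV, hom, S ∘ₗ U, fun p => ?_, fun p => ?_⟩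
  · have h1 := (hU p).1
    have : p - (S ∘ₗ U) p = U p - π (U p) := by
      rw [LinearMap.comp_apply, LinearMap.sub_apply] at *
      nth_rewrite 1 [← h1]
      abel
    rw [this]
    exact hπ _
  · refine ⟨(colL z (U p)).1, (colL z (U p)).2, rfl, fun η => ?_⟩
    have hUp := (hU p).2
    have e1 : (colL z (U p)).1 η = ∑ β, U p β • c β η := by
      rw [colL_apply, Prod.fst_sum, Finset.sum_apply]; rfl
    have e2 : (colL z (U p)).2 η = ∑ β, U p β * t β η := by
      rw [colL_apply, Prod.snd_sum, Finset.sum_apply]; rfl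
    have hfin : C1 * N 1 (U p) ≤ C1 * 2 * N 1 p := by
      rw [mul_assoc]; gcongr
    constructor
    · rw [e1]
      refine (N_sum zero_le_one _ _).trans (le_trans ?_ hfin)
      rw [N1_eq, Finset.mul_sum]
      refine Finset.sum_le_sum fun β _ => ?_
      rw [N_smul, mul_comm]
      exact mul_le_mul_of_nonneg_right (hc β η) (abs_nonneg _)
    · rw [e2]
      refine (Finset.abs_sum_le_sum_abs _ _).trans (le_trans ?_ hfin)
      rw [N1_eq, Finset.mul_sum]
      refine Finset.sum_le_sum fun β _ => ?_
      rw [abs_mul, mul_comm]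
      exact mul_le_mul_of_nonneg_right (ht β η) (abs_nonneg _)

/-! ### Compactness -/

abbrev JJ (n r : ℕ) : Type := (Jet n r →L[ℝ] Jet n r) × Jet n r

def Amap (j : ℕ) (z : JJ n r) : (Jet n r × ℝ) →L[ℝ] Jet n r :=
  (LinearMap.toContinuousLinearMap (trl j)).comp
    ((ContinuousLinearMap.id ℝ (Jet n r) - z.1).comp (ContinuousLinearMap.fst ℝ (Jet n r) ℝ) +
      ContinuousLinearMap.smulRightL ℝ (Jet n r × ℝ) (Jet n r)
        (ContinuousLinearMap.snd ℝ (Jet n r) ℝ) z.2)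

lemma continuous_Amap (j : ℕ) : Continuous (Amap j : JJ n r → _) := by
  unfold Amap; fun_prop

lemma range_Amap (j : ℕ) (z : JJ n r) :
    LinearMap.range (Amap j z : (Jet n r × ℝ) →ₗ[ℝ] Jet n r) = (ZZ (z.1 : Jet n r →ₗ[ℝ] Jet n r) z.2).map (trl j) := by
  ext x
  constructor
  · rintro ⟨⟨p, t⟩, rfl⟩
    refine ⟨(LinearMap.id - (z.1 : Jet n r →ₗ[ℝ] Jet n r) : Jet n r →ₗ[ℝ] Jet n r) p + t • z.2, ?_, rfl⟩
    exact Submodule.add_mem_sup ⟨p, rfl⟩ (Submodule.smul_mem _ _ (Submodule.mem_span_singleton_self _))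
  · rintro ⟨w, hw, rfl⟩
    obtain ⟨_, ⟨p, rfl⟩, _, hQ, rfl⟩ := Submodule.mem_sup.1 hw
    obtain ⟨t, rfl⟩ := Submodule.mem_span_singleton.1 hQ
    exact ⟨(p, t), rfl⟩

open Filter Topology in
lemma om_lsc (z0 : JJ n r) : ∀ᶠ z : JJ n r in 𝓝 z0,
    om (ZZ (z0.1 : Jet n r →ₗ[ℝ] Jet n r) z0.2) ≤ om (ZZ (z.1 : Jet n r →ₗ[ℝ] Jet n r) z.2) := by
  have h : ∀ j ∈ Finset.range (r + 1), ∀ᶠ z : JJ n r in 𝓝 z0,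
      Module.finrank ℝ ((ZZ (z0.1 : Jet n r →ₗ[ℝ] Jet n r) z0.2).map (trl j)) ≤
      Module.finrank ℝ ((ZZ (z.1 : Jet n r →ₗ[ℝ] Jet n r) z.2).map (trl j)) := by
    intro j _
    have ho := isOpen_setOfPred_nat_le_rank (𝕜 := ℝ) (E := Jet n r × ℝ) (F := Jet n r)
      (Module.finrank ℝ ((ZZ (z0.1 : Jet n r →ₗ[ℝ] Jet n r) z0.2).map (trl j)))
    have ho2 := ho.preimage (continuous_Amap j)
    have hrk : ∀ z : JJ n r, (Amap j z : (Jet n r × ℝ) →ₗ[ℝ] Jet n r).rank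
        = (Module.finrank ℝ ((ZZ (z.1 : Jet n r →ₗ[ℝ] Jet n r) z.2).map (trl j)) : Cardinal) := by
      intro z
      rw [Module.finrank_eq_rank, ← range_Amap]
    have hm : z0 ∈ (Amap j) ⁻¹' {f : (Jet n r × ℝ) →L[ℝ] Jet n r |
        ((Module.finrank ℝ ((ZZ (z0.1 : Jet n r →ₗ[ℝ] Jet n r) z0.2).map (trl j)) : ℕ) : Cardinal)
          ≤ (f : (Jet n r × ℝ) →ₗ[ℝ] Jet n r).rank} := by
      rw [Set.mem_preimage, Set.mem_ofPred_eq, hrk]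
    filter_upwards [ho2.mem_nhds hm] with z hz
    have hz' := hz
    rw [Set.mem_preimage, Set.mem_ofPred_eq, hrk] at hz'
    exact_mod_cast hz'
  rw [← Finset.eventually_all] at h
  filter_upwards [h] with z hz
  exact Finset.sum_le_sum hz

lemma continuous_Comb (s : ℝ) (c : Ix n r → Jet n r) (t : Ix n r → ℝ) :
    Continuous fun z : JJ n r => Comb s (z.1 : Jet n r →ₗ[ℝ] Jet n r) z.2 c t := by
  unfold Comb
  refine continuous_finsetSum _ fun η _ => ?_
  have h1 : Continuous (fun p : Jet n r => jm (bs η) (Sc s⁻¹ p)) :=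
    LinearMap.continuous_of_finiteDimensional ((jmL (bs η)) ∘ₗ (Sc s⁻¹))
  refine h1.comp ?_
  have : Continuous fun z : JJ n r => z.1 (c η) + t η • z.2 := by fun_prop
  exact this

lemma continuous_low : Continuous fun z : JJ n r => low (z.1 : Jet n r →ₗ[ℝ] Jet n r) := by
  unfold low
  refine continuous_finsetSum _ fun β _ => continuous_finsetSum _ fun α _ => ?_
  split_ifs
  · have : Continuous fun z : JJ n r => |z.1 (bs β) α| := by fun_prop
    exact this
  · exact continuous_const

open Filter Topology in
theorem RL_cpt (K : Set (JJ n r)) (hK : IsCompact K) (d : ℕ)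
    (hne : ∀ z ∈ K, z.2 ≠ 0 ∨ low (z.1 : Jet n r →ₗ[ℝ] Jet n r) ≠ 0) :
    ∃ s0 C' : ℝ, 0 < s0 ∧ s0 ≤ 1 ∧ 0 < C' ∧
      ∀ z ∈ K, om (ZZ (z.1 : Jet n r →ₗ[ℝ] Jet n r) z.2) ≤ d →
        Concl (z.1 : Jet n r →ₗ[ℝ] Jet n r) z.2 d s0 C' := by
  refine hK.induction_on (p := fun U => ∃ s0 C' : ℝ, 0 < s0 ∧ s0 ≤ 1 ∧ 0 < C' ∧
      ∀ z ∈ U, om (ZZ (z.1 : Jet n r →ₗ[ℝ] Jet n r) z.2) ≤ d →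
        Concl (z.1 : Jet n r →ₗ[ℝ] Jet n r) z.2 d s0 C') ?_ ?_ ?_ ?_
  · exact ⟨1, 1, one_pos, le_rfl, one_pos, fun z hz => absurd hz (Set.notMem_empty _)⟩
  · rintro U U' hU ⟨s0, C', h1, h2, h3, h4⟩
    exact ⟨s0, C', h1, h2, h3, fun z hz => h4 z (hU hz)⟩
  · rintro U U' ⟨s0, C', h1, h2, h3, h4⟩ ⟨s1, C1, g1, g2, g3, g4⟩
    refine ⟨min s0 s1, max C' C1, lt_min h1 g1, (min_le_left _ _).trans h2, lt_max_of_lt_left h3, ?_⟩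
    rintro z (hz | hz) hd
    · exact (h4 z hz hd).mono (min_le_left _ _) (le_max_left _ _)
    · exact (g4 z hz hd).mono (min_le_right _ _) (le_max_right _ _)
  · intro z0 hz0
    by_cases hd : om (ZZ (z0.1 : Jet n r →ₗ[ℝ] Jet n r) z0.2) ≤ d
    · obtain ⟨s, V', π, c, t, hs, hs1, hV, hom, hπ, hb⟩ := RLpt (hne z0 hz0) hd
      have hev : ∀ᶠ z : JJ n r in 𝓝 z0, ∀ β,
          N 1 (Comb s (z.1 : Jet n r →ₗ[ℝ] Jet n r) z.2 (c β) (t β) - π (bs β)) < 1 / 2 := by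
        rw [eventually_all]
        intro β
        have hc : Continuous fun z : JJ n r =>
            N 1 (Comb s (z.1 : Jet n r →ₗ[ℝ] Jet n r) z.2 (c β) (t β) - π (bs β)) :=
          (continuous_N 1).comp ((continuous_Comb s (c β) (t β)).sub continuous_const)
        exact hc.continuousAt.eventually (gt_mem_nhds (hb β))
      set C1 : ℝ := ∑ β, ∑ η, (N 1 (c β η) + |t β η|) + 1 with hC1
      have hnn : ∀ β η, 0 ≤ N 1 (c β η) + |t β η| := fun β η =>
        add_nonneg (N_nonneg zero_le_one _) (abs_nonneg _)
      have hle : ∀ β η, N 1 (c β η) + |t β η| ≤ C1 := by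
        intro β η
        have a1 := Finset.single_le_sum (f := fun η => N 1 (c β η) + |t β η|)
          (fun η _ => hnn β η) (Finset.mem_univ η)
        have a2 := Finset.single_le_sum (f := fun β => ∑ η, (N 1 (c β η) + |t β η|))
          (fun β _ => Finset.sum_nonneg fun η _ => hnn β η) (Finset.mem_univ β)
        linarith
      have hC1p : 0 < C1 := by
        have : 0 ≤ ∑ β, ∑ η, (N 1 (c β η) + |t β η|) :=
          Finset.sum_nonneg fun β _ => Finset.sum_nonneg fun η _ => hnn β η
        linarith
      refine ⟨_, mem_nhdsWithin_of_mem_nhds hev, s, C1 * 2, hs, hs1, by positivity, ?_⟩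
      intro z hz _
      refine Concl_of hs1 hV hom hπ (fun β => (hz β).le) hC1p.le ?_ ?_
      · intro β η; linarith [hle β η, abs_nonneg (t β η)]
      · intro β η; linarith [hle β η, N_nonneg zero_le_one (c β η)]
    · refine ⟨_, mem_nhdsWithin_of_mem_nhds (om_lsc z0), 1, 1, one_pos, le_rfl, one_pos, ?_⟩
      intro z hz hz2
      exact absurd (le_trans hz hz2) hd

lemma norm_le_N1 (p : Jet n r) : ‖p‖ ≤ N 1 p := by
  rw [pi_norm_le_iff_of_nonneg (N_nonneg zero_le_one _)]
  intro β; exact abs_le_N1 p β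

lemma N1_le_norm (p : Jet n r) : N 1 p ≤ Fintype.card (Ix n r) * ‖p‖ := by
  rw [N1_eq]
  refine (Finset.sum_le_card_nsmul _ _ ‖p‖ fun β _ => norm_le_pi_norm p β).trans ?_
  simp

/-- Relabeling lemma. -/
theorem RL (n r : ℕ) (C : ℝ) (hC : 0 ≤ C) (d : ℕ) : ∃ s0 C' : ℝ, 0 < s0 ∧ s0 ≤ 1 ∧ 0 < C' ∧
    ∀ (V : Submodule ℝ (Jet n r)) (T : Jet n r →ₗ[ℝ] Jet n r) (Q : Jet n r), om V ≤ d →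
      (∀ p, p - T p ∈ V) → (∀ p, N 1 (T p) ≤ C * N 1 p) → Q ∈ V → N 1 Q ≤ 1 →
      (N 1 Q = 1 ∨ 1 ≤ low T) → Concl T Q d s0 C' := by
  let K : Set (JJ n r) := Metric.closedBall 0 (C * Fintype.card (Ix n r) + 1) ∩
    {z | 1 ≤ N 1 z.2 ∨ 1 ≤ low (z.1 : Jet n r →ₗ[ℝ] Jet n r)}
  have hKc : IsCompact K := by
    haveI : ProperSpace (JJ n r) := FiniteDimensional.proper ℝ _
    refine (isCompact_closedBall _ _).inter_right ?_
    exact (isClosed_le continuous_const ((continuous_N 1).comp continuous_snd)).union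
      (isClosed_le continuous_const continuous_low)
  obtain ⟨s0, C', h1, h2, h3, h4⟩ := RL_cpt K hKc d (by
    rintro z ⟨_, hz | hz⟩
    · left; intro h0; rw [h0, N_zero] at hz; linarith
    · right; intro h0; rw [h0] at hz; linarith)
  refine ⟨s0, C', h1, h2, h3, fun V T Q hV hT hTb hQ hQb hor => ?_⟩
  refine h4 (LinearMap.toContinuousLinearMap T, Q) ⟨?_, ?_⟩ ?_
  · rw [mem_closedBall_zero_iff, Prod.norm_def]
    refine max_le ?_ ?_
    · refine le_trans (ContinuousLinearMap.opNorm_le_bound _ (M := C * Fintype.card (Ix n r)) (by positivity) ?_) (by linarith)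
      intro p
      refine (norm_le_N1 _).trans ((hTb p).trans ?_)
      rw [mul_assoc]
      exact mul_le_mul_of_nonneg_left (N1_le_norm p) hC
    · have : 0 ≤ C * Fintype.card (Ix n r) := by positivity
      exact (norm_le_N1 _).trans (hQb.trans (by linarith))
  · rcases hor with h | h
    · left; exact h.ge
    · right; exact h
  · refine le_trans ?_ hV
    unfold om
    refine Finset.sum_le_sum fun j _ => Submodule.finrank_mono (Submodule.map_mono ?_)
    refine sup_le ?_ ?_
    · rintro _ ⟨p, rfl⟩; exact hT p
    · rw [Submodule.span_singleton_le_iff_mem]; exact hQ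

end NNI
end SecP5c


open scoped BigOperators

noncomputable section SecP5d

namespace NNI

variable {n r : ℕ}

def HasT (E : Finset (Euc n)) (f : Euc n → ℝ) (V : Submodule ℝ (Jet n r)) (x : Euc n) (δ : ℝ)
    (p0 : Jet n r) (M : ℝ) (k : ℕ) (C : ℝ) (T : Jet n r →ₗ[ℝ] Jet n r) : Prop :=
  (∀ p, p - T p ∈ V) ∧ (∀ p, N 1 (T p) ≤ C * N 1 p) ∧
    ∀ p, N 1 p ≤ 1 → p0 + (M / C) • Sc δ (T p) ∈ GamK E f k x M

def Has (E : Finset (Euc n)) (f : Euc n → ℝ) (V : Submodule ℝ (Jet n r)) (x : Euc n) (δ : ℝ)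
    (p0 : Jet n r) (M : ℝ) (k : ℕ) (C : ℝ) : Prop :=
  DTI V ∧ ∃ T, HasT E f V x δ p0 M k C T

lemma HasT.center {E : Finset (Euc n)} {f : Euc n → ℝ} {V : Submodule ℝ (Jet n r)} {x : Euc n}
    {δ M C : ℝ} {p0 : Jet n r} {k : ℕ} {T : Jet n r →ₗ[ℝ] Jet n r}
    (h : HasT E f V x δ p0 M k C T) : p0 ∈ GamK E f k x M := by
  have := h.2.2 0 (by rw [N_zero]; norm_num)
  simpa using this

lemma HasT.mono {E : Finset (Euc n)} {f : Euc n → ℝ} {V : Submodule ℝ (Jet n r)} {x : Euc n}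
    {δ M M' C C' : ℝ} {p0 : Jet n r} {k k' : ℕ} {T : Jet n r →ₗ[ℝ] Jet n r}
    (h : HasT E f V x δ p0 M k C T) (hM0 : 0 < M) (hC0 : 0 < C) (hM : M ≤ M') (hC : C ≤ C')
    (hk : k' ≤ k) (hMC : M' * C ≤ M * C') : HasT E f V x δ p0 M' k' C' T := by
  refine ⟨h.1, fun p => (h.2.1 p).trans (by have := N_nonneg zero_le_one p; gcongr), fun p hp => ?_⟩
  have hC0' := hC0.trans_le hC
  set a : ℝ := (M' / C') / (M / C) with ha
  have ha0 : 0 ≤ a := by have := hM0.trans_le hM; positivity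
  have ha1 : a ≤ 1 := by
    rw [ha, div_le_one (by positivity), div_le_div_iff₀ hC0' hC0]; exact hMC
  have h1 := h.2.2 (a • p) (by
    rw [N_smul, abs_of_nonneg ha0]
    have := N_nonneg zero_le_one p
    nlinarith)
  rw [map_smul, map_smul, smul_smul, ha, mul_div_cancel₀ _ (by positivity)] at h1
  exact GamK.mono h1 hk hM

lemma Has.mono {E : Finset (Euc n)} {f : Euc n → ℝ} {V : Submodule ℝ (Jet n r)} {x : Euc n}
    {δ M M' C C' : ℝ} {p0 : Jet n r} {k k' : ℕ}
    (h : Has E f V x δ p0 M k C) (hM0 : 0 < M) (hC0 : 0 < C) (hM : M ≤ M') (hC : C ≤ C')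
    (hk : k' ≤ k) (hMC : M' * C ≤ M * C') : Has E f V x δ p0 M' k' C' :=
  ⟨h.1, h.2.imp fun _ hT => hT.mono hM0 hC0 hM hC hk hMC⟩

lemma avg {K : Set (Jet n r)} (hK : Convex ℝ K) (p0 : Jet n r) (v : Ix n r → Jet n r)
    (h : ∀ η, p0 + v η ∈ K) : p0 + (Fintype.card (Ix n r) : ℝ)⁻¹ • ∑ η, v η ∈ K := by
  have hc : (0:ℝ) < Fintype.card (Ix n r) := by
    have : 0 < Fintype.card (Ix n r) := Fintype.card_pos_iff.2 ⟨z0⟩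
    exact_mod_cast this
  have h1 := hK.sum_mem (t := Finset.univ) (w := fun _ : Ix n r => (Fintype.card (Ix n r) : ℝ)⁻¹)
    (z := fun η => p0 + v η) (fun _ _ => by positivity)
    (by simp only [Finset.sum_const, Finset.card_univ, nsmul_eq_mul]; exact mul_inv_cancel₀ hc.ne')
    (fun η _ => h η)
  have h2 : ∑ η, (Fintype.card (Ix n r) : ℝ)⁻¹ • (p0 + v η)
      = p0 + (Fintype.card (Ix n r) : ℝ)⁻¹ • ∑ η, v η := by
    rw [← Finset.smul_sum, Finset.sum_add_distrib, smul_add]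
    congr 1
    simp only [Finset.sum_const, Finset.card_univ]
    rw [← Nat.cast_smul_eq_nsmul ℝ, smul_smul, inv_mul_cancel₀ hc.ne', one_smul]
  rwa [h2] at h1

lemma card_pos' (n r : ℕ) : (1:ℝ) ≤ Fintype.card (Ix n r) := by
  have : 0 < Fintype.card (Ix n r) := Fintype.card_pos_iff.2 ⟨z0⟩
  exact_mod_cast this

def Arc (n r : ℕ) (C a s0 C' : ℝ) : ℝ :=
  2 * C' * Cw n r * ((C + 1) / s0 ^ (r + 1)) * Fintype.card (Ix n r) / a

lemma RC {E : Finset (Euc n)} {f : Euc n → ℝ} {x : Euc n}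
    {δ M C a s0 C' : ℝ} {p0 Q : Jet n r} {k d : ℕ} {T : Jet n r →ₗ[ℝ] Jet n r}
    (hδ : 0 < δ) (hM : 0 < M) (hC : 1 ≤ C) (ha : 0 < a) (ha1 : a ≤ 1) (hs0 : 0 < s0) (hs01 : s0 ≤ 1)
    (hC' : 1 ≤ C') (hT : ∀ p, N 1 (T p) ≤ C * N 1 p) (hQ : N 1 Q ≤ 1)
    (hG : ∀ (c : Jet n r) (t : ℝ), N 1 c ≤ 1 → |t| ≤ 1 → p0 + (a * M) • Sc δ (T c + t • Q) ∈ GamK E f k x M)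
    (hc : Concl T Q d s0 C') :
    ∃ s, s0 ≤ s ∧ s ≤ 1 ∧ ∃ V', om V' < d ∧ Has E f V' x (s * δ) p0 (2 * M) k (Arc n r C a s0 C') := by
  obtain ⟨s, hs1, hs2, V', hV, hom, T', hT', hcomb⟩ := hc
  have hs : 0 < s := hs0.trans_le hs1
  have hD := card_pos' n r
  have hCw := one_le_Cw n r
  set D : ℝ := (Fintype.card (Ix n r) : ℝ) with hDdef
  set L : ℝ := (C + 1) / s0 ^ (r + 1) with hL
  have hspow : s0 ^ (r + 1) ≤ 1 := pow_le_one₀ hs0.le hs01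
  have hL1 : 1 ≤ L := by
    rw [hL, le_div_iff₀ (by positivity)]; linarith
  have hw : ∀ (p : Jet n r) (c : Ix n r → Jet n r) (t : Ix n r → ℝ) η, N 1 (c η) ≤ C' * N 1 p →
      |t η| ≤ C' * N 1 p → N 1 (T (c η) + t η • Q) ≤ (C + 1) * (C' * N 1 p) := by
    intro p c t η h1 h2
    refine (N_add zero_le_one _ _).trans ?_
    rw [N_smul]
    have h3 := hT (c η)
    have h4 : C * N 1 (c η) ≤ C * (C' * N 1 p) := by gcongr
    have h5 : |t η| * N 1 Q ≤ (C' * N 1 p) * 1 :=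
      mul_le_mul h2 hQ (N_nonneg zero_le_one _) (le_trans (abs_nonneg _) h2)
    linarith
  have hA : D * L * C' ≤ Arc n r C a s0 C' := by
    unfold Arc
    rw [le_div_iff₀ ha]
    have h1 : D * L * C' * a ≤ D * L * C' * 1 := by gcongr
    have h2 : D * L * C' * 1 ≤ D * L * C' * (2 * Cw n r) := by gcongr; linarith
    calc _ ≤ _ := h1.trans h2
      _ = _ := by ring
  refine ⟨s, hs1, hs2, V', hom, hV, T', hT', fun p => ?_, fun p hp => ?_⟩
  · obtain ⟨c, t, h1, h2⟩ := hcomb p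
    refine le_trans ?_ (mul_le_mul_of_nonneg_right hA (N_nonneg zero_le_one p))
    rw [h1, Comb]
    refine (N_sum zero_le_one _ _).trans ?_
    refine (Finset.sum_le_card_nsmul _ _ (L * C' * N 1 p) fun η _ => ?_).trans (le_of_eq ?_)
    · refine (N_jm zero_le_one _ _).trans ?_
      rw [N_bs, one_pow, one_mul, N_Sc (by positivity)]
      have h3 := hw p c t η (h2 η).1 (h2 η).2
      have h4 : N (1 / s⁻¹) (T (c η) + t η • Q) ≤ N 1 (T (c η) + t η • Q) :=
        N_mono (by positivity) (by simpa using hs2) _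
      have h5 : s⁻¹ ^ (r + 1) ≤ (s0 ^ (r + 1))⁻¹ := by
        rw [inv_pow]; gcongr
      calc s⁻¹ ^ (r + 1) * N (1 / s⁻¹) (T (c η) + t η • Q)
          ≤ (s0 ^ (r + 1))⁻¹ * ((C + 1) * (C' * N 1 p)) := by
            refine mul_le_mul h5 (h4.trans h3) (N_nonneg (by positivity) _) (by positivity)
        _ = _ := by rw [hL]; ring
    · rw [Finset.card_univ, nsmul_eq_mul]; ring
  · obtain ⟨c, t, h1, h2⟩ := hcomb p
    have hη : ∀ η, p0 + ((Cw n r * L)⁻¹ * (a * M / C')) •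
        Sc (s * δ) (jm (bs η) (Sc s⁻¹ (T (c η) + t η • Q))) ∈ GamK E f k x (2 * M) := by
      intro η
      have hcb : N 1 (c η) ≤ C' := (h2 η).1.trans (by nlinarith)
      have htb : |t η| ≤ C' := (h2 η).2.trans (by nlinarith)
      have hC0 : 0 < C' := by linarith
      have g : ∀ ε : ℝ, |ε| = 1 → p0 + ε • ((a * M / C') • Sc δ (T (c η) + t η • Q)) ∈ GamK E f k x M := by
        intro ε hε
        have := hG ((ε * C'⁻¹) • c η) ((ε * C'⁻¹) * t η) (by
          rw [N_smul, abs_mul, hε, abs_of_pos (inv_pos.2 hC0), one_mul, inv_mul_le_iff₀ hC0]; linarith)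
          (by rw [abs_mul, abs_mul, hε, abs_of_pos (inv_pos.2 hC0), one_mul, inv_mul_le_iff₀ hC0]; linarith)
        convert this using 2
        simp only [map_add, map_smul, smul_add, smul_smul]
        congr 2 <;> ring
      have g1 := g 1 (by simp)
      have g2 := g (-1) (by simp)
      rw [one_smul] at g1
      rw [neg_one_smul, ← sub_eq_add_neg] at g2
      have hWC := WC (q := Dl (s * δ)⁻¹ (bs η)) hM.le hL1 (δ := s * δ) (by positivity) g1 g2 (by
        rw [N_smul, abs_of_nonneg (by positivity)]
        have e1 : N (s * δ) (Sc δ (T (c η) + t η • Q)) ≤ δ ^ (r + 1) * ((C + 1) * C') := by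
          refine (N_mono (by positivity) (by nlinarith : s * δ ≤ δ) _).trans ?_
          rw [N_Sc_self hδ]
          gcongr
          refine (hw p c t η (h2 η).1 (h2 η).2).trans ?_
          gcongr; nlinarith
        calc a * M / C' * N (s * δ) (Sc δ (T (c η) + t η • Q))
            ≤ a * M / C' * (δ ^ (r + 1) * ((C + 1) * C')) := by gcongr
          _ = a * ((C + 1) * M * δ ^ (r + 1)) := by field_simp
          _ ≤ 1 * ((C + 1) * M * δ ^ (r + 1)) := by gcongr
          _ ≤ (s / s0) ^ (r + 1) * ((C + 1) * M * δ ^ (r + 1)) := by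
              gcongr
              exact one_le_pow₀ ((one_le_div hs0).2 hs1)
          _ = _ := by rw [hL, div_pow, mul_pow]; ring) (by
        rw [N_Dl (by positivity), inv_mul_cancel₀ (by positivity), N_bs, one_pow])
      convert hWC using 2
      rw [Sc_jm (by positivity), Sc_Sc, jm_smul_right, smul_smul]
      congr 4
      field_simp
    have h3 := avg (convex_GamK E f k x (2 * M)) p0 _ hη
    convert h3 using 2
    rw [← Finset.smul_sum, ← map_sum, smul_smul, h1, Comb]
    congr 1
    unfold Arc
    rw [← hL, ← hDdef]
    have : C' ≠ 0 := by linarith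
    have : L ≠ 0 := by linarith
    have : Cw n r ≠ 0 := by linarith
    have : D ≠ 0 := by linarith
    field_simp

/-! ### Rescaled map -/

def Ts (s : ℝ) (T : Jet n r →ₗ[ℝ] Jet n r) : Jet n r →ₗ[ℝ] Jet n r := Sc s⁻¹ ∘ₗ T ∘ₗ Sc s

lemma Ts_apply (s : ℝ) (T : Jet n r →ₗ[ℝ] Jet n r) (p : Jet n r) : Ts s T p = Sc s⁻¹ (T (Sc s p)) := rfl

lemma Ts_one (T : Jet n r →ₗ[ℝ] Jet n r) : Ts 1 T = T := by
  ext p; simp [Ts, Sc_one]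

lemma Sc_bs (s : ℝ) (β : Ix n r) : Sc s (bs β) = s ^ (r + 1 - dg β) • (bs β : Jet n r) := by
  ext γ
  rw [Sc_apply, Pi.smul_apply, smul_eq_mul]
  by_cases h : γ = β
  · subst h; rfl
  · rw [bs_apply_ne h]; ring

lemma Ts_entry {s : ℝ} (hs : 0 < s) (T : Jet n r →ₗ[ℝ] Jet n r) (α β : Ix n r) :
    |Ts s T (bs β) α| * s ^ (dg β) = s ^ (dg α) * |T (bs β) α| := by
  rw [Ts_apply, Sc_bs, map_smul, map_smul, Pi.smul_apply, smul_eq_mul, Sc_apply, abs_mul, abs_mul,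
    abs_of_pos (by positivity), abs_of_pos (by positivity)]
  have h1 : s ^ (r + 1) = s ^ (r + 1 - dg β) * s ^ dg β := by
    rw [← pow_add]; congr 1; have := β.2; simp only [dg] at *; omega
  have h2 : s ^ (r + 1) = s ^ (r + 1 - dg α) * s ^ dg α := by
    rw [← pow_add]; congr 1; have := α.2; simp only [dg] at *; omega
  calc s ^ (r + 1 - dg β) * (s⁻¹ ^ (r + 1 - dg α) * |T (bs β) α|) * s ^ dg β
      = (s ^ (r + 1 - dg β) * s ^ dg β) * (s⁻¹ ^ (r + 1 - dg α) * |T (bs β) α|) := by ring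
    _ = (s ^ (r + 1 - dg α) * s ^ dg α) * (s⁻¹ ^ (r + 1 - dg α) * |T (bs β) α|) := by rw [← h1, h2]
    _ = (s * s⁻¹) ^ (r + 1 - dg α) * (s ^ dg α * |T (bs β) α|) := by rw [mul_pow]; ring
    _ = _ := by rw [mul_inv_cancel₀ hs.ne', one_pow, one_mul]

lemma Ts_entry' {s : ℝ} (hs : 0 < s) (T : Jet n r →ₗ[ℝ] Jet n r) (α β : Ix n r) :
    |Ts s T (bs β) α| = s ^ (dg α) * (s ^ dg β)⁻¹ * |T (bs β) α| := by
  have := Ts_entry hs T α β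
  field_simp
  linarith

lemma Ts_bound {s C : ℝ} (hs : 0 < s) (hs1 : s ≤ 1) {T : Jet n r →ₗ[ℝ] Jet n r}
    (hT : ∀ p, N 1 (T p) ≤ C * N 1 p) (hlow : low (Ts s T) ≤ 1) (p : Jet n r) :
    N 1 (Ts s T p) ≤ (C + 1) * N 1 p := by
  refine lin_bound zero_le_one (fun β => ?_) p
  have h1 : N 1 (T (bs β)) ≤ C := by
    have := hT (bs β); rwa [N_bs, one_pow, mul_one] at this
  have h2 : ∑ α : Ix n r, (if dg α < dg β then |Ts s T (bs β) α| else 0) ≤ low (Ts s T) := by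
    unfold low
    exact Finset.single_le_sum (f := fun β => ∑ α : Ix n r, (if dg α < dg β then |Ts s T (bs β) α| else 0))
      (fun β _ => Finset.sum_nonneg fun α _ => by split_ifs <;> positivity) (Finset.mem_univ β)
  have h3 : N 1 (Ts s T (bs β)) ≤ N 1 (T (bs β)) +
      ∑ α : Ix n r, (if dg α < dg β then |Ts s T (bs β) α| else 0) := by
    rw [N1_eq, N1_eq, ← Finset.sum_add_distrib]
    refine Finset.sum_le_sum fun α _ => ?_
    split_ifs with h
    · linarith [abs_nonneg (T (bs β) α)]
    · rw [add_zero, Ts_entry' hs]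
      have h4 : s ^ dg α ≤ s ^ dg β := pow_le_pow_of_le_one hs.le hs1 (by omega)
      have h5 : s ^ dg α * (s ^ dg β)⁻¹ ≤ 1 := by
        rw [← div_eq_mul_inv]; exact (div_le_one (by positivity)).2 h4
      have := abs_nonneg (T (bs β) α)
      nlinarith
  linarith

lemma low_ivt {s C : ℝ} (hs : 0 < s) (hs1 : s ≤ 1) {T : Jet n r →ₗ[ℝ] Jet n r} (hC : 0 ≤ C)
    (hT : ∀ p, N 1 (T p) ≤ C * N 1 p) (hlow : 1 ≤ low (Ts s T)) :
    ∃ s', s ≤ s' ∧ s' ≤ 1 ∧ 1 ≤ low (Ts s' T) ∧ ∀ p, N 1 (Ts s' T p) ≤ (C + 1) * N 1 p := by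
  by_cases h1 : 1 ≤ low (Ts 1 T)
  · refine ⟨1, hs1, le_rfl, h1, fun p => ?_⟩
    rw [Ts_one]
    refine (hT p).trans ?_
    have := N_nonneg zero_le_one p
    nlinarith
  · have hcont : ContinuousOn (fun s => low (Ts s T)) (Set.Icc s 1) := by
      have : ContinuousOn (fun s : ℝ => ∑ β : Ix n r, ∑ α : Ix n r, if dg α < dg β then
          s ^ (dg α) * (s ^ dg β)⁻¹ * |T (bs β) α| else 0) (Set.Icc s 1) := by
        refine continuousOn_finsetSum _ fun β _ => continuousOn_finsetSum _ fun α _ => ?_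
        split_ifs
        · refine ContinuousOn.mul (ContinuousOn.mul (by fun_prop) ?_) continuousOn_const
          refine ContinuousOn.inv₀ (by fun_prop) ?_
          intro u hu
          have := hs.trans_le hu.1
          positivity
        · exact continuousOn_const
      refine this.congr ?_
      intro u hu
      have hu0 := hs.trans_le hu.1
      unfold low
      refine Finset.sum_congr rfl fun β _ => Finset.sum_congr rfl fun α _ => ?_
      split_ifs
      · rw [Ts_entry' hu0]
      · rfl
    obtain ⟨s', hs', h2⟩ := intermediate_value_Icc' hs1 hcont (show (1:ℝ) ∈ Set.Icc _ _ from ⟨(not_le.1 h1).le, hlow⟩)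
    exact ⟨s', hs'.1, hs'.2, h2.ge, Ts_bound (hs.trans_le hs'.1) hs'.2 hT h2.le⟩

lemma HasT.Ts_mem {E : Finset (Euc n)} {f : Euc n → ℝ} {V : Submodule ℝ (Jet n r)} {x : Euc n}
    {δ M C s : ℝ} {p0 : Jet n r} {k : ℕ} {T : Jet n r →ₗ[ℝ] Jet n r}
    (h : HasT E f V x δ p0 M k C T) (hs : 0 < s) (hs1 : s ≤ 1) {p : Jet n r}
    (hp : N 1 p ≤ 1) : p0 + (M / C) • Sc (s * δ) (Ts s T p) ∈ GamK E f k x M := by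
  have h1 := h.2.2 (Sc s p) (by
    rw [N_Sc hs]
    have h2 := N_scale_up (δ := 1) (t := 1 / s) zero_le_one ((one_le_div hs).2 hs1) p
    rw [mul_one] at h2
    calc s ^ (r + 1) * N (1 / s) p ≤ s ^ (r + 1) * ((1 / s) ^ r * N 1 p) := by gcongr
      _ = (s * (1 / s)) ^ r * (s * N 1 p) := by rw [mul_pow, pow_succ]; ring
      _ = s * N 1 p := by rw [mul_one_div_cancel hs.ne', one_pow, one_mul]
      _ ≤ 1 * 1 := mul_le_mul hs1 hp (N_nonneg zero_le_one _) zero_le_one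
      _ = 1 := by norm_num)
  convert h1 using 3
  rw [Ts_apply, Sc_Sc]
  congr 2
  field_simp

lemma Ts_V {V : Submodule ℝ (Jet n r)} (hV : DTI V) {T : Jet n r →ₗ[ℝ] Jet n r}
    (hT : ∀ p, p - T p ∈ V) {s : ℝ} (hs : 0 < s) (p : Jet n r) : p - Ts s T p ∈ V := by
  have h1 := hV.sc (inv_ne_zero hs.ne') (hT (Sc s p))
  rwa [map_sub, Sc_inv' hs.ne', ← Ts_apply] at h1

/-- R3 and R4 combined. -/
theorem R34 (n r : ℕ) (C : ℝ) (hC : 1 ≤ C) (d : ℕ) : ∃ s0 A : ℝ, 0 < s0 ∧ s0 ≤ 1 ∧ 1 ≤ A ∧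
    ∀ (E : Finset (Euc n)) (f : Euc n → ℝ) (V : Submodule ℝ (Jet n r)) (y : Euc n) (δ0 δ M : ℝ)
      (p : Jet n r) (k : ℕ) (T : Jet n r →ₗ[ℝ] Jet n r), DTI V → om V ≤ d → 0 < δ → δ ≤ δ0 → 0 < M →
      HasT E f V y δ0 p M k C T →
      (1 ≤ low (Ts (δ / δ0) T) → ∃ δ1, s0 * δ ≤ δ1 ∧ δ1 ≤ δ0 ∧ ∃ V', om V' < d ∧
        Has E f V' y δ1 p (2 * M) k A) ∧
      (low (Ts (δ / δ0) T) ≤ 1 → ∀ Q ∈ V, N 1 Q = 1 → p + (M / C) • Sc δ Q ∈ GamK E f k y M →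
        p - (M / C) • Sc δ Q ∈ GamK E f k y M → ∃ δ1, s0 * δ ≤ δ1 ∧ δ1 ≤ δ ∧ ∃ V', om V' < d ∧
        Has E f V' y δ1 p (2 * M) k A) := by
  obtain ⟨s0, C1, h1, h2, h3, hRL⟩ := RL n r (C + 1) (by linarith) d
  set C' := max C1 1 with hC'
  have ha : (0:ℝ) < 1 / (2 * C) := by positivity
  have ha1 : 1 / (2 * C) ≤ 1 := by rw [div_le_one (by positivity)]; linarith
  refine ⟨s0, Arc n r (C + 1) (1 / (2 * C)) s0 C', h1, h2, ?_, ?_⟩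
  · unfold Arc
    rw [le_div_iff₀ ha, one_mul]
    refine ha1.trans ?_
    have e1 : (1:ℝ) ≤ C' := le_max_right _ _
    have e2 := one_le_Cw n r
    have e3 := card_pos' n r
    have e4 : 1 ≤ (C + 1 + 1) / s0 ^ (r + 1) := by
      rw [le_div_iff₀ (by positivity), one_mul]
      have : s0 ^ (r + 1) ≤ 1 := pow_le_one₀ h1.le h2
      linarith
    have e5 : (1:ℝ) ≤ 2 * C' := by linarith
    exact one_le_mul_of_one_le_of_one_le (one_le_mul_of_one_le_of_one_le
      (one_le_mul_of_one_le_of_one_le e5 e2) e4) e3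
  · intro E f V y δ0 δ M p k T hV hd hδ hδ0 hM hT
    have hδ0' : 0 < δ0 := hδ.trans_le hδ0
    have hs : 0 < δ / δ0 := by positivity
    have hs1 : δ / δ0 ≤ 1 := (div_le_one hδ0').2 hδ0
    -- centre
    have hp0 := hT.center
    have half : ∀ s, 0 < s → s ≤ 1 → ∀ c, N 1 c ≤ 1 → ∀ q, p + (M / C) • q ∈ GamK E f k y M →
        p + (1 / (2 * C) * M) • (Sc (s * δ0) (Ts s T c) + q) ∈ GamK E f k y M := by
      intro s e1 e2 c e3 q hq
      have e4 := hT.Ts_mem e1 e2 e3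
      have e5 := convex_GamK E f k y M e4 hq (by norm_num : (0:ℝ) ≤ 1 / 2) (by norm_num : (0:ℝ) ≤ 1 / 2)
        (by norm_num)
      convert e5 using 1
      have : C ≠ 0 := by linarith
      have e6 : 1 / (2 * C) * M = 1 / 2 * (M / C) := by field_simp
      have e7 : p = (1/2 : ℝ) • p + (1/2 : ℝ) • p := by rw [← add_smul]; norm_num
      rw [e6, smul_add, smul_add, smul_add, mul_smul, mul_smul]
      nth_rewrite 1 [e7]
      abel
    constructor
    · intro hlow
      obtain ⟨s', g1, g2, g3, g4⟩ := low_ivt hs hs1 (by linarith) hT.2.1 hlow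
      have hs' : 0 < s' := hs.trans_le g1
      have hc := (hRL V (Ts s' T) 0 hd (Ts_V hV hT.1 hs') g4 (Submodule.zero_mem _) (by rw [N_zero]; norm_num)
        (Or.inr g3)).mono le_rfl (le_max_left C1 1)
      obtain ⟨s, k1, k2, V', k3, k4⟩ := RC (E := E) (f := f) (x := y) (p0 := p) (k := k)
        (δ := s' * δ0) (M := M) (by positivity) hM
        (by linarith : (1:ℝ) ≤ C + 1) ha ha1 h1 h2 (le_max_right C1 1) g4 (by rw [N_zero]; norm_num) (by
          intro c t hc1 _
          have := half s' hs' g2 c hc1 0 (by simpa using hp0)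
          simpa using this) hc
      refine ⟨s * (s' * δ0), ?_, ?_, V', k3, k4⟩
      · have : δ ≤ s' * δ0 := (div_le_iff₀ hδ0').1 g1
        have hs0 := h1.trans_le k1
        gcongr
      · have hs0 := h1.trans_le k1
        have : s' * δ0 ≤ 1 * δ0 := by gcongr
        have : s * (s' * δ0) ≤ 1 * (s' * δ0) := by gcongr
        linarith
    · intro hlow Q hQ hQ1 hQp hQm
      have g4 := Ts_bound hs hs1 hT.2.1 hlow
      have hc := (hRL V (Ts (δ / δ0) T) Q hd (Ts_V hV hT.1 hs) g4 hQ hQ1.le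
        (Or.inl hQ1)).mono le_rfl (le_max_left C1 1)
      have hδe : δ / δ0 * δ0 = δ := by field_simp
      obtain ⟨s, k1, k2, V', k3, k4⟩ := RC (E := E) (f := f) (x := y) (p0 := p) (k := k)
        (δ := δ) (M := M) hδ hM
        (by linarith : (1:ℝ) ≤ C + 1) ha ha1 h1 h2 (le_max_right C1 1) g4 hQ1.le (by
          intro c t hc1 ht
          have := half (δ / δ0) hs hs1 c hc1 (t • Sc δ Q) (by
            have ht' := abs_le.1 ht
            have e5 := convex_GamK E f k y M hQp hQm (by linarith : (0:ℝ) ≤ (1 + t) / 2)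
              (by linarith : (0:ℝ) ≤ (1 - t) / 2) (by ring)
            convert e5 using 1
            module)
          rw [hδe, ← map_smul, ← map_add] at this
          exact this) hc
      have hs0 := h1.trans_le k1
      refine ⟨s * δ, by gcongr, ?_, V', k3, k4⟩
      have : s * δ ≤ 1 * δ := by gcongr
      linarith

theorem DS (n r : ℕ) (d : ℕ) : ∀ (A : ℝ), 1 ≤ A → ∃ s5 B A5 : ℝ, 0 < s5 ∧ s5 ≤ 1 ∧ 1 ≤ B ∧ 1 ≤ A5 ∧
    ∀ (E : Finset (Euc n)) (f : Euc n → ℝ) (V : Submodule ℝ (Jet n r)) (x : Euc n) (δ δ1 M : ℝ)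
      (p : Jet n r) (k : ℕ), om V ≤ d → 0 < δ1 → δ1 ≤ δ → 0 < M → Has E f V x δ p M k A →
      ∃ δ2, s5 * δ1 ≤ δ2 ∧ δ2 ≤ δ1 ∧ ∃ V', om V' ≤ d ∧ Has E f V' x δ2 p (B * M) k A5 := by
  induction d using Nat.strong_induction_on with
  | _ d ih =>
  intro A hA
  obtain ⟨s0, A3, a1, a2, a3, hR⟩ := R34 n r A hA d
  have main : ∃ s5 B A5 : ℝ, 0 < s5 ∧ s5 ≤ 1 ∧ 1 ≤ B ∧ 1 ≤ A5 ∧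
      ∀ (E : Finset (Euc n)) (f : Euc n → ℝ) (V : Submodule ℝ (Jet n r)) (x : Euc n) (δ δ1 M : ℝ)
      (p : Jet n r) (k : ℕ), om V < d → 0 < δ1 → δ1 ≤ δ → 0 < M → Has E f V x δ p M k A3 →
      ∃ δ2, s5 * δ1 ≤ δ2 ∧ δ2 ≤ δ1 ∧ ∃ V', om V' ≤ d ∧ Has E f V' x δ2 p (B * M) k A5 := by
    rcases Nat.eq_zero_or_pos d with h0 | h0
    · exact ⟨1, 1, 1, one_pos, le_rfl, le_rfl, le_rfl, fun E f V x δ δ1 M p k h => by omega⟩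
    · obtain ⟨s5, B, A5, b1, b2, b3, b4, hI⟩ := ih (d - 1) (by omega) A3 a3
      refine ⟨s5, B, A5, b1, b2, b3, b4, fun E f V x δ δ1 M p k h e1 e2 e3 e4 => ?_⟩
      obtain ⟨δ2, c1, c2, V', c3, c4⟩ := hI E f V x δ δ1 M p k (by omega) e1 e2 e3 e4
      exact ⟨δ2, c1, c2, V', by omega, c4⟩
  obtain ⟨s5, B, A5, b1, b2, b3, b4, hI⟩ := main
  set A6 := max (A5 * (2 * B)) (max (A3 * (2 * B)) ((A + 1) * (2 * B))) with hA6
  have hA6a : A5 * (2 * B) ≤ A6 := le_max_left _ _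
  have hA6b : A3 * (2 * B) ≤ A6 := (le_max_left _ _).trans (le_max_right _ _)
  have hA6c : (A + 1) * (2 * B) ≤ A6 := (le_max_right _ _).trans (le_max_right _ _)
  have hA6p : 1 ≤ A6 := le_trans (by nlinarith) hA6a
  refine ⟨min s0 s5, 2 * B, A6, lt_min a1 b1, (min_le_left _ _).trans a2, by linarith, by nlinarith, ?_⟩
  intro E f V x δ δ1 M p k hd hδ1 hδ hM ⟨hV, T, hT⟩
  have hδp := hδ1.trans_le hδ
  have hm1 : min s0 s5 ≤ s0 := min_le_left _ _
  have hm2 : min s0 s5 ≤ s5 := min_le_right _ _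
  by_cases hlow : 1 ≤ low (Ts (δ1 / δ) T)
  · obtain ⟨δ', c1, c2, V', c3, c4⟩ := (hR E f V x δ δ1 M p k T hV hd hδ1 hδ hM hT).1 hlow
    by_cases hδ' : δ' ≤ δ1
    · refine ⟨δ', le_trans (by gcongr) c1, hδ', V', c3.le, c4.mono (by positivity) (by linarith) ?_ ?_ le_rfl ?_⟩
      · nlinarith
      · nlinarith
      · have e : M * (A3 * (2 * B)) ≤ M * A6 := by gcongr
        have : 0 < M * A6 := by positivity
        linarith
    · obtain ⟨δ2, g1, g2, V'', g3, g4⟩ := hI E f V' x δ' δ1 (2 * M) p k c3 hδ1 (not_le.1 hδ').le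
        (by positivity) c4
      refine ⟨δ2, le_trans (by gcongr) g1, g2, V'', g3, g4.mono (by positivity) (by linarith) ?_ ?_ le_rfl ?_⟩
      · nlinarith
      · nlinarith
      · have e : M * (A5 * (2 * B)) ≤ M * A6 := by gcongr
        have : M * A6 * 1 ≤ M * A6 * B := by gcongr
        have : 0 < M * A6 := by positivity
        linarith
  · have hlow' := (not_le.1 hlow).le
    have hs : 0 < δ1 / δ := by positivity
    have hs1 : δ1 / δ ≤ 1 := (div_le_one hδp).2 hδ
    have hT2 : HasT E f V x δ1 p M k (A + 1) (Ts (δ1 / δ) T) := by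
      refine ⟨Ts_V hV hT.1 hs, Ts_bound hs hs1 hT.2.1 hlow', fun q hq => ?_⟩
      have e := hT.Ts_mem hs hs1 (p := (A / (A + 1)) • q) (by
        rw [N_smul, abs_of_nonneg (by positivity)]
        have : A / (A + 1) ≤ 1 := (div_le_one (by positivity)).2 (by linarith)
        exact mul_le_one₀ this (N_nonneg zero_le_one _) hq)
      have hδe : δ1 / δ * δ = δ1 := by field_simp
      rw [hδe, map_smul, map_smul, smul_smul] at e
      convert e using 3
      field_simp
    refine ⟨δ1, ?_, le_rfl, V, hd, hV, _, hT2.mono hM (by linarith) ?_ ?_ le_rfl ?_⟩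
    · have : min s0 s5 ≤ 1 := hm1.trans a2
      nlinarith
    · nlinarith
    · nlinarith
    · have e : M * ((A + 1) * (2 * B)) ≤ M * A6 := by gcongr
      linarith

end NNI
end SecP5d


open scoped BigOperators

noncomputable section SecP6

namespace NNI

variable {n r : ℕ}

lemma pack (n : ℕ) {ε : ℝ} (hε : 0 < ε) : ∃ P : ℕ, ∀ S : Finset (Euc n), (∀ x ∈ S, ‖x‖ ≤ 1) →
    (∀ x ∈ S, ∀ y ∈ S, x ≠ y → ε < ‖x - y‖) → S.card ≤ P := by
  classical
  have h := (isCompact_closedBall (0 : Euc n) 1).totallyBounded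
  rw [Metric.totallyBounded_iff] at h
  obtain ⟨t, ht, hcov⟩ := h (ε / 2) (by positivity)
  refine ⟨ht.toFinset.card, fun S hS hsep => ?_⟩
  have h1 : ∀ x ∈ S, ∃ y ∈ t, dist x y < ε / 2 := by
    intro x hx
    have := hcov (show x ∈ Metric.closedBall (0 : Euc n) 1 by
      rw [mem_closedBall_zero_iff]; exact hS x hx)
    simpa using this
  choose! g hg1 hg2 using h1
  refine Finset.card_le_card_of_injOn g (fun x hx => by simpa using hg1 x hx) ?_
  intro x hx y hy hxy
  by_contra hne
  have a := hsep x hx y hy hne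
  have b := hg2 x hx
  have c := hg2 y hy
  rw [hxy] at b
  rw [← dist_eq_norm] at a
  have := dist_triangle_right x y (g y)
  linarith

lemma pack_ball {P : ℕ} {ε : ℝ} (hP : ∀ S : Finset (Euc n), (∀ x ∈ S, ‖x‖ ≤ 1) →
    (∀ x ∈ S, ∀ y ∈ S, x ≠ y → ε < ‖x - y‖) → S.card ≤ P) {c : Euc n} {R : ℝ} (hR : 0 < R)
    (S : Finset (Euc n)) (hS : ∀ x ∈ S, ‖x - c‖ ≤ R)
    (hsep : ∀ x ∈ S, ∀ y ∈ S, x ≠ y → ε * R < ‖x - y‖) : S.card ≤ P := by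
  classical
  let φ : Euc n → Euc n := fun x => R⁻¹ • (x - c)
  have hφ : ∀ x y, ‖φ x - φ y‖ = R⁻¹ * ‖x - y‖ := by
    intro x y
    have : φ x - φ y = R⁻¹ • (x - y) := by simp only [φ]; rw [← smul_sub]; congr 1; abel
    rw [this, norm_smul, Real.norm_of_nonneg (by positivity)]
  have hinj : Function.Injective φ := by
    intro x y h
    have := hφ x y
    rw [h, sub_self, norm_zero] at this
    have h2 : ‖x - y‖ = 0 := by
      rcases mul_eq_zero.1 this.symm with h | h
      · exact absurd h (inv_ne_zero hR.ne')
      · exact h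
    exact sub_eq_zero.1 (norm_eq_zero.1 h2)
  rw [← Finset.card_image_of_injective S hinj]
  refine hP _ ?_ ?_
  · intro x' hx'
    obtain ⟨x, hx, rfl⟩ := Finset.mem_image.1 hx'
    simp only [φ]
    rw [norm_smul, Real.norm_of_nonneg (by positivity), inv_mul_le_iff₀ hR, mul_one]
    exact hS x hx
  · intro x' hx' y' hy' hne
    obtain ⟨x, hx, rfl⟩ := Finset.mem_image.1 hx'
    obtain ⟨y, hy, rfl⟩ := Finset.mem_image.1 hy'
    rw [hφ, lt_inv_mul_iff₀ hR, mul_comm]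
    exact hsep x hx y hy (fun h => hne (by rw [h]))

lemma exists_sep (x0 : Euc n) (R : ℝ) (ρ : Euc n → ℝ) {ρm : ℝ} (hρm : 0 < ρm)
    (hρ : ∀ x ∈ Metric.closedBall x0 R, ρm ≤ ρ x) :
    ∃ S : Finset (Euc n), (∀ x ∈ S, x ∈ Metric.closedBall x0 R) ∧
      (∀ x ∈ S, ∀ y ∈ S, x ≠ y → min (ρ x) (ρ y) < ‖x - y‖) ∧
      ∀ x ∈ Metric.closedBall x0 R, ∃ y ∈ S, ‖x - y‖ ≤ min (ρ x) (ρ y) := by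
  classical
  let Sep : Finset (Euc n) → Prop := fun S => (∀ x ∈ S, x ∈ Metric.closedBall x0 R) ∧
      (∀ x ∈ S, ∀ y ∈ S, x ≠ y → min (ρ x) (ρ y) < ‖x - y‖)
  have hR : 0 < |R| + 1 := by positivity
  obtain ⟨P, hP⟩ := pack n (ε := ρm / 2 / (|R| + 1)) (by positivity)
  have hb : ∀ S, Sep S → S.card ≤ P := by
    intro S hS
    refine pack_ball hP hR (c := x0) S ?_ ?_
    · intro x hx
      have := hS.1 x hx
      rw [mem_closedBall_iff_norm] at this
      linarith [le_abs_self R]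
    · intro x hx y hy hne
      rw [div_mul_cancel₀ _ hR.ne']
      refine lt_of_lt_of_le ?_ (hS.2 x hx y hy hne).le
      refine lt_of_lt_of_le (by linarith : ρm / 2 < ρm) (le_min (hρ x (hS.1 x hx)) (hρ y (hS.1 y hy)))
  let A : Set ℕ := {k | ∃ S, Sep S ∧ S.card = k}
  have hA : BddAbove A := ⟨P, by rintro k ⟨S, hS, rfl⟩; exact hb S hS⟩
  have hne : A.Nonempty := ⟨0, ∅, ⟨by simp, by simp⟩, rfl⟩
  obtain ⟨S, hS, hcard⟩ := Nat.sSup_mem hne hA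
  refine ⟨S, hS.1, hS.2, fun x hx => ?_⟩
  by_contra hcon
  push Not at hcon
  have hx0 : x ∉ S := by
    intro h
    have := hcon x h
    simp only [sub_self, norm_zero, min_self] at this
    linarith [hρ x hx]
  have hS' : Sep (insert x S) := by
    refine ⟨?_, ?_⟩
    · intro y hy
      rcases Finset.mem_insert.1 hy with hy' | hy'
      · rw [hy']; exact hx
      · exact hS.1 y hy'
    · intro y hy z hz hyz
      rcases Finset.mem_insert.1 hy with hy' | hy'
      · rcases Finset.mem_insert.1 hz with hz' | hz'
        · exact absurd (hy'.trans hz'.symm) hyz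
        · rw [hy']; exact hcon z hz'
      · rcases Finset.mem_insert.1 hz with hz' | hz'
        · rw [hz', min_comm, norm_sub_rev]; exact hcon y hy'
        · exact hS.2 y hy' z hz' hyz
  have := le_csSup hA ⟨_, hS', rfl⟩
  rw [Finset.card_insert_of_notMem hx0, ← hcard] at this
  omega

/-- one gluing step -/
def gs (ρ : Euc n → ℝ) (F : Euc n → Euc n → Jet n r) (G : Euc n → Jet n r) (c : Euc n) :
    Euc n → Jet n r := fun z => G z + jm (bmp r c (ρ c / 16) z) (F c z - G z)

lemma gs_ev (ρ : Euc n → ℝ) (F : Euc n → Euc n → Jet n r) (G : Euc n → Jet n r) (c z : Euc n) :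
    ev (gs ρ F G c z) = (1 - ev (bmp r c (ρ c / 16) z)) * ev (G z) +
      ev (bmp r c (ρ c / 16) z) * ev (F c z) := by
  simp only [gs, map_add, ev_jm, map_sub]; ring

lemma gs_far {ρ : Euc n → ℝ} (F : Euc n → Euc n → Jet n r) (G : Euc n → Jet n r) {c z : Euc n}
    (hρ : 0 < ρ c) (h : ρ c / 8 ≤ ‖z - c‖) : gs ρ F G c z = G z := by
  rw [gs, bmp_zero c (by positivity) (by linarith), jm_zero_left, add_zero]

lemma gs_near {ρ : Euc n → ℝ} (F : Euc n → Euc n → Jet n r) (G : Euc n → Jet n r) {c z : Euc n}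
    (hρ : 0 < ρ c) (h : ‖z - c‖ ≤ ρ c / 16) : gs ρ F G c z = F c z := by
  rw [gs, bmp_one c (by positivity) h, jm_one_left]; abel

lemma fold_nonneg {ρ : Euc n → ℝ} {F : Euc n → Euc n → Jet n r} (z : Euc n) (L : List (Euc n))
    (hρ : ∀ c ∈ L, 0 < ρ c) (hF : ∀ c ∈ L, ‖z - c‖ ≤ ρ c → 0 ≤ ev (F c z)) :
    ∀ G : Euc n → Jet n r, 0 ≤ ev (G z) → 0 ≤ ev (L.foldl (gs ρ F) G z) := by
  induction L with
  | nil => intro G hG; exact hG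
  | cons c L ih =>
    intro G hG
    rw [List.foldl_cons]
    refine ih (fun c hc => hρ c (List.mem_cons_of_mem _ hc)) (fun c hc => hF c (List.mem_cons_of_mem _ hc)) _ ?_
    have hc := hρ c List.mem_cons_self
    by_cases h : ‖z - c‖ ≤ ρ c
    · have h1 := hF c List.mem_cons_self h
      have h2 := bmp_nonneg (r := r) c (ρ c / 16) z
      have h3 := bmp_le_one (r := r) c (ρ c / 16) z
      rw [gs_ev]
      have : 0 ≤ 1 - ev (bmp r c (ρ c / 16) z) := by linarith
      positivity
    · rw [gs_far F G hc (by linarith)]; exact hG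

lemma fold_eq {ρ : Euc n → ℝ} {F : Euc n → Euc n → Jet n r} (z : Euc n) (a : ℝ) (L : List (Euc n))
    (hρ : ∀ c ∈ L, 0 < ρ c) (hF : ∀ c ∈ L, ‖z - c‖ ≤ ρ c → ev (F c z) = a) :
    ∀ G : Euc n → Jet n r, ev (G z) = a → ev (L.foldl (gs ρ F) G z) = a := by
  induction L with
  | nil => intro G hG; exact hG
  | cons c L ih =>
    intro G hG
    rw [List.foldl_cons]
    refine ih (fun c hc => hρ c (List.mem_cons_of_mem _ hc)) (fun c hc => hF c (List.mem_cons_of_mem _ hc)) _ ?_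
    have hc := hρ c List.mem_cons_self
    by_cases h : ‖z - c‖ ≤ ρ c
    · have h1 := hF c List.mem_cons_self h
      rw [gs_ev, h1, hG]; ring
    · rw [gs_far F G hc (by linarith)]; exact hG

def Kg (n r : ℕ) : ℝ := 1 + 2 * (pc r * Cb n r)

lemma one_le_Kg (n r : ℕ) : 1 ≤ Kg n r := by
  have := pc_pos r; have := one_le_Cb n r
  unfold Kg; nlinarith

lemma fold_Bd {ρ : Euc n → ℝ} {F : Euc n → Euc n → Jet n r} {U : Set (Euc n)} {u A0 : ℝ}
    {P : Euc n → Jet n r} (hu : 0 < u) (hA0 : 0 ≤ A0) (rel : Euc n → Prop) [DecidablePred rel] (L : List (Euc n))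
    (hρ : ∀ c ∈ L, 0 < ρ c)
    (hrel : ∀ c ∈ L, ¬ rel c → ∀ z ∈ U, ρ c / 8 ≤ ‖z - c‖)
    (hF : ∀ c ∈ L, rel c → Bd U u A0 (fun z => F c z - P z) ∧ u ≤ ρ c / 16) :
    ∀ (G : Euc n → Jet n r) (A : ℝ), A0 ≤ A → Bd U u A (fun z => G z - P z) →
      Bd U u (A * Kg n r ^ (L.countP rel)) (fun z => L.foldl (gs ρ F) G z - P z) := by
  induction L with
  | nil => intro G A _ hG; simpa using hG
  | cons c L ih =>
    intro G A hA hG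
    have ih' := ih (fun c hc => hρ c (List.mem_cons_of_mem _ hc))
      (fun c hc => hrel c (List.mem_cons_of_mem _ hc)) (fun c hc => hF c (List.mem_cons_of_mem _ hc))
    simp only [List.foldl_cons]
    have hc := hρ c List.mem_cons_self
    by_cases h : rel c
    · obtain ⟨h1, h2⟩ := hF c List.mem_cons_self h
      have h3 := ih' (gs ρ F G c) (A * Kg n r) (by have := one_le_Kg n r; nlinarith) ?_
      · rw [List.countP_cons_of_pos (by simpa using h), pow_succ, mul_comm (Kg n r ^ _), ← mul_assoc]
        exact h3
      · have h4 : Bd U u (Cb n r) (bmp r c (ρ c / 16)) :=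
          (Bd_bmp (r := r) c (by positivity)).mono (Set.subset_univ _) hu h2 le_rfl
            (zero_le_one.trans (one_le_Cb n r))
        have h5 := hG.add hu.le (h4.jm hu (h1.sub hu.le hG))
        have hpc := pc_pos r
        have hcb := one_le_Cb n r
        refine (h5.mono (A' := A * Kg n r) subset_rfl hu le_rfl ?_ ?_).congr ?_
        · unfold Kg
          have : pc r * (Cb n r * (A0 + A)) ≤ pc r * (Cb n r * (A + A)) := by gcongr
          linarith
        · have := one_le_Kg n r
          have := hA0.trans hA
          positivity
        · intro z _
          simp only [gs]
          rw [sub_sub_sub_cancel_right]; abel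
    · have h3 := ih' (gs ρ F G c) A hA (hG.congr fun z hz => by
        rw [gs_far F G hc (hrel c List.mem_cons_self h z hz)])
      rw [List.countP_cons_of_neg (by simpa using h)]
      exact h3

theorem GLUE (n r : ℕ) : ∃ K : ℝ, 1 ≤ K ∧ ∀ (E : Finset (Euc n)) (f : Euc n → ℝ) (x0 : Euc n) (R : ℝ)
    (ρ : Euc n → ℝ) (ρm M : ℝ) (F : Euc n → Euc n → Jet n r), 0 < ρm → 0 ≤ M →
    (∀ x ∈ Metric.closedBall x0 R, ρm ≤ ρ x) →
    (∀ x ∈ Metric.closedBall x0 R, ∀ y ∈ Metric.closedBall x0 R, ρ x ≤ ρ y + ‖x - y‖) →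
    (∀ x ∈ Metric.closedBall x0 R, Wh (Metric.closedBall x (ρ x)) M (F x)) →
    (∀ x ∈ Metric.closedBall x0 R, ∀ z, ‖z - x‖ ≤ ρ x → 0 ≤ ev (F x z)) →
    (∀ x ∈ Metric.closedBall x0 R, ∀ z ∈ E, ‖z - x‖ ≤ ρ x → ev (F x z) = f z) →
    (∀ x ∈ Metric.closedBall x0 R, ∀ y ∈ Metric.closedBall x0 R, ‖x - y‖ ≤ ρ x / 4 →
      N (ρ x) (F x x - tr (x - y) (F y y)) ≤ M * ρ x ^ (r + 1)) →
    ∃ G : Euc n → Jet n r, Wh (Metric.closedBall x0 R) (K * M) G ∧ (∀ z, 0 ≤ ev (G z)) ∧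
      (∀ z ∈ E, z ∈ Metric.closedBall x0 R → ev (G z) = f z) ∧
      ∀ x ∈ Metric.closedBall x0 R, N (ρ x) (G x - F x x) ≤ K * M * ρ x ^ (r + 1) := by
  classical
  obtain ⟨P, hP⟩ := pack n (ε := 1 / 128) (by norm_num)
  have hKg := one_le_Kg n r
  set K1 : ℝ := 2 * Kg n r ^ P * 32 ^ (r + 1) with hK1
  have hKP : 1 ≤ Kg n r ^ P := one_le_pow₀ hKg
  have h32 : (1:ℝ) ≤ 32 ^ (r + 1) := one_le_pow₀ (by norm_num)
  have hK11 : 1 ≤ K1 := by rw [hK1]; nlinarith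
  have h2r : (1:ℝ) ≤ 2 ^ r := one_le_pow₀ (by norm_num)
  refine ⟨2 ^ r * K1, by nlinarith, ?_⟩
  intro E f x0 R ρ ρm M F hρm hM hρ hlip hW hpos hval hcons
  set B := Metric.closedBall x0 R with hB
  obtain ⟨S, hS1, hS2, hS3⟩ := exists_sep x0 R (fun x => ρ x / 64) (ρm := ρm / 64) (by positivity)
    (fun x hx => by have := hρ x hx; linarith)
  have hρ0 : ∀ x ∈ B, 0 < ρ x := fun x hx => hρm.trans_le (hρ x hx)
  set L := S.toList with hL
  have hLB : ∀ c ∈ L, c ∈ B := fun c hc => hS1 c (by simpa [hL] using hc)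
  set G := L.foldl (gs ρ F) (fun _ => 0) with hG
  -- local analysis
  have key : ∀ x ∈ B, Bd (Metric.closedBall x (ρ x / 32)) (ρ x / 32)
      (2 * M * ρ x ^ (r + 1) * Kg n r ^ P) (fun z => G z - cf x (F x x) z) ∧
      (x ∈ E → ev (G x) = f x) := by
    intro x hx
    have hx0 := hρ0 x hx
    set ρx := ρ x with hρx
    obtain ⟨c, hcS, hc⟩ := hS3 x hx
    have hcB := hS1 c hcS
    have hc1 : ‖x - c‖ ≤ ρx / 64 := hc.trans (min_le_left _ _)
    have hc2 : ‖x - c‖ ≤ ρ c / 64 := hc.trans (min_le_right _ _)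
    have hcl := hlip x hx c hcB
    have hcL : c ∈ L := by simpa [hL] using hcS
    obtain ⟨l1, l2, hl⟩ := List.append_of_mem hcL
    let rel : Euc n → Prop := fun c => ‖x - c‖ ≤ ρx / 4 ∧ ρx / 2 ≤ ρ c
    have hGe : G = l2.foldl (gs ρ F) (gs ρ F (l1.foldl (gs ρ F) fun _ => 0) c) := by
      rw [hG, hl, List.foldl_append, List.foldl_cons]
    set G1 := gs ρ F (l1.foldl (gs ρ F) fun _ => 0) c with hG1
    have hl2 : ∀ c' ∈ l2, c' ∈ L := fun c' hc' => by rw [hl]; simp [hc']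
    have hG1c : ∀ z ∈ Metric.closedBall x (ρx / 32), G1 z = F c z := by
      intro z hz
      rw [mem_closedBall_iff_norm] at hz
      refine gs_near F _ (hρ0 c hcB) ?_
      have := norm_sub_le_norm_sub_add_norm_sub z x c
      linarith
    have hrelc : ∀ c' ∈ B, rel c' → Bd (Metric.closedBall x (ρx / 32)) (ρx / 32)
        (2 * M * ρx ^ (r + 1)) (fun z => F c' z - cf x (F x x) z) ∧ ρx / 32 ≤ ρ c' / 16 := by
      rintro c' hc' ⟨e1, e2⟩
      refine ⟨?_, by linarith⟩
      have hsub : Metric.closedBall x (ρx / 32) ⊆ Metric.closedBall c' (ρ c') := by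
        intro z hz
        rw [mem_closedBall_iff_norm] at *
        have := norm_sub_le_norm_sub_add_norm_sub z x c'
        linarith
      have hWd := ((hW c' hc').mono hsub le_rfl).sub (Wh_cf (Metric.closedBall x (ρx / 32)) x (F x x))
      refine Bd_of_Wh (by positivity) hWd ?_ ?_
      · have : (ρx / 32) ^ (r + 1) ≤ ρx ^ (r + 1) := by gcongr; linarith
        have h3 : M * (ρx / 32) ^ (r + 1) ≤ M * ρx ^ (r + 1) := by gcongr
        have : 0 ≤ M * ρx ^ (r + 1) := by positivity
        linarith
      · intro z hz
        have hz' := hz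
        rw [mem_closedBall_iff_norm] at hz'
        have hzc : ‖z - c'‖ ≤ ρx := by
          have := norm_sub_le_norm_sub_add_norm_sub z x c'
          linarith
        have i1 := Wh_scale (hW c' hc') hM (hsub hz)
          (Metric.mem_closedBall_self (hρ0 c' hc').le) hx0 hzc
        have i2 := hcons x hx c' hc' e1
        have i3 : N (ρx / 32) (tr (z - x) (F x x - tr (x - c') (F c' c'))) ≤ M * ρx ^ (r + 1) :=
          ((N_tr (by positivity) _ _).trans (N_mono (by positivity) (by linarith) _)).trans i2
        have i4 : F c' z - cf x (F x x) z = (F c' z - tr (z - c') (F c' c')) -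
            tr (z - x) (F x x - tr (x - c') (F c' c')) := by
          rw [map_sub, tr_tr, cf, sub_add_sub_cancel]; abel
        rw [i4]
        refine (N_sub (by positivity) _ _).trans ?_
        have i5 := (N_mono (by positivity) (by linarith : ρx / 32 ≤ ρx) _).trans i1
        linarith
    have hrelcc : rel c := ⟨by linarith, by linarith⟩
    constructor
    · have hbd := fold_Bd (ρ := ρ) (F := F) (U := Metric.closedBall x (ρx / 32)) (u := ρx / 32)
        (P := cf x (F x x)) (A0 := 2 * M * ρx ^ (r + 1)) (by positivity) (by positivity) rel l2
        (fun c' hc' => hρ0 c' (hLB c' (hl2 c' hc')))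
        (by
          intro c' hc' hnr z hz
          rw [mem_closedBall_iff_norm] at hz
          by_contra hcon
          push Not at hcon
          have j1 := hlip x hx c' (hLB c' (hl2 c' hc'))
          have j2 := hlip c' (hLB c' (hl2 c' hc')) x hx
          have j3 := norm_sub_le_norm_sub_add_norm_sub x z c'
          rw [norm_sub_rev c' x] at j2
          rw [norm_sub_rev x z] at j3
          exact hnr ⟨by linarith, by linarith⟩)
        (fun c' hc' h => hrelc c' (hLB c' (hl2 c' hc')) h) G1 (2 * M * ρx ^ (r + 1)) le_rfl
        ((hrelc c hcB hrelcc).1.congr fun z hz => by rw [hG1c z hz])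
      rw [← hGe] at hbd
      refine hbd.mono subset_rfl (by positivity) le_rfl ?_ (by positivity)
      refine mul_le_mul_of_nonneg_left (pow_le_pow_right₀ hKg ?_) (by positivity)
      have h1 : l2.countP rel ≤ L.countP rel := by
        rw [hl, List.countP_append, List.countP_cons]; omega
      refine h1.trans ?_
      have h2 : L.countP rel = (S.filter rel).card := by
        rw [List.countP_eq_length_filter, ← List.toFinset_card_of_nodup (S.nodup_toList.filter _),
          List.toFinset_filter, Finset.toList_toFinset]
        simp
      rw [h2]
      refine pack_ball hP hx0 (c := x) _ ?_ ?_
      · intro y hy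
        have := (Finset.mem_filter.1 hy).2.1
        rw [norm_sub_rev]; linarith
      · intro y hy z hz hne
        have a1 := (Finset.mem_filter.1 hy)
        have a2 := (Finset.mem_filter.1 hz)
        refine lt_of_le_of_lt ?_ (hS2 y a1.1 z a2.1 hne)
        have := a1.2.2; have := a2.2.2
        exact le_min (by linarith) (by linarith)
    · intro hxE
      rw [hGe]
      refine fold_eq x (f x) l2 (fun c' hc' => hρ0 c' (hLB c' (hl2 c' hc')))
        (fun c' hc' h => hval c' (hLB c' (hl2 c' hc')) x hxE h) _ ?_
      rw [hG1c x (Metric.mem_closedBall_self (by positivity))]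
      exact hval c hcB x hxE (by have := hρ0 c hcB; linarith)
  refine ⟨G, ?_, ?_, ?_, ?_⟩
  · have hconv : Convex ℝ B := convex_closedBall _ _
    rw [mul_assoc]
    refine LG hconv (ε := ρm / 64) (by positivity) (by positivity) ?_
    intro x hx z hz hxz
    have hx0 := hρ0 x hx
    have hb := (key x hx).1.2 x (Metric.mem_closedBall_self (by positivity)) z (by
      rw [mem_closedBall_iff_norm, norm_sub_rev]; have := hρ x hx; linarith) (by have := hρ x hx; linarith)
    have e : G x - cf x (F x x) x - tr (x - z) (G z - cf x (F x x) z) = G x - tr (x - z) (G z) := by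
      rw [map_sub, tr_cf]; abel
    rw [e] at hb
    refine hb.trans (le_of_eq ?_)
    rw [hK1, div_div_eq_mul_div, div_pow, mul_pow]
    field_simp
  · intro z
    exact fold_nonneg z L (fun c hc => hρ0 c (hLB c hc)) (fun c hc h => hpos c (hLB c hc) z h) _ (by simp)
  · intro z hz hzB
    exact (key z hzB).2 hz
  · intro x hx
    have hx0 := hρ0 x hx
    have hb := (key x hx).1.1 x (Metric.mem_closedBall_self (by positivity))
    simp only [cf_self] at hb
    have h1 := N_le_of_scale (s := ρ x / 32) (t := ρ x) (K := 32) (by positivity) hx0.le (by norm_num) (by linarith)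
      (G x - F x x)
    refine h1.trans ((mul_le_mul_of_nonneg_left hb (by positivity)).trans ?_)
    have h3 : (32:ℝ) ^ r ≤ 32 ^ (r + 1) := pow_le_pow_right₀ (by norm_num) (by omega)
    calc (32:ℝ) ^ r * (2 * M * ρ x ^ (r + 1) * Kg n r ^ P)
        ≤ 32 ^ (r + 1) * (2 * M * ρ x ^ (r + 1) * Kg n r ^ P) := by gcongr
      _ = 1 * (K1 * M * ρ x ^ (r + 1)) := by rw [hK1]; ring
      _ ≤ 2 ^ r * (K1 * M * ρ x ^ (r + 1)) := by gcongr
      _ = _ := by ring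

end NNI
end SecP6

open scoped BigOperators
noncomputable section SecP7a
namespace NNI
variable {n r : ℕ}

lemma N_tr2 {δ : ℝ} (hδ : 0 ≤ δ) {h : Euc n} (hh : ‖h‖ ≤ δ) (p : Jet n r) :
    N δ (tr h p) ≤ 2 ^ r * N δ p := by
  refine (N_tr hδ h p).trans ?_
  refine (N_mono (by positivity) (by linarith : δ + ‖h‖ ≤ 2 * δ) p).trans ?_
  exact N_scale_up hδ (by norm_num) p

lemma N1_Sc_inv {δ : ℝ} (hδ : 0 < δ) (p : Jet n r) :
    N 1 (Sc δ⁻¹ p) = (δ ^ (r + 1))⁻¹ * N δ p := by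
  have := N_Sc_self hδ (Sc δ⁻¹ p)
  rw [Sc_inv hδ.ne'] at this
  rw [this, inv_mul_cancel_left₀ (by positivity)]

lemma N1_Sc_inv_le {δ A : ℝ} (hδ : 0 < δ) {p : Jet n r} (h : N δ p ≤ A * δ ^ (r + 1)) :
    N 1 (Sc δ⁻¹ p) ≤ A := by
  rw [N1_Sc_inv hδ, inv_mul_le_iff₀ (by positivity), mul_comm]; exact h

set_option maxHeartbeats 1000000 in
theorem step1 {C : ℝ} (hC : 1 ≤ C) : ∃ c1 C1 : ℝ, 0 < c1 ∧ c1 ≤ 1 ∧ 1 ≤ C1 ∧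
    ∀ (E : Finset (Euc n)) (f : Euc n → ℝ) (V : Submodule ℝ (Jet n r)) (x0 : Euc n) (δ0 M : ℝ)
      (p0 : Jet n r) (k : ℕ) (T : Jet n r →ₗ[ℝ] Jet n r) (y : Euc n), DTI V → 0 < δ0 → 0 < M →
      HasT E f V x0 δ0 p0 M ((DD n r + 1) * k) C T → ‖y - x0‖ ≤ c1 * δ0 →
      ∃ p, p - tr (y - x0) p0 ∈ V ∧ N δ0 (p - tr (y - x0) p0) ≤ C1 * M * δ0 ^ (r + 1) ∧
        ∃ T', HasT E f V y δ0 p M k C1 T' := by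
  classical
  set D : ℝ := (Fintype.card (Ix n r) : ℝ) with hD
  have hD1 : 1 ≤ D := card_pos' n r
  set b : ℝ := 2 ^ r with hb
  have hb1 : 1 ≤ b := one_le_pow₀ (by norm_num)
  set lam : ℝ := 1 / (D * 2 * b * C) with hlam
  have hlam0 : 0 < lam := by positivity
  set c1 := lam / 2 with hc1
  have hc10 : 0 < c1 := by positivity
  have hlamC : lam * (D * 2 * b * C) = 1 := by rw [hlam]; field_simp
  have hbC : 1 ≤ b * C := by nlinarith
  have hc1C : c1 * (b * C) ≤ 1 / 4 := by
    have h1 : lam * (2 * (b * C)) ≤ lam * (D * (2 * (b * C))) := by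
      refine mul_le_mul_of_nonneg_left ?_ hlam0.le
      nlinarith
    nlinarith
  have hc11 : c1 ≤ 1 / 4 := by nlinarith
  have hCc1 : C * c1 ≤ 1 / 4 := by nlinarith [mul_nonneg (mul_nonneg hc10.le (by linarith : (0:ℝ) ≤ C)) (by linarith : (0:ℝ) ≤ b - 1)]
  set C' : ℝ := 2 * (b * ((b + 1) * C)) with hC'
  set C1 : ℝ := 4 * D * b * (b + 1) * C with hC1
  have hC'0 : 0 < C' := by positivity
  have hC'C1 : 2 * C' ≤ C1 := by
    have : 0 ≤ b * (b + 1) * C := by positivity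
    rw [hC', hC1]; nlinarith
  have hC'1 : 4 ≤ C' := by rw [hC']; nlinarith
  have hlC1 : 2 / lam ≤ C1 := by
    rw [div_le_iff₀ hlam0, hC1]
    have : lam * (D * 2 * b * C) * (2 * (b + 1)) ≥ 2 := by rw [hlamC]; linarith
    nlinarith
  refine ⟨c1, C1, hc10, by linarith, by linarith, ?_⟩
  intro E f V x0 δ0 M p0 k T y hV hδ hM hT hy
  obtain ⟨hTV, hTN, hTG⟩ := hT
  set h := y - x0 with hh
  have hhδ : ‖h‖ ≤ δ0 := hy.trans (by nlinarith)
  -- transported points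
  have htr : ∀ p ∈ (GamK E f ((DD n r + 1) * k) x0 M : Set (Jet n r)), ∃ p' ∈ (GamK E f k y M : Set (Jet n r)),
      N δ0 (p' - tr h p) ≤ c1 * M * δ0 ^ (r + 1) := by
    intro p hp
    obtain ⟨p', a1, a2⟩ := transport' hp hM.le (t := c1 * δ0) (by positivity) y hy
    refine ⟨p', a1, (N_up (by positivity) (by nlinarith : c1 * δ0 ≤ δ0) _ a2).trans (le_of_eq ?_)⟩
    ring
  have hp1 : ∀ β, p0 + (M / C) • Sc δ0 (T (bs β)) ∈ GamK E f ((DD n r + 1) * k) x0 M := fun β =>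
    hTG _ (by rw [N_bs, one_pow])
  have hp2 : ∀ β, p0 - (M / C) • Sc δ0 (T (bs β)) ∈ GamK E f ((DD n r + 1) * k) x0 M := fun β => by
    have := hTG (-bs β) (by rw [N_neg, N_bs, one_pow])
    rwa [map_neg, map_neg, smul_neg, ← sub_eq_add_neg] at this
  choose qp hqp1 hqp2 using fun β => htr _ (hp1 β)
  choose qm hqm1 hqm2 using fun β => htr _ (hp2 β)
  set w : Ix n r → Jet n r := fun β => (1/2 : ℝ) • (qp β - qm β) with hw
  set pc0 : Jet n r := D⁻¹ • ∑ β, (1/2 : ℝ) • (qp β + qm β) with hpc0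
  have hmem : ∀ q : Jet n r, N 1 q ≤ 1 → pc0 + D⁻¹ • ∑ β, q β • w β ∈ GamK E f k y M := by
    intro q hq
    have h1 := avg (convex_GamK E f k y M) 0 (fun β => ((1 + q β) / 2) • qp β + ((1 - q β) / 2) • qm β)
      (fun β => by
        rw [zero_add]
        have h2 := abs_le.1 ((abs_le_N1 q β).trans hq)
        exact convex_GamK E f k y M (hqp1 β) (hqm1 β) (by linarith) (by linarith) (by ring))
    rw [zero_add] at h1
    convert h1 using 1
    rw [hpc0, ← smul_add, ← Finset.sum_add_distrib]
    congr 1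
    refine Finset.sum_congr rfl fun β _ => ?_
    rw [hw]
    module
  have he0 : N δ0 (pc0 - tr h p0) ≤ c1 * M * δ0 ^ (r + 1) := by
    have h1 : pc0 - tr h p0 = D⁻¹ • ∑ β, (1/2:ℝ) • ((qp β - tr h (p0 + (M / C) • Sc δ0 (T (bs β)))) +
        (qm β - tr h (p0 - (M / C) • Sc δ0 (T (bs β))))) := by
      have h2 : tr h p0 = D⁻¹ • ∑ β : Ix n r, tr h p0 := by
        rw [Finset.sum_const, Finset.card_univ, ← Nat.cast_smul_eq_nsmul ℝ, smul_smul, ← hD,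
          inv_mul_cancel₀ (by positivity), one_smul]
      nth_rewrite 1 [h2]
      rw [hpc0, ← smul_sub, ← Finset.sum_sub_distrib]
      congr 1
      refine Finset.sum_congr rfl fun β _ => ?_
      rw [map_add, map_sub]
      module
    rw [h1, N_smul, abs_of_pos (by positivity), inv_mul_le_iff₀ (by positivity)]
    refine (N_sum hδ.le _ _).trans ((Finset.sum_le_card_nsmul _ _ (c1 * M * δ0 ^ (r + 1)) fun β _ => ?_).trans (le_of_eq ?_))
    · rw [N_smul, abs_of_pos (by norm_num)]
      have := N_add hδ.le (qp β - tr h (p0 + (M / C) • Sc δ0 (T (bs β)))) (qm β - tr h (p0 - (M / C) • Sc δ0 (T (bs β))))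
      linarith [hqp2 β, hqm2 β]
    · rw [Finset.card_univ, nsmul_eq_mul]
  -- the operators
  set τ : Euc n → Jet n r →ₗ[ℝ] Jet n r := fun h => Sc δ0⁻¹ ∘ₗ tr h ∘ₗ Sc δ0 with hτ
  have hτN : ∀ h' : Euc n, ‖h'‖ ≤ δ0 → ∀ p, N 1 (τ h' p) ≤ b * N 1 p := by
    intro h' hh' p
    simp only [hτ, LinearMap.comp_apply]
    refine N1_Sc_inv_le hδ ?_
    refine (N_tr2 hδ.le hh' _).trans ?_
    rw [N_Sc_self hδ]
    exact le_of_eq (by ring)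
  have hττ : ∀ p, τ h (τ (-h) p) = p := by
    intro p
    simp only [hτ, LinearMap.comp_apply]
    rw [Sc_inv hδ.ne', tr_tr, add_neg_cancel, tr_zero, Sc_inv' hδ.ne']
  have hτV : ∀ p ∈ V, τ h p ∈ V := fun p hp =>
    hV.sc (inv_ne_zero hδ.ne') (hV.tr h (hV.sc hδ.ne' hp))
  set T0 : Jet n r →ₗ[ℝ] Jet n r := colL fun β => (C / M) • Sc δ0⁻¹ (w β) with hT0
  have hT0S : ∀ q, (M / C) • Sc δ0 (T0 q) = ∑ β, q β • w β := by
    intro q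
    rw [hT0, colL_apply, map_sum, Finset.smul_sum]
    refine Finset.sum_congr rfl fun β _ => ?_
    rw [map_smul, map_smul, Sc_inv hδ.ne', smul_smul, smul_smul]
    congr 1
    field_simp
  have herr : ∀ β, N 1 ((T0 - τ h ∘ₗ T) (bs β)) ≤ C * c1 := by
    intro β
    have h1 : (T0 - τ h ∘ₗ T) (bs β) = Sc δ0⁻¹ ((C / M) • (w β - (M / C) • tr h (Sc δ0 (T (bs β))))) := by
      have : C / M * (M / C) = 1 := by field_simp
      rw [LinearMap.sub_apply, hT0, colL_bs, LinearMap.comp_apply, smul_sub, smul_smul (C / M) (M / C), this, one_smul,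
        map_sub, map_smul (Sc δ0⁻¹) _ (w β)]
      rfl
    rw [h1]
    refine N1_Sc_inv_le hδ ?_
    rw [N_smul, abs_of_pos (by positivity)]
    have h2 : w β - (M / C) • tr h (Sc δ0 (T (bs β))) = (1/2:ℝ) • ((qp β - tr h (p0 + (M / C) • Sc δ0 (T (bs β)))) -
        (qm β - tr h (p0 - (M / C) • Sc δ0 (T (bs β))))) := by
      rw [hw, map_add, map_sub, map_smul]
      module
    have h3 : N δ0 (w β - (M / C) • tr h (Sc δ0 (T (bs β)))) ≤ c1 * M * δ0 ^ (r + 1) := by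
      rw [h2, N_smul, abs_of_pos (by norm_num)]
      have := N_sub hδ.le (qp β - tr h (p0 + (M / C) • Sc δ0 (T (bs β)))) (qm β - tr h (p0 - (M / C) • Sc δ0 (T (bs β))))
      linarith [hqp2 β, hqm2 β]
    calc C / M * N δ0 (w β - (M / C) • tr h (Sc δ0 (T (bs β)))) ≤ C / M * (c1 * M * δ0 ^ (r + 1)) := by gcongr
      _ = _ := by field_simp
  have herr' := lin_bound zero_le_one herr
  have hT0N : ∀ p, N 1 (T0 p) ≤ (b + 1) * C * N 1 p := by
    intro p
    have h1 : T0 p = (T0 - τ h ∘ₗ T) p + τ h (T p) := by simp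
    rw [h1]
    refine (N_add zero_le_one _ _).trans ?_
    have h2 := herr' p
    have h3 := (hτN h hhδ (T p)).trans (mul_le_mul_of_nonneg_left (hTN p) (by positivity))
    have h4 : C * c1 * N 1 p ≤ C * N 1 p := by
      have := N_nonneg zero_le_one p
      gcongr; nlinarith
    nlinarith
  have hnh : ‖-h‖ ≤ δ0 := by rwa [norm_neg]
  set R : Jet n r →ₗ[ℝ] Jet n r := (T0 - τ h ∘ₗ T) ∘ₗ τ (-h) with hR
  obtain ⟨U, hU⟩ := lin_invert (R := R) (fun p => by
    rw [hR, LinearMap.comp_apply]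
    refine (herr' _).trans ?_
    have h1 := hτN (-h) hnh p
    have h2 := N_nonneg zero_le_one p
    calc C * c1 * N 1 (τ (-h) p) ≤ C * c1 * (b * N 1 p) := by gcongr
      _ = (c1 * (b * C)) * N 1 p := by ring
      _ ≤ 1 / 2 * N 1 p := by gcongr; linarith)
  set T' : Jet n r →ₗ[ℝ] Jet n r := T0 ∘ₗ τ (-h) ∘ₗ U with hT'
  have hT'V : ∀ p, p - T' p ∈ V := by
    intro p
    have h1 := hτV _ (hTV (τ (-h) (U p)))
    convert h1 using 1
    nth_rewrite 1 [← (hU p).1]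
    rw [hT', hR]
    simp only [LinearMap.comp_apply, LinearMap.sub_apply]
    rw [map_sub, hττ]
    abel
  have hqb : ∀ p, N 1 (τ (-h) (U p)) ≤ 2 * b * N 1 p := by
    intro p
    refine (hτN _ hnh _).trans ?_
    have h1 := mul_le_mul_of_nonneg_left (hU p).2 (by positivity : 0 ≤ b)
    linarith
  have hT'N : ∀ p, N 1 (T' p) ≤ C' * N 1 p := by
    intro p
    rw [hT']
    refine (hT0N _).trans ?_
    have := hqb p
    calc (b + 1) * C * N 1 (τ (-h) (U p)) ≤ (b + 1) * C * (2 * b * N 1 p) := by gcongr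
      _ = _ := by rw [hC']; ring
  have hT'G : ∀ p, N 1 p ≤ 1 → pc0 + (lam * M) • Sc δ0 (T' p) ∈ GamK E f k y M := by
    intro p hp
    have h1 := hmem ((1 / (2 * b)) • τ (-h) (U p)) (by
      rw [N_smul, abs_of_pos (by positivity), div_mul_eq_mul_div, one_mul, div_le_one (by positivity)]
      have := hqb p
      nlinarith)
    rw [← hT0S, map_smul, map_smul, smul_smul, smul_smul] at h1
    have h2 : lam * M = D⁻¹ * (M / C) * (1 / (2 * b)) := by rw [hlam]; field_simp
    rw [h2]
    exact h1
  set e : Jet n r := Sc δ0⁻¹ (pc0 - tr h p0) with he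
  have heN : N 1 e ≤ c1 * M := N1_Sc_inv_le hδ he0
  refine ⟨pc0 - Sc δ0 (T' e), ?_, ?_, T', hT'V, ?_, ?_⟩
  · have h1 := hV.sc hδ.ne' (hT'V e)
    rw [map_sub, he, Sc_inv hδ.ne', ← he] at h1
    convert h1 using 1; abel
  · have h1 : pc0 - Sc δ0 (T' e) - tr h p0 = (pc0 - tr h p0) - Sc δ0 (T' e) := by abel
    rw [h1]
    refine (N_sub hδ.le _ _).trans ?_
    rw [N_Sc_self hδ]
    have h2 := (hT'N e).trans (mul_le_mul_of_nonneg_left heN hC'0.le)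
    calc N δ0 (pc0 - tr h p0) + δ0 ^ (r + 1) * N 1 (T' e) ≤ c1 * M * δ0 ^ (r + 1) + δ0 ^ (r + 1) * (C' * (c1 * M)) := by
          gcongr
      _ = (c1 * (1 + C')) * (M * δ0 ^ (r + 1)) := by ring
      _ ≤ C1 * (M * δ0 ^ (r + 1)) := by gcongr; nlinarith
      _ = _ := by ring
  · intro p
    refine (hT'N p).trans ?_
    have := N_nonneg zero_le_one p
    gcongr; linarith
  · intro p hp
    have h1 := hT'G (-(1 / (lam * M)) • e + (1 / (lam * C1)) • p) (by
      refine (N_add zero_le_one _ _).trans ?_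
      rw [N_smul, N_smul, abs_neg, abs_of_pos (by positivity), abs_of_pos (by positivity)]
      have h2 : 1 / (lam * M) * N 1 e ≤ 1 / 2 := by
        calc 1 / (lam * M) * N 1 e ≤ 1 / (lam * M) * (c1 * M) := by gcongr
          _ = 1 / 2 := by rw [hc1]; field_simp
      have h3 : 1 / (lam * C1) ≤ 1 / 2 := by
        rw [div_le_iff₀ (by positivity)]
        rw [div_le_iff₀ hlam0] at hlC1
        linarith
      have h5 := N_nonneg zero_le_one p
      have h4 : 1 / (lam * C1) * N 1 p ≤ 1 / 2 * 1 := by gcongr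
      linarith)
    convert h1 using 1
    rw [map_add, map_add, map_smul, map_smul, map_smul, map_smul, smul_add, smul_smul, smul_smul]
    have e1 : lam * M * -(1 / (lam * M)) = -1 := by field_simp
    have e2 : lam * M * (1 / (lam * C1)) = M / C1 := by field_simp
    rw [e1, e2]
    module

end NNI
end SecP7a

open scoped BigOperators
noncomputable section SecP7b
namespace NNI
variable {n r : ℕ}

def OK (A : ℝ) (E : Finset (Euc n)) (f : Euc n → ℝ) (V : Submodule ℝ (Jet n r)) (z : Euc n) (δ0 : ℝ)
    (q0 : Jet n r) (M : ℝ) (k d : ℕ) (δ : ℝ) : Prop :=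
  ∃ p, p - q0 ∈ V ∧ N δ0 (p - q0) ≤ A * M * δ0 ^ (r + 1) ∧ ∃ V', om V' < d ∧ Has E f V' z δ p (4 * M) k A

set_option maxHeartbeats 1000000 in
theorem UNQ (n r : ℕ) (C1 : ℝ) (hC1 : 1 ≤ C1) (d : ℕ) : ∃ A : ℝ, 1 ≤ A ∧ ∀ A' : ℝ, 1 ≤ A' →
    ∃ CU : ℝ, 0 ≤ CU ∧ ∀ (E : Finset (Euc n)) (f : Euc n → ℝ) (V : Submodule ℝ (Jet n r)) (z : Euc n)
      (δ0 δb M : ℝ) (pz q0 : Jet n r) (k : ℕ) (T : Jet n r →ₗ[ℝ] Jet n r), DTI V → om V ≤ d → 0 < δb →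
      0 < δ0 → 0 < M → HasT E f V z δ0 pz M k C1 T → pz - q0 ∈ V →
      N δ0 (pz - q0) ≤ C1 * M * δ0 ^ (r + 1) →
      (∀ δ, δb ≤ δ → δ ≤ δ0 → ¬ OK A E f V z δ0 q0 M k d δ) →
      ∀ p'' q', p'' ∈ GamK E f k z (A' * M) → q' - q0 ∈ V → N δ0 (q' - q0) ≤ A' * M * δ0 ^ (r + 1) →
      N δb (p'' - q') ≤ A' * M * δb ^ (r + 1) → N δb (pz - q') ≤ CU * M * δb ^ (r + 1) := by
  obtain ⟨s0, A3, hs0, hs01, hA3, hR⟩ := R34 n r (4 * C1) (by linarith) d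
  refine ⟨2 * A3 + C1 + 1, by linarith, fun A' hA' => ?_⟩
  obtain ⟨K0, hKe⟩ : ∃ K0, K0 = 2 * A' + A' + (C1 + 1) * A' + C1 := ⟨_, rfl⟩
  have hKa : C1 + A' ≤ K0 := by nlinarith
  have hKb : 2 * A' + A' + (C1 + 1) * A' ≤ K0 := by linarith
  have hKp : 0 ≤ K0 := by linarith
  set K := K0 * (s0⁻¹) ^ (r + 1) with hK
  have hK0 : 0 ≤ K := by positivity
  refine ⟨K, hK0, ?_⟩
  intro E f V z δ0 δb M pz q0 k T hV hd hδb hδ0 hM hT hpV hpN hbad p'' q' hp'' hqV hqN hpq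
  have hs1 : 1 ≤ s0⁻¹ := (one_le_inv₀ hs0).2 hs01
  have hsp : 1 ≤ (s0⁻¹) ^ (r + 1) := one_le_pow₀ hs1
  have hpq0 : N δ0 (pz - q') ≤ (C1 + A') * M * δ0 ^ (r + 1) := by
    refine (N_sub_le hδ0.le pz q0 q').trans ?_
    rw [N_sub_comm _ q0 q']
    linarith
  set δ2 := s0⁻¹ * δb with hδ2
  have hδ2p : 0 < δ2 := by positivity
  have hδb2 : δb ≤ δ2 := by rw [hδ2]; nlinarith
  have hδ2e : δ2 ^ (r + 1) = (s0⁻¹) ^ (r + 1) * δb ^ (r + 1) := by rw [hδ2, mul_pow]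
  rcases le_total δ0 δb with hcase | hcase
  · refine (N_up' hδ0 hcase _ hpq0).trans ?_
    gcongr
    rw [hK]
    nlinarith
  rcases lt_or_ge δ0 δ2 with hcase2 | hcase2
  · refine (N_mono hδb.le hcase _).trans (hpq0.trans ?_)
    calc (C1 + A') * M * δ0 ^ (r + 1) ≤ (C1 + A') * M * δ2 ^ (r + 1) := by gcongr
      _ = (C1 + A') * (s0⁻¹) ^ (r + 1) * M * δb ^ (r + 1) := by rw [hδ2e]; ring
      _ ≤ _ := by
        gcongr
        rw [hK]
        gcongr
  -- main case
  have hs0δ : s0 * δ2 = δb := by rw [hδ2]; field_simp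
  have hlow : low (Ts (δ2 / δ0) T) ≤ 1 := by
    by_contra hcon
    push Not at hcon
    obtain ⟨δ1, a1, a2, V', a3, a4⟩ := (hR E f V z δ0 δ2 M pz k T hV hd hδ2p hcase2 hM
      (hT.mono hM (by linarith) le_rfl (by linarith) le_rfl (by gcongr; linarith))).1 hcon.le
    refine hbad δ1 (by linarith) a2 ⟨pz, hpV, hpN.trans (by gcongr; linarith), V', a3, ?_⟩
    exact a4.mono (by positivity) (by linarith) (by linarith) (by linarith) le_rfl (by nlinarith)
  have hsd : 0 < δ2 / δ0 := by positivity
  have hsd1 : δ2 / δ0 ≤ 1 := (div_le_one hδ0).2 hcase2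
  have hsde : δ2 / δ0 * δ0 = δ2 := by field_simp
  set T2 := Ts (δ2 / δ0) T with hT2
  have hT2N := Ts_bound hsd hsd1 hT.2.1 hlow
  have hT2V := Ts_V hV hT.1 hsd
  set e := p'' - q' with he
  have he2 : N δ2 e ≤ A' * M * δ2 ^ (r + 1) := N_up' hδb hδb2 _ hpq
  have he0 : N δ0 e ≤ A' * M * δ0 ^ (r + 1) := N_up' hδb hcase _ hpq
  set te := Sc δ2⁻¹ e with hte
  have hte1 : N 1 te ≤ A' * M := N1_Sc_inv_le hδ2p he2
  have hSte : Sc δ2 te = e := Sc_inv hδ2p.ne' e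
  have hTe0 : Sc δ2 (T2 te) = Sc δ0 (T (Sc δ0⁻¹ e)) := by
    rw [hT2, Ts_apply, hte, Sc_Sc, Sc_Sc]
    congr 2
    · field_simp
    · congr 1
      congr 1
      field_simp
  set v := p'' - pz - Sc δ2 (T2 te) with hv
  have hveq : v = (q' - q0) - (pz - q0) + (e - Sc δ2 (T2 te)) := by rw [hv, he]; abel
  have hvV : v ∈ V := by
    rw [hveq]
    refine V.add_mem (V.sub_mem hqV hpV) ?_
    have := hV.sc hδ2p.ne' (hT2V te)
    rwa [map_sub, hSte] at this
  have hT2e : N δ2 (Sc δ2 (T2 te)) ≤ (C1 + 1) * A' * M * δ2 ^ (r + 1) := by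
    rw [N_Sc_self hδ2p]
    have := (hT2N te).trans (mul_le_mul_of_nonneg_left hte1 (by linarith))
    calc δ2 ^ (r + 1) * N 1 (T2 te) ≤ δ2 ^ (r + 1) * ((C1 + 1) * (A' * M)) := by gcongr
      _ = _ := by ring
  have hv0 : N δ0 v ≤ (2 * A' + C1 + C1 * A') * M * δ0 ^ (r + 1) := by
    rw [hveq]
    refine (N_add hδ0.le _ _).trans ?_
    have h1 := N_sub hδ0.le (q' - q0) (pz - q0)
    have h2 := N_sub hδ0.le e (Sc δ2 (T2 te))
    have h3 : N δ0 (Sc δ2 (T2 te)) ≤ C1 * A' * M * δ0 ^ (r + 1) := by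
      rw [hTe0, N_Sc_self hδ0]
      have := (hT.2.1 (Sc δ0⁻¹ e)).trans (mul_le_mul_of_nonneg_left (N1_Sc_inv_le hδ0 he0) (by linarith))
      calc δ0 ^ (r + 1) * N 1 (T (Sc δ0⁻¹ e)) ≤ δ0 ^ (r + 1) * (C1 * (A' * M)) := by gcongr
        _ = _ := by ring
    linarith
  have hvb : N δ2 v ≤ 2 * A' * M * δ2 ^ (r + 1) := by
    by_contra hcon
    push Not at hcon
    set t : ℝ := 1 / (2 * A' * C1) with ht
    have ht0 : 0 < t := by positivity
    have hAC : 1 ≤ A' * C1 := by nlinarith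
    have htAC : t * (A' * C1) = 1 / 2 := by rw [ht]; field_simp
    have ht1 : t ≤ 1 / 2 := by nlinarith
    have htA : t * A' ≤ 1 / 2 := by nlinarith [mul_pos ht0 (by linarith : 0 < A')]
    have hptv : pz + t • v ∈ GamK E f k z (2 * M) := by
      have h1 := hT.Ts_mem hsd hsd1 (p := -(C1 * t / ((1 - t) * M)) • te) (by
        rw [N_smul, abs_neg, abs_of_nonneg (by have : 0 < 1 - t := by linarith
                                               positivity)]
        have h1t : 0 < 1 - t := by linarith
        calc C1 * t / ((1 - t) * M) * N 1 te ≤ C1 * t / ((1 - t) * M) * (A' * M) := by gcongr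
          _ = (t * (A' * C1)) / (1 - t) := by field_simp
          _ ≤ 1 := by rw [htAC, div_le_one h1t]; linarith)
      rw [hsde] at h1
      have h2 := GamK.comb h1 hp'' (by linarith : 0 ≤ 1 - t) ht0.le (by ring)
      have h3 := GamK.mono h2 le_rfl (by nlinarith : (1 - t) * M + t * (A' * M) ≤ 2 * M)
      convert h3 using 1
      rw [hv, map_smul, map_smul, smul_smul]
      have h4 : M / C1 * -(C1 * t / ((1 - t) * M)) = -(t / (1 - t)) := by
        have : 1 - t ≠ 0 := by linarith
        field_simp
      rw [h4, smul_add, smul_smul]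
      have h5 : (1 - t) * -(t / (1 - t)) = -t := by
        have : 1 - t ≠ 0 := by linarith
        field_simp
      rw [h5]
      module
    have hpz2 : pz ∈ GamK E f k z (2 * M) := GamK.mono hT.center le_rfl (by linarith)
    set ps := pz + (t / 2) • v with hps
    have hsym : ∀ a : ℝ, |a| ≤ 1 → ps + (a * (t / 2)) • v ∈ GamK E f k z (2 * M) := by
      intro a ha
      have ha' := abs_le.1 ha
      have := convex_GamK E f k z (2 * M) hpz2 hptv (by linarith : 0 ≤ (1 - a) / 2)
        (by linarith : 0 ≤ (1 + a) / 2) (by ring)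
      convert this using 1
      rw [hps]; module
    have hTs : HasT E f V z δ0 ps (2 * M) k (4 * C1) T := by
      refine ⟨hT.1, fun p => (hT.2.1 p).trans ?_, fun p hp => ?_⟩
      · have := N_nonneg zero_le_one p
        gcongr; linarith
      · have h1 := GamK.comb (hT.2.2 p hp) hptv (by norm_num : (0:ℝ) ≤ 1/2) (by norm_num : (0:ℝ) ≤ 1/2) (by norm_num)
        have h3 := GamK.mono h1 le_rfl (by linarith : 1/2 * M + 1/2 * (2 * M) ≤ 2 * M)
        convert h3 using 1
        have h4 : 2 * M / (4 * C1) = 1/2 * (M / C1) := by field_simp; norm_num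
        rw [hps, h4]; module
    have hNv : 0 < N δ2 v := lt_of_le_of_lt (by positivity) hcon
    set a : ℝ := (M / (2 * C1)) * δ2 ^ (r + 1) / ((t / 2) * N δ2 v) with ha
    have ha0 : 0 < a := by positivity
    have ha1 : a ≤ 1 := by
      rw [ha, div_le_one (by positivity)]
      have h1 : M / (2 * C1) = t / 2 * (2 * A' * M) := by rw [ht]; field_simp
      rw [h1]
      calc t / 2 * (2 * A' * M) * δ2 ^ (r + 1) = t / 2 * (2 * A' * M * δ2 ^ (r + 1)) := by ring
        _ ≤ _ := by gcongr
    set Q := (2 * C1 / M * (a * (t / 2))) • Sc δ2⁻¹ v with hQ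
    have hSQ : (2 * M / (4 * C1)) • Sc δ2 Q = (a * (t / 2)) • v := by
      rw [hQ, map_smul, Sc_inv hδ2p.ne', smul_smul]
      congr 1
      field_simp; norm_num
    obtain ⟨δ1, b1, b2, V', b3, b4⟩ := (hR E f V z δ0 δ2 (2 * M) ps k T hV hd hδ2p hcase2 (by positivity)
      hTs).2 hlow Q (V.smul_mem _ (hV.sc (inv_ne_zero hδ2p.ne') hvV)) (by
        rw [hQ, N_smul, N1_Sc_inv hδ2p, abs_of_pos (by positivity), ha]
        field_simp) (by
        rw [hSQ]; exact hsym a (by rw [abs_of_pos ha0]; exact ha1)) (by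
        rw [hSQ]
        have := hsym (-a) (by rw [abs_neg, abs_of_pos ha0]; exact ha1)
        convert this using 1
        module)
    refine hbad δ1 (by linarith) (b2.trans hcase2) ⟨ps, ?_, ?_, V', b3, ?_⟩
    · have : ps - q0 = (pz - q0) + (t / 2) • v := by rw [hps]; abel
      rw [this]
      exact V.add_mem hpV (V.smul_mem _ hvV)
    · have : ps - q0 = (pz - q0) + (t / 2) • v := by rw [hps]; abel
      rw [this]
      refine (N_add hδ0.le _ _).trans ?_
      rw [N_smul, abs_of_pos (by positivity)]
      have h1 : t / 2 * N δ0 v ≤ t / 2 * ((2 * A' + C1 + C1 * A') * M * δ0 ^ (r + 1)) := by gcongr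
      have h2 : t / 2 * (2 * A' + C1 + C1 * A') ≤ 1 := by
        have h3 : t * C1 ≤ 1 / 2 := by nlinarith [mul_pos ht0 (by linarith : 0 < C1)]
        nlinarith
      have h3 : t / 2 * (2 * A' + C1 + C1 * A') * (M * δ0 ^ (r + 1)) ≤ 1 * (M * δ0 ^ (r + 1)) := by gcongr
      have h4 : 0 ≤ A3 * (M * δ0 ^ (r + 1)) := by positivity
      nlinarith
    · have := b4.mono (M' := 4 * M) (C' := 2 * A3 + C1 + 1) (k' := k) (by positivity) (by linarith) (by linarith) (by linarith) le_rfl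
        (by nlinarith)
      exact this
  have hfin : pz - q' = e - Sc δ2 (T2 te) - v := by rw [hv, he]; abel
  rw [hfin]
  have h1 := N_sub hδ2p.le (e - Sc δ2 (T2 te)) v
  have h2 := N_sub hδ2p.le e (Sc δ2 (T2 te))
  refine (N_mono hδb.le hδb2 _).trans ?_
  calc N δ2 (e - Sc δ2 (T2 te) - v) ≤ (2 * A' + A' + (C1 + 1) * A') * M * δ2 ^ (r + 1) := by linarith
    _ ≤ K0 * M * δ2 ^ (r + 1) := by gcongr
    _ = _ := by rw [hδ2e, hK]; ring

end NNI
end SecP7b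

open scoped BigOperators
noncomputable section SecP7c
namespace NNI
variable {n r : ℕ}

lemma N_chg {δ δ' K A : ℝ} (hδ : 0 < δ) (hδ' : 0 ≤ δ') (hK : 1 ≤ K) (h : δ ≤ K * δ') {p : Jet n r}
    (hA : N δ p ≤ A * δ ^ (r + 1)) : N δ' p ≤ A * K ^ (r + 1) * δ' ^ (r + 1) := by
  have h1 := N_up' hδ h p hA
  rw [mul_pow, ← mul_assoc] at h1
  exact (N_mono hδ' (by nlinarith) p).trans h1

lemma sep_E (E : Finset (Euc n)) : ∃ ρm : ℝ, 0 < ρm ∧ ∀ x, (E.filter (fun y => ‖y - x‖ ≤ ρm)).card ≤ 1 := by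
  classical
  have h : ∀ S : Finset (Euc n × Euc n), (∀ p ∈ S, p.1 ≠ p.2) → ∃ ρm : ℝ, 0 < ρm ∧ ∀ p ∈ S, 2 * ρm < ‖p.1 - p.2‖ := by
    intro S
    induction S using Finset.induction_on with
    | empty => intro _; exact ⟨1, one_pos, by simp⟩
    | insert a S ha ih =>
      intro hS
      obtain ⟨ρ, h1, h2⟩ := ih (fun p hp => hS p (Finset.mem_insert_of_mem hp))
      have h3 : 0 < ‖a.1 - a.2‖ := norm_pos_iff.2 (sub_ne_zero.2 (hS a (Finset.mem_insert_self _ _)))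
      refine ⟨min ρ (‖a.1 - a.2‖ / 4), by positivity, fun p hp => ?_⟩
      rcases Finset.mem_insert.1 hp with hp' | hp'
      · rw [hp']
        have := min_le_right ρ (‖a.1 - a.2‖ / 4)
        linarith
      · have := min_le_left ρ (‖a.1 - a.2‖ / 4)
        linarith [h2 p hp']
  obtain ⟨ρm, h1, h2⟩ := h ((E ×ˢ E).filter fun p => p.1 ≠ p.2) (fun p hp => (Finset.mem_filter.1 hp).2)
  refine ⟨ρm, h1, fun x => Finset.card_le_one.2 fun a ha b hb => ?_⟩
  by_contra hab
  rw [Finset.mem_filter] at ha hb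
  have h3 := h2 (a, b) (by simp [ha.1, hb.1, hab])
  have h4 := norm_sub_le_norm_sub_add_norm_sub a x b
  rw [norm_sub_rev x b] at h4
  simp only at h3
  linarith [ha.2, hb.2]

lemma exists_rho (E : Finset (Euc n)) (P : Euc n → ℝ → Prop) {K K' δ0 ρmax : ℝ} (hK : 0 ≤ K)
    (hρmax : 0 < ρmax) (hK1 : 2 * K ≤ K') (hK2 : δ0 < K' * ρmax) :
    ∃ (ρ : Euc n → ℝ) (ρm : ℝ), 0 < ρm ∧ (∀ x, ρm ≤ ρ x) ∧ (∀ x, ρ x ≤ ρmax) ∧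
      (∀ x y, ρ x ≤ ρ y + ‖x - y‖) ∧
      (∀ x, (E.filter (fun y => ‖y - x‖ ≤ ρ x / 2)).card ≤ 1 ∨ ∃ δ, K * (ρ x / 2) ≤ δ ∧ δ ≤ δ0 ∧ P x δ) ∧
      ∀ x, ∃ z, ‖z - x‖ ≤ 2 * ρ x ∧ ‖z - x‖ ≤ ρmax ∧ ∀ δ, K' * ρ x ≤ δ → δ ≤ δ0 → ¬ P z δ := by
  classical
  let G : Euc n → ℝ → Prop := fun x ρ => (E.filter (fun y => ‖y - x‖ ≤ ρ)).card ≤ 1 ∨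
    ∀ y, ‖y - x‖ ≤ ρ → ∃ δ, K * ρ ≤ δ ∧ δ ≤ δ0 ∧ P y δ
  have hG : ∀ x x' ρ ρ', G x ρ → ρ' + ‖x' - x‖ ≤ ρ → G x' ρ' := by
    intro x x' ρ ρ' h hle
    have hn := norm_nonneg (x' - x)
    have hb : ∀ y, ‖y - x'‖ ≤ ρ' → ‖y - x‖ ≤ ρ := fun y hy => by
      have := norm_sub_le_norm_sub_add_norm_sub y x' x
      linarith
    rcases h with h | h
    · left
      exact (Finset.card_le_card (Finset.monotone_filter_right E (fun y _ => hb y))).trans h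
    · right
      intro y hy
      obtain ⟨δ, h1, h2⟩ := h y (hb y hy)
      exact ⟨δ, (mul_le_mul_of_nonneg_left (by linarith) hK).trans h1, h2⟩
  obtain ⟨ρ1, hρ1, hE⟩ := sep_E E
  let A : Euc n → Set ℝ := fun x => {ρ | ρ ≤ ρmax ∧ G x ρ}
  have hbd : ∀ x, BddAbove (A x) := fun x => ⟨ρmax, fun ρ h => h.1⟩
  have hmem : ∀ x, min ρ1 ρmax ∈ A x := fun x => ⟨min_le_right _ _, hG x x ρ1 _ (Or.inl (hE x)) (by simp)⟩
  let ρ : Euc n → ℝ := fun x => sSup (A x)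
  have hρm : 0 < min ρ1 ρmax := lt_min hρ1 hρmax
  have hge : ∀ x, min ρ1 ρmax ≤ ρ x := fun x => le_csSup (hbd x) (hmem x)
  have hle : ∀ x, ρ x ≤ ρmax := fun x => csSup_le ⟨_, hmem x⟩ fun ρ h => h.1
  have hlt : ∀ x t, t < ρ x → G x t := by
    intro x t ht
    obtain ⟨t', h1, h2⟩ := exists_lt_of_lt_csSup ⟨_, hmem x⟩ ht
    exact hG x x t' t h1.2 (by simpa using h2.le)
  refine ⟨ρ, min ρ1 ρmax, hρm, hge, hle, ?_, ?_, ?_⟩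
  · intro x y
    refine csSup_le ⟨_, hmem x⟩ fun t ht => ?_
    have : t - ‖x - y‖ ∈ A y := ⟨by linarith [ht.1, norm_nonneg (x - y)], hG x y t _ ht.2 (by
      rw [norm_sub_rev y x]; linarith)⟩
    linarith [le_csSup (hbd y) this]
  · intro x
    have h0 := hρm.trans_le (hge x)
    rcases hlt x (ρ x / 2) (by linarith) with h | h
    · exact Or.inl h
    · exact Or.inr (h x (by simp; linarith))
  · intro x
    have h0 := hρm.trans_le (hge x)
    rcases (hle x).lt_or_eq with h | h
    · set t := min (2 * ρ x) ρmax with ht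
      have h1 : ρ x < t := lt_min (by linarith) h
      have h2 : ¬ G x t := fun hg => by
        have := le_csSup (hbd x) (show t ∈ A x from ⟨min_le_right _ _, hg⟩)
        exact absurd this (not_le.2 h1)
      simp only [G, not_or, not_forall] at h2
      obtain ⟨_, z, hz, h3⟩ := h2
      refine ⟨z, hz.trans (min_le_left _ _), hz.trans (min_le_right _ _), fun δ h4 h5 h6 => h3 ⟨δ, ?_, h5, h6⟩⟩
      have : K * t ≤ K * (2 * ρ x) := mul_le_mul_of_nonneg_left (min_le_left _ _) hK
      nlinarith
    · refine ⟨x, by simp; linarith, by simp; linarith, fun δ h4 h5 => ?_⟩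
      rw [h] at h4
      linarith

lemma mem_of_local {E : Finset (Euc n)} {f : Euc n → ℝ} {k : ℕ} {x z : Euc n} {ρ M1 M2 M3 : ℝ}
    {F : Euc n → Jet n r} {p : Jet n r} (hρ : 0 < ρ) (hM1 : 0 ≤ M1) (hM2 : 0 ≤ M2) (hM3 : 0 ≤ M3)
    (hF : Wh (Metric.closedBall x (4 * ρ)) M1 F)
    (hF0 : ∀ z, ‖z - x‖ ≤ 4 * ρ → 0 ≤ ev (F z))
    (hFE : ∀ z ∈ E, ‖z - x‖ ≤ 4 * ρ → ev (F z) = f z)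
    (hp : p ∈ GamK E f k x M2) (hd : N ρ (F x - p) ≤ M3 * ρ ^ (r + 1)) (hz : ‖z - x‖ ≤ ρ) :
    F z ∈ GamK E f k z (Ct n r * (M1 + M2 + M3)) := by
  intro S hS hc
  obtain ⟨H, hH, hHx⟩ := hp S hS hc
  obtain ⟨G, hG, hGz⟩ := TF hρ hM1 hM2 hM3 hF hF0 hFE hS hH (by rw [hHx]; exact hd)
  exact ⟨G, hG, hGz z hz⟩

end NNI
end SecP7c

open scoped BigOperators
noncomputable section SecP7d
namespace NNI
variable {n r : ℕ}

def MLc (n r d k : ℕ) (C c C' : ℝ) : Prop :=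
  ∀ (E : Finset (Euc n)) (f : Euc n → ℝ) (V : Submodule ℝ (Jet n r)) (x0 : Euc n) (δ0 M : ℝ)
    (p0 : Jet n r), om V < d → 0 < δ0 → 0 < M → Has E f V x0 δ0 p0 M k C →
    ∃ F : Euc n → Jet n r, Wh (Metric.closedBall x0 (c * δ0)) (C' * M) F ∧
      (∀ z, ‖z - x0‖ ≤ c * δ0 → 0 ≤ ev (F z)) ∧
      (∀ z ∈ E, ‖z - x0‖ ≤ c * δ0 → ev (F z) = f z) ∧ N δ0 (F x0 - p0) ≤ C' * M * δ0 ^ (r + 1)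

lemma N_tr_back {δ : ℝ} (hδ : 0 ≤ δ) {x z : Euc n} (h : ‖z - x‖ ≤ δ) (q : Jet n r) :
    N δ q ≤ 2 ^ r * N δ (tr (z - x) q) := by
  have h1 := N_tr2 hδ (h := x - z) (by rwa [norm_sub_rev]) (tr (z - x) q)
  rwa [tr_tr, sub_add_sub_cancel, sub_self, tr_zero] at h1

lemma tr_sub_q0 (x0 y z : Euc n) (p p0 : Jet n r) :
    tr (z - y) p - tr (z - x0) p0 = tr (z - y) (p - tr (y - x0) p0) := by
  rw [map_sub, tr_tr, sub_add_sub_cancel]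

set_option maxHeartbeats 2000000 in
theorem ML_step (n r d κ : ℕ) (hκ : 1 ≤ κ)
    (ih : ∀ C : ℝ, 1 ≤ C → ∃ c C' : ℝ, 0 < c ∧ c ≤ 1 ∧ 1 ≤ C' ∧ MLc n r d κ C c C') :
    ∀ C : ℝ, 1 ≤ C → ∃ c C' : ℝ, 0 < c ∧ c ≤ 1 ∧ 1 ≤ C' ∧
      MLc n r (d + 1) ((DD n r + 1) * ((DD n r + 1) * κ)) C c C' := by
  classical
  intro C hC
  obtain ⟨c1, C1, hc10, hc11, hC1, hst⟩ := step1 (n := n) (r := r) hC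
  obtain ⟨A, hA, hU⟩ := UNQ n r C1 hC1 d
  obtain ⟨s5, B, A5, hs5, hs51, hB, hA5, hDS⟩ := DS n r (d - 1) A hA
  obtain ⟨c5, C5, hc5, hc51, hC5, hML⟩ := ih A5 hA5
  obtain ⟨Kg', hKg', hGLUE⟩ := GLUE n r
  obtain ⟨b, hb⟩ : ∃ b : ℝ, b = 2 ^ r := ⟨_, rfl⟩
  have hb1 : 1 ≤ b := hb ▸ one_le_pow₀ (by norm_num)
  have hb0 : 0 < b := by linarith
  obtain ⟨K, hK⟩ : ∃ K : ℝ, K = 20 / (c5 * s5) := ⟨_, rfl⟩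
  have hK0 : 0 < K := by rw [hK]; positivity
  have hcsK : c5 * (s5 * K) = 20 := by rw [hK]; field_simp
  have hK20 : 20 ≤ K := by
    rw [hK, le_div_iff₀ (by positivity)]
    have : c5 * s5 ≤ 1 := mul_le_one₀ hc51 hs5.le hs51
    linarith
  obtain ⟨c, hc⟩ : ∃ c : ℝ, c = c1 / 10 := ⟨_, rfl⟩
  have hc0 : 0 < c := by rw [hc]; positivity
  obtain ⟨K', hK'⟩ : ∃ K' : ℝ, K' = 2 * K + 2 / c := ⟨_, rfl⟩
  have hKK' : 2 * K ≤ K' := by rw [hK']; have : 0 < 2 / c := by positivity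
                               linarith
  have hK'c : 2 ≤ K' * c := by
    rw [hK', add_mul, div_mul_cancel₀ _ hc0.ne']
    have : 0 < K * c := by positivity
    linarith
  have hK'0 : 0 < K' := by linarith
  obtain ⟨m1, hm1⟩ : ∃ m1 : ℝ, m1 = C5 * (B * 4) := ⟨_, rfl⟩
  have hm10 : 0 < m1 := by rw [hm1]; positivity
  obtain ⟨m3, hm3⟩ : ∃ m3 : ℝ, m3 = m1 * K ^ (r + 1) := ⟨_, rfl⟩
  have hm30 : 0 < m3 := by rw [hm3]; positivity
  have hCt := one_le_Ct n r
  have hCt0 : 0 < Ct n r := by linarith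
  obtain ⟨m4, hm4⟩ : ∃ m4 : ℝ, m4 = Ct n r * (m1 + B * 4 + m3) := ⟨_, rfl⟩
  have hm40 : 0 < m4 := by rw [hm4]; positivity
  have hbC1 : 0 < b * C1 := by positivity
  have hbA : 0 < b * A := by positivity
  have hbm1 : 0 < b * m1 := by positivity
  obtain ⟨CU1, hCU1, hU1⟩ := hU (1 + b * C1) (by linarith)
  obtain ⟨CU2, hCU2, hU2⟩ := hU (1 + b * A + (m1 + b * m1) + m4) (by linarith)
  obtain ⟨C8, hC8⟩ : ∃ C8 : ℝ, C8 = m1 + b * (CU1 + CU2) + 1 := ⟨_, rfl⟩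
  have hbCU : 0 ≤ b * (CU1 + CU2) := by positivity
  have hC80 : 0 < C8 := by rw [hC8]; positivity
  obtain ⟨C8', hC8'⟩ : ∃ C8' : ℝ, C8' = C8 + b * (2 * CU1) + b * (C8 * 2 ^ (r + 1)) := ⟨_, rfl⟩
  have hC8'0 : C8 ≤ C8' := by
    rw [hC8']; have : 0 ≤ b * (2 * CU1) := by positivity
    have : 0 ≤ b * (C8 * 2 ^ (r + 1)) := by positivity
    linarith
  obtain ⟨C9, hC9⟩ : ∃ C9 : ℝ, C9 = C8' * (2 * K') ^ (r + 1) := ⟨_, rfl⟩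
  have hK'1 : (1:ℝ) ≤ (2 * K') ^ (r + 1) := one_le_pow₀ (by linarith)
  have hC89 : C8 ≤ C9 := by
    rw [hC9]
    exact hC8'0.trans (le_mul_of_one_le_right (by linarith) hK'1)
  have hC90 : 0 < C9 := by linarith
  have hKC9 : 0 < Kg' * C9 := by positivity
  have hC8K : 0 < C8 * K' ^ (r + 1) := by positivity
  refine ⟨c, Kg' * C9 + C8 * K' ^ (r + 1) + C1, hc0, by linarith, by linarith, ?_⟩
  intro E f V x0 δ0 M p0 hd hδ0 hM hHas
  obtain ⟨hV, T, hT⟩ := hHas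
  -- data at all nearby points
  have hdata : ∀ y, ∃ (p : Jet n r) (T' : Jet n r →ₗ[ℝ] Jet n r), ‖y - x0‖ ≤ c1 * δ0 →
      p - tr (y - x0) p0 ∈ V ∧ N δ0 (p - tr (y - x0) p0) ≤ C1 * M * δ0 ^ (r + 1) ∧
        HasT E f V y δ0 p M ((DD n r + 1) * κ) C1 T' := by
    intro y
    by_cases hy : ‖y - x0‖ ≤ c1 * δ0
    · obtain ⟨p, h1, h2, T', h3⟩ := hst E f V x0 δ0 M p0 _ T y hV hδ0 hM hT hy
      exact ⟨p, T', fun _ => ⟨h1, h2, h3⟩⟩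
    · exact ⟨0, 0, fun h => absurd h hy⟩
  choose px Tx hpx using hdata
  have hcδ : 0 < c * δ0 := by positivity
  have hc1δ : c1 * δ0 = 10 * (c * δ0) := by rw [hc]; ring
  have hcδ1 : 10 * (c * δ0) ≤ δ0 := by rw [← hc1δ]; exact mul_le_of_le_one_left hδ0.le hc11
  obtain ⟨ρ, ρm, hρm, hρge, hρle, hρlip, hρgood, hρbad⟩ := exists_rho E
    (fun y δ => OK A E f V y δ0 (tr (y - x0) p0) M κ d δ) (K := K) (K' := K') (δ0 := δ0) (ρmax := c * δ0)
    hK0.le hcδ hKK' (by nlinarith)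
  have hρ0 : ∀ x, 0 < ρ x := fun x => hρm.trans_le (hρge x)
  choose zz hz1 hz2 hz3 using hρbad
  have hκk : κ ≤ (DD n r + 1) * κ := Nat.le_mul_of_pos_left _ (by omega)
  have hzx0 : ∀ x, ‖x - x0‖ ≤ c * δ0 → ‖zz x - x0‖ ≤ 2 * (c * δ0) := by
    intro x hx
    have := norm_sub_le_norm_sub_add_norm_sub (zz x) x x0
    linarith [hz2 x]
  -- uniqueness at bad points
  have hδb0 : ∀ x, 0 < K' * ρ x := fun x => mul_pos hK'0 (hρ0 x)
  have hδb2 : ∀ x, 40 * ρ x ≤ K' * ρ x := fun x => mul_le_mul_of_nonneg_right (by linarith) (hρ0 x).le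
  have hq0 : ∀ y z (p : Jet n r) (a : ℝ), ‖z - y‖ ≤ δ0 → p - tr (y - x0) p0 ∈ V →
      N δ0 (p - tr (y - x0) p0) ≤ a * M * δ0 ^ (r + 1) →
      tr (z - y) p - tr (z - x0) p0 ∈ V ∧
      N δ0 (tr (z - y) p - tr (z - x0) p0) ≤ b * a * M * δ0 ^ (r + 1) := by
    intro y z p a h1 h2 h3
    rw [tr_sub_q0]
    refine ⟨hV.tr _ h2, (N_tr2 hδ0.le h1 _).trans ?_⟩
    rw [← hb]
    calc b * N δ0 (p - tr (y - x0) p0) ≤ b * (a * M * δ0 ^ (r + 1)) := by gcongr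
      _ = _ := by ring
  have hcmp : ∀ x y, ‖x - x0‖ ≤ c * δ0 → ‖y - x0‖ ≤ c * δ0 → ‖zz x - y‖ ≤ K' * ρ x →
      N (K' * ρ x) (px (zz x) - tr (zz x - y) (px y)) ≤ CU1 * M * (K' * ρ x) ^ (r + 1) := by
    intro x y hx hy hzy
    have hz0 := hzx0 x hx
    obtain ⟨a1, a2, a3⟩ := hpx (zz x) (by linarith)
    obtain ⟨b1, b2, b3⟩ := hpx y (by linarith)
    obtain ⟨p'', g1, g2⟩ := transport' b3.center hM.le (hδb0 x) (zz x) hzy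
    have hzy' : ‖zz x - y‖ ≤ δ0 := by
      have := norm_sub_le_norm_sub_add_norm_sub (zz x) x0 y
      rw [norm_sub_rev x0 y] at this
      linarith
    obtain ⟨e1, e2⟩ := hq0 y (zz x) (px y) C1 hzy' b1 b2
    have hMM : M ≤ (1 + b * C1) * M := le_mul_of_one_le_left hM.le (by linarith)
    refine hU1 E f V (zz x) δ0 (K' * ρ x) M (px (zz x)) (tr (zz x - x0) p0) κ (Tx (zz x)) hV (by omega)
      (hδb0 x) hδ0 hM (a3.mono hM (by linarith) le_rfl le_rfl hκk le_rfl) a1 a2 (hz3 x) p'' _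
      (GamK.mono g1 le_rfl hMM) e1 (e2.trans ?_) (g2.trans ?_)
    · gcongr; linarith
    · have := hδb0 x
      gcongr
  -- local solutions
  have hloc : ∀ x, ∃ F : Euc n → Jet n r, ‖x - x0‖ ≤ c * δ0 →
      Wh (Metric.closedBall x (ρ x / 2)) (C8 * M) F ∧
      (∀ z, ‖z - x‖ ≤ ρ x / 2 → 0 ≤ ev (F z)) ∧ (∀ z ∈ E, ‖z - x‖ ≤ ρ x / 2 → ev (F z) = f z) ∧
      N (K' * ρ x) (F x - px x) ≤ C8 * M * (K' * ρ x) ^ (r + 1) := by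
    intro x
    by_cases hx : ‖x - x0‖ ≤ c * δ0
    swap
    · exact ⟨fun _ => 0, fun h => absurd h hx⟩
    have hρx := hρ0 x
    have hδb := hδb0 x
    have h40 := hδb2 x
    rcases hρgood x with hg | ⟨δ, hg1, hg2, p, hg3, hg4, V', hg5, hg6⟩
    · have hkk : 1 ≤ (DD n r + 1) * κ := hκ.trans hκk
      obtain ⟨F, hF, hFx⟩ := (hpx x (by linarith)).2.2.center _ (Finset.filter_subset _ E) (hg.trans hkk)
      refine ⟨F, fun _ => ⟨?_, fun z _ => hF.2.1 z, fun z hz hzx => hF.2.2 z (Finset.mem_filter.2 ⟨hz, hzx⟩), ?_⟩⟩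
      · exact hF.1.mono (Set.subset_univ _) (le_mul_of_one_le_left hM.le (by linarith))
      · rw [hFx, sub_self, N_zero]; positivity
    · have hd1 : om V' ≤ d - 1 := by omega
      obtain ⟨δ2, e1, e2, V'', e3, e4⟩ := hDS E f V' x δ (K * (ρ x / 2)) (4 * M) p κ hd1 (by positivity)
        hg1 (by positivity) hg6
      have hδ2 : 0 < δ2 := lt_of_lt_of_le (by positivity) e1
      obtain ⟨F, hF, hF0, hFE, hFN⟩ := hML E f V'' x δ2 (B * (4 * M)) p (by omega) hδ2 (by positivity) e4
      have hm1M : C5 * (B * (4 * M)) = m1 * M := by rw [hm1]; ring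
      rw [hm1M] at hF hFN
      have hc5δ : 10 * ρ x ≤ c5 * δ2 := by
        have h1 := mul_le_mul_of_nonneg_left e1 hc5.le
        have h2 : c5 * (s5 * (K * (ρ x / 2))) = (c5 * (s5 * K)) * (ρ x / 2) := by ring
        rw [h2, hcsK] at h1
        linarith
      have hδ2ρ : 10 * ρ x ≤ δ2 := hc5δ.trans (mul_le_of_le_one_left hδ2.le hc51)
      have hp : p ∈ GamK E f κ x (B * 4 * M) := by
        obtain ⟨T'', hT''⟩ := e4.2
        have := hT''.center
        rwa [← mul_assoc] at this
      have hN5 : N (5 / 2 * ρ x) (F x - p) ≤ m3 * M * (5 / 2 * ρ x) ^ (r + 1) := by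
        have h1 := N_chg (δ' := 5 / 2 * ρ x) (K := K) hδ2 (by positivity) (by linarith) (by
          refine e2.trans (mul_le_mul_of_nonneg_left (by linarith) hK0.le)) hFN
        refine h1.trans (le_of_eq ?_)
        rw [hm3]; ring
      have hbsub : Metric.closedBall x (4 * (5 / 2 * ρ x)) ⊆ Metric.closedBall x (c5 * δ2) :=
        Metric.closedBall_subset_closedBall (by linarith)
      have hFz : F (zz x) ∈ GamK E f κ (zz x) (m4 * M) := by
        have h1 := mem_of_local (ρ := 5 / 2 * ρ x) (z := zz x) (M1 := m1 * M) (M2 := B * 4 * M) (M3 := m3 * M) (by positivity) (by positivity)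
          (by positivity) (by positivity) (hF.mono hbsub le_rfl) (fun z hz => hF0 z (by linarith))
          (fun z hz hz' => hFE z hz (by linarith)) hp hN5 (by linarith [hz1 x])
        have h2 : Ct n r * (m1 * M + B * 4 * M + m3 * M) = m4 * M := by rw [hm4]; ring
        rwa [h2] at h1
      have hzx : ‖zz x - x‖ ≤ K' * ρ x := by linarith [hz1 x]
      have hzxδ : ‖zz x - x‖ ≤ δ0 := by linarith [hz2 x]
      have hδ2b : δ2 ≤ K' * ρ x := by
        refine e2.trans ?_
        have : K * (ρ x / 2) ≤ K' * ρ x := mul_le_mul (by linarith) (by linarith) (by positivity) hK'0.le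
        exact this
      have hFNb : N (K' * ρ x) (F x - p) ≤ m1 * M * (K' * ρ x) ^ (r + 1) := N_up' hδ2 hδ2b _ hFN
      have hz0 := hzx0 x hx
      obtain ⟨a1, a2, a3⟩ := hpx (zz x) (by linarith)
      obtain ⟨i1, i2⟩ := hq0 x (zz x) p A hzxδ hg3 hg4
      have hu := hU2 E f V (zz x) δ0 (K' * ρ x) M (px (zz x)) (tr (zz x - x0) p0) κ (Tx (zz x)) hV (by omega)
        hδb hδ0 hM (a3.mono hM (by linarith) le_rfl le_rfl hκk le_rfl) a1 a2 (hz3 x) (F (zz x)) (tr (zz x - x) p)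
        (GamK.mono hFz le_rfl (mul_le_mul_of_nonneg_right (by linarith) hM.le)) i1
        (i2.trans (by gcongr; linarith)) (by
          refine (N_sub_le hδb.le _ (tr (zz x - x) (F x)) _).trans ?_
          have j1 := Wh_scale hF (by positivity)
            (x := zz x) (y := x) (by rw [mem_closedBall_iff_norm]; linarith [hz1 x])
            (Metric.mem_closedBall_self (by positivity)) hδb hzx
          have j2 := N_tr2 hδb.le hzx (F x - p)
          rw [map_sub, ← hb] at j2
          have j3 := mul_le_mul_of_nonneg_left hFNb hb0.le
          have j4 : 0 ≤ (1 + b * A + m4) * M * (K' * ρ x) ^ (r + 1) := by positivity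
          calc _ ≤ m1 * M * (K' * ρ x) ^ (r + 1) + b * (m1 * M * (K' * ρ x) ^ (r + 1)) := add_le_add j1 (j2.trans j3)
            _ ≤ m1 * M * (K' * ρ x) ^ (r + 1) + b * (m1 * M * (K' * ρ x) ^ (r + 1)) + (1 + b * A + m4) * M * (K' * ρ x) ^ (r + 1) := by linarith
            _ = _ := by ring)
      have hu' := hcmp x x hx hx hzx
      have hpp : N (K' * ρ x) (p - px x) ≤ b * (CU1 + CU2) * M * (K' * ρ x) ^ (r + 1) := by
        refine (N_tr_back hδb.le hzx _).trans ?_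
        rw [map_sub, ← hb]
        have j1 := N_sub_le hδb.le (tr (zz x - x) p) (px (zz x)) (tr (zz x - x) (px x))
        rw [N_sub_comm _ (tr (zz x - x) p) (px (zz x))] at j1
        calc _ ≤ b * (CU2 * M * (K' * ρ x) ^ (r + 1) + CU1 * M * (K' * ρ x) ^ (r + 1)) := by
              refine mul_le_mul_of_nonneg_left (j1.trans (add_le_add hu hu')) hb0.le
          _ = _ := by ring
      refine ⟨F, fun _ => ⟨?_, fun z hz => hF0 z (by linarith), fun z hz hz' => hFE z hz (by linarith), ?_⟩⟩
      · exact hF.mono (Metric.closedBall_subset_closedBall (by linarith))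
          (mul_le_mul_of_nonneg_right (by linarith) hM.le)
      · refine (N_sub_le hδb.le _ p _).trans ((add_le_add hFNb hpp).trans ?_)
        have : 0 ≤ M * (K' * ρ x) ^ (r + 1) := by positivity
        rw [hC8]
        linarith
  choose FF' hFF using hloc
  obtain ⟨G, hG1, hG2, hG3, hG4⟩ := hGLUE E f x0 (c * δ0) (fun x => ρ x / 2) (ρm / 2) (C9 * M) FF'
    (by positivity) (by positivity) (fun x _ => by have := hρge x; linarith)
    (fun x _ y _ => by have := hρlip x y; have := norm_nonneg (x - y); linarith)
    (fun x hx => (hFF x (mem_closedBall_iff_norm.1 hx)).1.mono subset_rfl (mul_le_mul_of_nonneg_right hC89 hM.le))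
    (fun x hx => (hFF x (mem_closedBall_iff_norm.1 hx)).2.1)
    (fun x hx => (hFF x (mem_closedBall_iff_norm.1 hx)).2.2.1)
    (by
      intro x hx y hy hxy
      rw [mem_closedBall_iff_norm] at hx hy
      have hρx := hρ0 x
      have hδb := hδb0 x
      have h40 := hδb2 x
      have hx4 := (hFF x hx).2.2.2
      have hy4 := (hFF y hy).2.2.2
      have hzx : ‖zz x - x‖ ≤ K' * ρ x := by linarith [hz1 x]
      have hzy : ‖zz x - y‖ ≤ K' * ρ x := by
        have := norm_sub_le_norm_sub_add_norm_sub (zz x) x y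
        linarith [hz1 x]
      have hxy' : ‖x - y‖ ≤ K' * ρ x := by linarith
      have k1 := hcmp x x hx hx hzx
      have k2 := hcmp x y hx hy hzy
      have k3 : N (K' * ρ x) (px x - tr (x - y) (px y)) ≤ b * (2 * CU1) * M * (K' * ρ x) ^ (r + 1) := by
        refine (N_tr_back hδb.le hzx _).trans ?_
        rw [map_sub, tr_tr, sub_add_sub_cancel, ← hb]
        have j1 := N_sub_le hδb.le (tr (zz x - x) (px x)) (px (zz x)) (tr (zz x - y) (px y))
        rw [N_sub_comm _ (tr (zz x - x) (px x)) (px (zz x))] at j1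
        calc _ ≤ b * (CU1 * M * (K' * ρ x) ^ (r + 1) + CU1 * M * (K' * ρ x) ^ (r + 1)) := by
              refine mul_le_mul_of_nonneg_left (j1.trans (add_le_add k1 k2)) hb0.le
          _ = _ := by ring
      have k4 : N (K' * ρ x) (tr (x - y) (px y) - tr (x - y) (FF' y y)) ≤
          b * (C8 * 2 ^ (r + 1)) * M * (K' * ρ x) ^ (r + 1) := by
        rw [← map_sub]
        refine (N_tr2 hδb.le hxy' _).trans ?_
        rw [← hb, N_sub_comm]
        have l1 := N_chg (δ' := K' * ρ x) (K := 2) (hδb0 y) hδb.le (by norm_num) (by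
          have := hρlip y x
          rw [norm_sub_rev] at this
          have h2 : K' * ρ y ≤ K' * (2 * ρ x) := mul_le_mul_of_nonneg_left (by linarith) hK'0.le
          linarith) hy4
        calc _ ≤ b * (C8 * M * 2 ^ (r + 1) * (K' * ρ x) ^ (r + 1)) := mul_le_mul_of_nonneg_left l1 hb0.le
          _ = _ := by ring
      have k5 : N (K' * ρ x) (FF' x x - tr (x - y) (FF' y y)) ≤ C8' * M * (K' * ρ x) ^ (r + 1) := by
        refine (N_sub_le hδb.le _ (px x) _).trans ?_
        have := N_sub_le hδb.le (px x) (tr (x - y) (px y)) (tr (x - y) (FF' y y))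
        rw [hC8']
        linarith
      have k6 := N_chg (δ' := ρ x / 2) (K := 2 * K') hδb (by positivity) (by linarith) (by linarith) k5
      refine k6.trans (le_of_eq ?_)
      rw [hC9]; ring)
  refine ⟨G, hG1.mono subset_rfl ?_, fun z _ => hG2 z, fun z hz hzx => hG3 z hz (mem_closedBall_iff_norm.2 hzx), ?_⟩
  · rw [← mul_assoc]
    exact mul_le_mul_of_nonneg_right (by linarith) hM.le
  · have hx0 : ‖x0 - x0‖ ≤ c * δ0 := by simp; positivity
    have l1 := hG4 x0 (Metric.mem_closedBall_self hcδ.le)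
    have hρx := hρ0 x0
    have hle : ρ x0 ≤ δ0 := by linarith [hρle x0]
    have l2 := N_up' (by positivity) (by linarith : ρ x0 / 2 ≤ δ0) _ l1
    have l3 := N_chg (δ' := δ0) (K := K') (hδb0 x0) hδ0.le (by linarith)
      (mul_le_mul_of_nonneg_left hle hK'0.le) (hFF x0 hx0).2.2.2
    have l4 := (hpx x0 (by rw [sub_self, norm_zero]; positivity)).2.1
    rw [sub_self, tr_zero] at l4
    have l5 := N_sub_le hδ0.le (G x0) (FF' x0 x0) p0
    have l6 := N_sub_le hδ0.le (FF' x0 x0) (px x0) p0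
    calc _ ≤ Kg' * (C9 * M) * δ0 ^ (r + 1) + (C8 * M * K' ^ (r + 1) * δ0 ^ (r + 1) + C1 * M * δ0 ^ (r + 1)) := by
          linarith
      _ = _ := by ring

theorem ML (n r d : ℕ) : ∃ k : ℕ, 1 ≤ k ∧ ∀ C : ℝ, 1 ≤ C → ∃ c C' : ℝ, 0 < c ∧ c ≤ 1 ∧ 1 ≤ C' ∧ MLc n r d k C c C' := by
  induction d with
  | zero => exact ⟨1, le_rfl, fun C _ => ⟨1, 1, one_pos, le_rfl, le_rfl, fun E f V x0 δ0 M p0 h => absurd h (by omega)⟩⟩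
  | succ d ih =>
    obtain ⟨κ, hκ, ih⟩ := ih
    refine ⟨_, ?_, ML_step n r d κ hκ ih⟩
    have : 0 < (DD n r + 1) * ((DD n r + 1) * κ) := by positivity
    exact this

end NNI
end SecP7d

open scoped BigOperators
noncomputable section SecP8
namespace NNI
variable {n r : ℕ}

theorem FIN (n r : ℕ) : ∃ (k : ℕ) (C : ℝ), 1 ≤ C ∧ ∀ (E : Finset (Euc n)) (f : Euc n → ℝ),
    (∀ S : Finset (Euc n), S ⊆ E → S.card ≤ k → ∃ FS : Euc n → ℝ, CmLipNormLe (r + 1) n FS 1 ∧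
      (∀ y, 0 ≤ FS y) ∧ ∀ x ∈ S, FS x = f x) → ∀ R : ℝ, ∃ G : Euc n → Jet n r,
      Wh (Metric.closedBall 0 R) C G ∧ (∀ z, 0 ≤ ev (G z)) ∧
      (∀ z ∈ E, z ∈ Metric.closedBall (0 : Euc n) R → ev (G z) = f z) ∧
      ∀ x ∈ Metric.closedBall (0 : Euc n) R, N 1 (G x) ≤ C := by
  classical
  obtain ⟨k, hk, hML⟩ := ML n r (om (⊤ : Submodule ℝ (Jet n r)) + 1)
  obtain ⟨c, C', hc, hc1, hC', hM⟩ := hML 1 le_rfl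
  obtain ⟨K, hK, hG⟩ := GLUE n r
  obtain ⟨M, hMd⟩ : ∃ M : ℝ, M = max 1 (fcK n r) := ⟨_, rfl⟩
  have hM1 : 1 ≤ M := hMd ▸ le_max_left _ _
  have hMf : fcK n r ≤ M := hMd ▸ le_max_right _ _
  have hM0 : 0 < M := by linarith
  obtain ⟨B, hB⟩ : ∃ B : ℝ, B = (C' + 1) * M := ⟨_, rfl⟩
  have hB1 : 1 ≤ B := by rw [hB]; nlinarith
  have hb1 : (0:ℝ) < 2 ^ r := by positivity
  obtain ⟨A, hA⟩ : ∃ A : ℝ, A = C' * M + B * (1 + 2 ^ r) / c ^ (r + 1) := ⟨_, rfl⟩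
  have hq : 0 ≤ B * (1 + 2 ^ r) / c ^ (r + 1) := by positivity
  have hA0 : 0 ≤ A := by rw [hA]; positivity
  have hKA : 0 ≤ K * A := by positivity
  refine ⟨(DD n r + 1) * k, K * A + B, by linarith, ?_⟩
  intro E f hyp R
  have hp : ∀ x : Euc n, ∃ p : Jet n r, ∀ S, S ⊆ E → S.card ≤ k →
      p ∈ Gam f S x M ∩ {p | N 1 (p - 0) ≤ M} := by
    intro x
    refine helly_E E k (fun S => Gam f S x M ∩ {p | N 1 (p - 0) ≤ M}) ?_ ?_ ?_
    · intro S; exact (convex_Gam f S x M).inter (convex_N zero_le_one 0 M)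
    · rintro S S' h p ⟨⟨F, hF, hFx⟩, hp⟩
      exact ⟨⟨F, ⟨hF.1, hF.2.1, fun z hz => hF.2.2 z (h hz)⟩, hFx⟩, hp⟩
    · intro S hS hc
      obtain ⟨F, hF, hF0, hFS⟩ := hyp S hS hc
      obtain ⟨h1, h2, h3⟩ := FC zero_le_one hF
      rw [mul_one] at h1 h3
      refine ⟨jf r F x, ⟨jf r F, ⟨h1.mono subset_rfl hMf, ?_, ?_⟩, rfl⟩, ?_⟩
      · intro z; rw [h2]; exact hF0 z
      · intro z hz; rw [h2]; exact hFS z hz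
      · show N 1 (jf r F x - 0) ≤ M
        rw [sub_zero]; exact (h3 x).trans hMf
  choose p hp using hp
  have hpN : ∀ x, N 1 (p x) ≤ M := by
    intro x
    have := (hp x ∅ (by simp) (by simp)).2
    simpa using this
  have hF : ∀ x, ∃ F : Euc n → Jet n r, Wh (Metric.closedBall x c) (C' * M) F ∧
      (∀ z, ‖z - x‖ ≤ c → 0 ≤ ev (F z)) ∧
      (∀ z ∈ E, ‖z - x‖ ≤ c → ev (F z) = f z) ∧ N 1 (F x - p x) ≤ C' * M := by
    intro x
    have := hM E f ⊤ x 1 M (p x) (Nat.lt_succ_self _) one_pos hM0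
      ⟨DTI_top, 0, fun _ => trivial, fun q => by
        rw [LinearMap.zero_apply, N_zero, one_mul]; exact N_nonneg zero_le_one _, fun q _ => by
        rw [LinearMap.zero_apply, map_zero, smul_zero, add_zero]
        exact fun S hS hc => (hp x S hS hc).1⟩
    simpa only [mul_one, one_pow] using this
  choose F hF1 hF2 hF3 hF4 using hF
  have hFB : ∀ x, N 1 (F x x) ≤ B := by
    intro x
    have h := N_add zero_le_one (F x x - p x) (p x)
    rw [sub_add_cancel] at h
    have := hF4 x; have := hpN x
    rw [hB]; linarith
  obtain ⟨G, g1, g2, g3, g4⟩ := hG E f 0 R (fun _ => c) c A F hc hA0 (fun _ _ => le_rfl)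
    (fun x _ y _ => by have := norm_nonneg (x - y); linarith)
    (fun x _ => (hF1 x).mono subset_rfl (by rw [hA]; linarith))
    (fun x _ => hF2 x) (fun x _ => hF3 x) (by
      intro x _ y _ hxy
      have h1 := N_mono hc.le hc1 (F x x - tr (x - y) (F y y))
      have h2 := N_sub zero_le_one (F x x) (tr (x - y) (F y y))
      have h3 := N_tr2 zero_le_one (h := x - y) (by linarith) (F y y)
      have h4 := mul_le_mul_of_nonneg_left (hFB y) hb1.le
      have h5 := hFB x
      have h6 : B * (1 + 2 ^ r) / c ^ (r + 1) * c ^ (r + 1) = B * (1 + 2 ^ r) := by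
        field_simp
      have h7 : 0 ≤ C' * M * c ^ (r + 1) := by positivity
      rw [hA, add_mul, h6]; linarith)
  refine ⟨G, g1.mono subset_rfl (by linarith), g2, g3, ?_⟩
  intro x hx
  have h1 := N_up' hc hc1 _ (g4 x hx)
  have h2 := N_add zero_le_one (G x - F x x) (F x x)
  rw [sub_add_cancel] at h2
  have := hFB x
  rw [one_pow, mul_one] at h1
  linarith

open Filter Topology in
theorem CPT (E : Set (Euc n)) (f : Euc n → ℝ) (C : ℝ)
    (h : ∀ E' : Finset (Euc n), (E' : Set (Euc n)) ⊆ E → ∀ R : ℝ, ∃ G : Euc n → Jet n r,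
      Wh (Metric.closedBall 0 R) C G ∧ (∀ z, 0 ≤ ev (G z)) ∧
      (∀ z ∈ E', z ∈ Metric.closedBall (0 : Euc n) R → ev (G z) = f z) ∧
      ∀ x ∈ Metric.closedBall (0 : Euc n) R, N 1 (G x) ≤ C) :
    ∃ G : Euc n → Jet n r, Wh Set.univ C G ∧ (∀ z, 0 ≤ ev (G z)) ∧ (∀ z ∈ E, ev (G z) = f z) ∧
      ∀ x, N 1 (G x) ≤ C := by
  classical
  have hs : ∀ s : Finset (Euc n), ∃ G : Euc n → Jet n r, Wh (s : Set (Euc n)) C G ∧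
      (∀ z, 0 ≤ ev (G z)) ∧ (∀ z ∈ s, z ∈ E → ev (G z) = f z) ∧ ∀ x ∈ s, N 1 (G x) ≤ C := by
    intro s
    have hR : ∀ z ∈ s, z ∈ Metric.closedBall (0 : Euc n) (∑ w ∈ s, ‖w‖) := by
      intro z hz
      rw [mem_closedBall_zero_iff]
      exact Finset.single_le_sum (f := fun w : Euc n => ‖w‖) (fun w _ => norm_nonneg w) hz
    obtain ⟨G, h1, h2, h3, h4⟩ := h (s.filter (· ∈ E)) (by intro z hz; simp at hz; exact hz.2)
      (∑ w ∈ s, ‖w‖)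
    exact ⟨G, h1.mono (fun z hz => hR z hz) le_rfl, h2,
      fun z hz hzE => h3 z (by simp [hz, hzE]) (hR z hz), fun x hx => h4 x (hR x hx)⟩
  choose G h1 h2 h3 h4 using hs
  let U : Ultrafilter (Finset (Euc n)) := Ultrafilter.of atTop
  have hU : (U : Filter (Finset (Euc n))) ≤ atTop := Ultrafilter.of_le _
  have hev : ∀ x : Euc n, ∀ᶠ s in (U : Filter (Finset (Euc n))), x ∈ s := by
    intro x
    refine hU ((eventually_ge_atTop {x}).mono fun s hs => hs (by simp))
  have hL : ∀ x, ∃ L : Jet n r, Tendsto (fun s => G s x) U (𝓝 L) := by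
    intro x
    have hc : IsCompact (Metric.closedBall (0 : Jet n r) C) := isCompact_closedBall _ _
    obtain ⟨L, _, hL⟩ := hc.ultrafilter_le_nhds (U.map (fun s => G s x)) (by
      rw [le_principal_iff]
      refine (hev x).mono fun s hs => ?_
      rw [mem_closedBall_zero_iff]
      exact (norm_le_N1 _).trans (h4 s x hs))
    exact ⟨L, hL⟩
  choose L hL using hL
  have cev : Continuous (fun p : Jet n r => ev p) := ev.continuous_of_finiteDimensional
  refine ⟨L, ?_, ?_, ?_, ?_⟩
  · intro x _ y _
    have ctr : Continuous (fun p : Jet n r => tr (x - y) p) :=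
      (tr (x - y)).continuous_of_finiteDimensional
    have ht := ((continuous_N ‖x - y‖).tendsto _).comp
      ((hL x).sub ((ctr.tendsto _).comp (hL y)))
    refine le_of_tendsto ht ?_
    filter_upwards [hev x, hev y] with s hx hy
    exact h1 s x hx y hy
  · intro z
    exact ge_of_tendsto ((cev.tendsto _).comp (hL z)) (Eventually.of_forall fun s => h2 s z)
  · intro z hz
    refine tendsto_nhds_unique ((cev.tendsto _).comp (hL z)) (tendsto_const_nhds.congr' ?_)
    filter_upwards [hev z] with s hs
    exact (h3 s z hs hz).symm
  · intro x
    refine le_of_tendsto (((continuous_N 1).tendsto _).comp (hL x)) ?_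
    filter_upwards [hev x] with s hs
    exact h4 s x hs

theorem final (m n : ℕ) (hm : 0 < m) :
    ∃ (kSharp : ℕ) (CSharp : ℝ), 0 < CSharp ∧
      ∀ (E : Set (Euc n)), ∀ f : Euc n → ℝ, (∀ x ∈ E, 0 ≤ f x) →
        (∀ S : Set (Euc n), S ⊆ E → S.Finite → S.ncard ≤ kSharp →
          ∃ FS : Euc n → ℝ, CmLipNormLe m n FS 1 ∧ (∀ y, 0 ≤ FS y) ∧ ∀ x ∈ S, FS x = f x) →
        ∃ F : Euc n → ℝ, CmLipNormLe m n F CSharp ∧ (∀ y, 0 ≤ F y) ∧ ∀ x ∈ E, F x = f x := by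
  obtain ⟨r, rfl⟩ : ∃ r, m = r + 1 := ⟨m - 1, by omega⟩
  obtain ⟨k, C, hC, h⟩ := FIN n r
  refine ⟨k, (r.factorial : ℝ) ^ n * C, by positivity, ?_⟩
  intro E f _ hyp
  obtain ⟨G, g1, g2, g3, g4⟩ := CPT (r := r) E f C (fun E' hE' R => h E' f (fun S hS hc => by
    obtain ⟨F, a, b, c⟩ := hyp (S : Set (Euc n)) (fun z hz => hE' (hS hz)) S.finite_toSet
      (by rwa [Set.ncard_coe_finset])
    exact ⟨F, a, b, fun x hx => c x hx⟩) R)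
  exact ⟨fun x => ev (G x), BC (by linarith) g1 g4, g2, g3⟩

end NNI
end SecP8

/-- **Finiteness principle for nonnegative `C^{m-1,1}` interpolation** (Theorem, part (B)). -/
theorem nonneg_Cm11_interpolation_finiteness (m n : ℕ) (hm : 0 < m) (hn : 0 < n) :
    ∃ (kSharp : ℕ) (CSharp : ℝ), 0 < CSharp ∧
      ∀ (E : Set (Euc n)), ∀ f : Euc n → ℝ, (∀ x ∈ E, 0 ≤ f x) →
        (∀ S : Set (Euc n), S ⊆ E → S.Finite → S.ncard ≤ kSharp →
          ∃ FS : Euc n → ℝ, CmLipNormLe m n FS 1 ∧ (∀ y, 0 ≤ FS y) ∧ ∀ x ∈ S, FS x = f x) →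
        ∃ F : Euc n → ℝ, CmLipNormLe m n F CSharp ∧ (∀ y, 0 ≤ F y) ∧ ∀ x ∈ E, F x = f x := by
  exact NNI.final m n hm

end
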